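/- Suppose A is a separable unital commutative C*-algebra, M is a von Neumann algebra on a complex Hilbert space, and π ∈ Rep(A,M). Then the closure U_M(π)⁻ of the unitary orbit of π in the topology of pointwise norm convergence is path-connected; in fact, for every ρ ∈ U_M(π)⁻ there is a strong internal path from π to ρ, i.e., a continuous map γ: [0,1) → U_M with ‖γ(t)* π(a) γ(t) − ρ(a)‖ → 0 as t → 1⁻ for every a ∈ A. -/

import Mathlib

open Filter

variable {A H : Type*}

/-- The unitary orbit of a representation `π : A → B(H)` under conjugation by unitaries of a
von Neumann algebra `M`, as a set of functions `A → B(H)` (with the topology of pointwise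
norm convergence, i.e. the product topology). -/
def unitaryOrbitVN [CStarAlgebra A] [NormedAddCommGroup H]
    [InnerProductSpace ℂ H] [CompleteSpace H] (M : VonNeumannAlgebra H)
    (π : A →⋆ₐ[ℂ] (H →L[ℂ] H)) : Set (A → (H →L[ℂ] H)) :=
  {f | ∃ u : H →L[ℂ] H, u ∈ M ∧ u ∈ unitary (H →L[ℂ] H) ∧ f = fun a => star u * π a * u}

/-- A strong internal path from `π` to `ρ`: a norm-continuous family `γ : [0,1) → U_M` of
unitaries of `M` such that `γ(t)* π(a) γ(t) → ρ(a)` in norm as `t → 1⁻`, for every `a`. -/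
def StrongInternalPathVN [CStarAlgebra A] [NormedAddCommGroup H]
    [InnerProductSpace ℂ H] [CompleteSpace H] (M : VonNeumannAlgebra H)
    (π ρ : A →⋆ₐ[ℂ] (H →L[ℂ] H)) : Prop :=
  ∃ γ : ℝ → (H →L[ℂ] H),
    ContinuousOn γ (Set.Ico 0 1) ∧
    (∀ t ∈ Set.Ico (0 : ℝ) 1, γ t ∈ M ∧ γ t ∈ unitary (H →L[ℂ] H)) ∧
    ∀ a : A, Tendsto (fun t => star (γ t) * π a * γ t)
      (nhdsWithin 1 (Set.Ico 0 1)) (nhds (ρ a))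

set_option linter.unusedSectionVars false

namespace VN

/-- A star ring in which elements have polar decompositions, families of projections have
suprema, and orthogonal families of partial isometries can be added up. -/
class VNRing (R : Type*) [Ring R] [StarRing R] : Prop where
  polar : ∀ t : R, ∃ v : R, v * (star v * v) = v ∧ t * (star v * v) = t ∧
    (∀ x, t * x = 0 → v * x = 0) ∧ ∀ y, y * t = 0 → y * v = 0
  sup : ∀ S : Set R, (∀ p ∈ S, IsStarProjection p) → ∃ e, IsStarProjection e ∧
    (∀ p ∈ S, e * p = p) ∧ ∀ x, (∀ p ∈ S, x * p = 0) → x * e = 0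
  sum : ∀ S : Set R, (∀ v ∈ S, v * (star v * v) = v) →
    (∀ v ∈ S, ∀ w ∈ S, v ≠ w → star v * w = 0 ∧ v * star w = 0) →
    ∃ u : R, ∀ v ∈ S, u * (star v * v) = v ∧ v * star v * u = v

variable {R : Type*} [Ring R] [StarRing R]

theorem asc {a b c : R} (h : a * b = c) (x : R) : a * (b * x) = c * x := by
  rw [← mul_assoc, h]

theorem _root_.IsStarProjection.mm {p : R} (hp : IsStarProjection p) : p * p = p :=
  hp.isIdempotentElem.eq

theorem _root_.IsStarProjection.st {p : R} (hp : IsStarProjection p) : star p = p :=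
  hp.isSelfAdjoint.star_eq

theorem _root_.IsStarProjection.le_symm {p q : R} (hp : IsStarProjection p)
    (hq : IsStarProjection q) (h : q * p = p) : p * q = p := by
  simpa [hp.st, hq.st] using congrArg star h

theorem _root_.IsStarProjection.orth_symm {p q : R} (hp : IsStarProjection p)
    (hq : IsStarProjection q) (h : q * p = 0) : p * q = 0 := by
  simpa [hp.st, hq.st] using congrArg star h

theorem isStarProjection_mk {p : R} (h1 : p * p = p) (h2 : star p = p) : IsStarProjection p :=
  ⟨h1, h2⟩

theorem _root_.IsStarProjection.sub' {p q : R} (hp : IsStarProjection p)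
    (hq : IsStarProjection q) (h : q * p = p) : IsStarProjection (q - p) := by
  refine isStarProjection_mk ?_ (by simp [hp.st, hq.st])
  simp [mul_sub, sub_mul, hp.mm, hq.mm, h, hp.le_symm hq h]

theorem _root_.IsStarProjection.add' {p q : R} (hp : IsStarProjection p)
    (hq : IsStarProjection q) (h : q * p = 0) : IsStarProjection (q + p) := by
  refine isStarProjection_mk ?_ (by simp [hp.st, hq.st])
  simp [mul_add, add_mul, hp.mm, hq.mm, h, hp.orth_symm hq h]

theorem _root_.IsStarProjection.mul' {p q : R} (hp : IsStarProjection p)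
    (hq : IsStarProjection q) (h : q * p = p * q) : IsStarProjection (q * p) := by
  refine isStarProjection_mk ?_ (by simp [hp.st, hq.st, h])
  rw [mul_assoc, asc h.symm, mul_assoc, hp.mm, asc hq.mm]

/-- `v` is a partial isometry from `p` to `q`. -/
structure PIso (v p q : R) : Prop where
  source : star v * v = p
  fin : v * star v = q
  mul_init : v * p = v

namespace PIso

variable {v w p q r p' q' : R}

theorem star_fin (h : PIso v p q) : star v * q = star v := by
  have := congrArg star h.mul_init
  rw [← h.fin, ← mul_assoc, h.source]
  rw [star_mul, ← h.source, star_mul, star_star, h.source] at this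
  exact this

theorem init_star (h : PIso v p q) : p * star v = star v := by
  rw [← h.source, mul_assoc, h.fin, h.star_fin]

theorem fin_mul (h : PIso v p q) : q * v = v := by
  rw [← h.fin, mul_assoc, h.source, h.mul_init]

theorem left (h : PIso v p q) : IsStarProjection p := by
  refine isStarProjection_mk ?_ ?_
  · have := congrArg (star v * ·) h.mul_init
    simpa only [← mul_assoc, h.source] using this
  · simp [← h.source]

theorem symm (h : PIso v p q) : PIso (star v) q p :=
  ⟨by rw [star_star, h.fin], by rw [star_star, h.source], h.star_fin⟩

theorem right (h : PIso v p q) : IsStarProjection q := h.symm.left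

theorem refl (h : IsStarProjection p) : PIso p p p :=
  ⟨by rw [h.st, h.mm], by rw [h.st, h.mm], h.mm⟩

theorem trans (h : PIso v p q) (k : PIso w q r) : PIso (w * v) p r := by
  refine ⟨?_, ?_, ?_⟩
  · rw [star_mul, mul_assoc, ← mul_assoc _ w, k.source, h.fin_mul, h.source]
  · rw [star_mul, mul_assoc, asc h.fin, k.symm.fin_mul, k.fin]
  · rw [mul_assoc, h.mul_init]

theorem add (h : PIso v p q) (k : PIso w p' q') (hp : p * p' = 0) (hq : q * q' = 0) :
    PIso (v + w) (p + p') (q + q') := by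
  have e1 : star v * w = 0 := by
    rw [← h.star_fin, ← k.fin_mul, mul_assoc, asc hq]; simp
  have e2 : star w * v = 0 := by simpa using congrArg star e1
  have e3 : v * star w = 0 := by
    rw [← h.mul_init, ← k.init_star, mul_assoc, asc hp]; simp
  have e4 : w * star v = 0 := by simpa using congrArg star e3
  have e5 : v * p' = 0 := by rw [← h.mul_init, mul_assoc, hp, mul_zero]
  have e6 : w * p = 0 := by
    rw [← k.mul_init, mul_assoc, k.left.orth_symm h.left hp, mul_zero]
  refine ⟨?_, ?_, ?_⟩
  · simp [mul_add, add_mul, h.source, k.source, e1, e2]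
  · simp [mul_add, add_mul, h.fin, k.fin, e3, e4]
  · simp [mul_add, add_mul, h.mul_init, k.mul_init, e5, e6]

theorem restrict (h : PIso v p q) (hr : IsStarProjection r) (hrp : p * r = r) :
    PIso (v * r) r (v * r * star v) := by
  refine ⟨?_, ?_, ?_⟩
  · rw [star_mul, hr.st, mul_assoc, asc h.source, hrp, hr.mm]
  · rw [star_mul, hr.st, mul_assoc, asc hr.mm, mul_assoc]
  · rw [mul_assoc, hr.mm]

theorem cut {z : R} (h : PIso v p q) (hz : IsStarProjection z) (hc : ∀ x, z * x = x * z) :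
    PIso (z * v) (z * p) (z * q) := by
  refine ⟨?_, ?_, ?_⟩
  · rw [star_mul, hz.st, mul_assoc, asc hz.mm, hc, ← mul_assoc, h.source, hc]
  · rw [star_mul, hz.st, ← hc, mul_assoc, ← mul_assoc v, ← hc v, mul_assoc, asc hz.mm, h.fin]
  · rw [mul_assoc, ← mul_assoc v, ← hc v, mul_assoc, asc hz.mm, h.mul_init]

end PIso

def Eqv (p q : R) : Prop := ∃ v, PIso v p q

/-- Murray–von Neumann subequivalence. -/
def Le (p q : R) : Prop := ∃ r, Eqv p r ∧ q * r = r

/-- Central projections. -/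
structure Cen (z : R) : Prop where
  proj : IsStarProjection z
  comm : ∀ x, z * x = x * z

namespace Cen
variable {z z' : R}

theorem compl (h : Cen z) : Cen (1 - z) :=
  ⟨h.proj.one_sub, fun x => by simp [sub_mul, mul_sub, h.comm]⟩

theorem mul (h : Cen z) (h' : Cen z') : Cen (z * z') :=
  ⟨h'.proj.mul' h.proj (h.comm _), fun x => by rw [mul_assoc, h'.comm, ← mul_assoc, h.comm,
    mul_assoc]⟩

theorem one : Cen (1 : R) := ⟨.one R, by simp⟩

theorem mul_proj {p : R} (h : Cen z) (hp : IsStarProjection p) : IsStarProjection (z * p) :=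
  hp.mul' h.proj (h.comm _)

theorem mul_compl (h : Cen z) (x : R) : z * ((1 - z) * x) = 0 := by
  rw [sub_mul, mul_sub, asc h.proj.mm, one_mul, sub_self]

theorem orth {p q : R} (h : Cen z) : (z * p) * ((1 - z) * q) = 0 := by
  rw [h.comm, mul_assoc, h.mul_compl, mul_zero]

theorem add_eq {p : R} : z * p + (1 - z) * p = p := by simp [sub_mul]

end Cen

namespace Eqv
variable {p q r p' q' z : R}

theorem left (h : Eqv p q) : IsStarProjection p := h.choose_spec.left

theorem right (h : Eqv p q) : IsStarProjection q := h.choose_spec.right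

theorem refl (h : IsStarProjection p) : Eqv p p := ⟨p, .refl h⟩

theorem symm (h : Eqv p q) : Eqv q p := ⟨_, h.choose_spec.symm⟩

theorem trans (h : Eqv p q) (k : Eqv q r) : Eqv p r := ⟨_, h.choose_spec.trans k.choose_spec⟩

theorem add (h : Eqv p q) (k : Eqv p' q') (hp : p * p' = 0) (hq : q * q' = 0) :
    Eqv (p + p') (q + q') := ⟨_, h.choose_spec.add k.choose_spec hp hq⟩

theorem cut (h : Eqv p q) (hz : Cen z) : Eqv (z * p) (z * q) :=
  ⟨_, h.choose_spec.cut hz.proj hz.comm⟩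

theorem le (h : Eqv p q) : Le p q := ⟨q, h, h.right.mm⟩

theorem glue (hz : Cen z) (h : Eqv (z * p) (z * q)) (k : Eqv ((1 - z) * p) ((1 - z) * q)) :
    Eqv p q := by
  have := h.add k hz.orth hz.orth
  rwa [Cen.add_eq, Cen.add_eq] at this

end Eqv

theorem conj_proj {v p q r : R} (h : PIso v p q) (hr : IsStarProjection r) (hrp : p * r = r) :
    IsStarProjection (v * r * star v) := (h.restrict hr hrp).right

namespace Le
variable {p q r p' q' z : R}

theorem left (h : Le p q) : IsStarProjection p := by
  obtain ⟨r, h, -⟩ := h; exact h.left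

theorem of_le (hp : IsStarProjection p) (h : q * p = p) : Le p q := ⟨p, .refl hp, h⟩

theorem refl (hp : IsStarProjection p) : Le p p := of_le hp hp.mm

theorem mono (h : Le p q) (hr : r * q = q) : Le p r := by
  obtain ⟨s, h, hs⟩ := h
  exact ⟨s, h, by rw [← hs, asc hr]⟩

theorem trans (h : Le p q) (k : Le q r) : Le p r := by
  obtain ⟨s, h, hs⟩ := h
  obtain ⟨t, ⟨w, k⟩, ht⟩ := k
  refine ⟨w * s * star w, h.trans ⟨_, k.restrict h.right hs⟩, ?_⟩
  have : r * w = w := by rw [← k.fin_mul, asc ht]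
  rw [mul_assoc, asc this]

theorem sub_left (h : Le p q) (hr : IsStarProjection r) (hrp : p * r = r) : Le r q :=
  (of_le hr hrp).trans h

theorem add (h : Le p q) (k : Le p' q') (hq : IsStarProjection q) (hq' : IsStarProjection q')
    (h1 : p * p' = 0) (h2 : q * q' = 0) :
    Le (p + p') (q + q') := by
  obtain ⟨s, h, hs⟩ := h
  obtain ⟨s', h', hs'⟩ := k
  have e : q' * q = 0 := hq'.orth_symm hq h2
  refine ⟨s + s', h.add h' h1 ?_, ?_⟩
  · rw [← h.right.le_symm hq hs, ← hs', mul_assoc, asc h2]; simp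
  · have e1 : q' * s = 0 := by rw [← hs, asc e, zero_mul]
    have e2 : q * s' = 0 := by rw [← hs', asc h2, zero_mul]
    simp [mul_add, add_mul, hs, hs', e1, e2]

theorem cut (h : Le p q) (hz : Cen z) : Le (z * p) (z * q) := by
  obtain ⟨s, h, hs⟩ := h
  exact ⟨z * s, h.cut hz, by rw [mul_assoc, ← mul_assoc q, ← hz.comm q, mul_assoc, hs,
    asc hz.proj.mm]⟩

end Le

section cen
variable {p q z : R}

theorem Le.glue (hz : Cen z) (hq : IsStarProjection q) (h : Le (z * p) (z * q))
    (k : Le ((1 - z) * p) ((1 - z) * q)) : Le p q := by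
  have := h.add k (hz.mul_proj hq) (hz.compl.mul_proj hq) hz.orth hz.orth
  rwa [Cen.add_eq, Cen.add_eq] at this

end cen

end VN

namespace VN
variable {R : Type*} [Ring R] [StarRing R]

structure IsSup {ι : Type*} (f : ι → R) (e : R) : Prop where
  proj : IsStarProjection e
  le : ∀ i, e * f i = f i
  least : ∀ x, (∀ i, x * f i = 0) → x * e = 0

namespace IsSup
variable {ι : Type*} {f : ι → R} {e e' g x z : R}

theorem le_of (h : IsSup f e) (hg : ∀ i, g * f i = f i) : g * e = e := by
  have := h.least (1 - g) (fun i => by rw [sub_mul, hg, one_mul, sub_self])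
  rw [sub_mul, one_mul, sub_eq_zero] at this
  exact this.symm

theorem le' (h : IsSup f e) (hf : ∀ i, IsStarProjection (f i)) (i) : f i * e = f i :=
  (hf i).le_symm h.proj (h.le i)

theorem zero_left (h : IsSup f e) (hf : ∀ i, IsStarProjection (f i)) (hx : ∀ i, f i * x = 0) :
    e * x = 0 := by
  have := h.least (star x) (fun i => by simpa [(hf i).st] using congrArg star (hx i))
  simpa [h.proj.st] using congrArg star this

theorem comm (h : IsSup f e) (hf : ∀ i, IsStarProjection (f i)) (hx : ∀ i, x * f i = f i * x) :
    x * e = e * x := by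
  have h1 : (1 - e) * x * e = 0 := h.least _ fun i => by
    rw [mul_assoc, hx, ← mul_assoc, sub_mul, h.le]; simp
  have h2 : e * (x * (1 - e)) = 0 := h.zero_left hf fun i => by
    rw [← mul_assoc, ← hx, mul_assoc, mul_sub, h.le' hf]; simp
  have e1 : x * e = e * (x * e) := by
    simpa [sub_mul, mul_assoc, sub_eq_zero] using h1
  have e2 : e * x = e * (x * e) := by
    simpa [mul_sub, mul_assoc, sub_eq_zero] using h2
  rw [e1, ← e2]

theorem cen (h : IsSup f e) (hf : ∀ i, Cen (f i)) : Cen e :=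
  ⟨h.proj, fun x => (h.comm (fun i => (hf i).proj) fun i => ((hf i).comm x).symm).symm⟩

theorem cut (h : IsSup f e) (hz : Cen z) : IsSup (fun i => z * f i) (z * e) :=
  ⟨hz.mul_proj h.proj, fun i => by rw [mul_assoc, ← mul_assoc e, ← hz.comm e, mul_assoc, h.le,
    asc hz.proj.mm],
    fun x hx => by rw [← mul_assoc]; exact h.least _ fun i => by rw [mul_assoc, hx]⟩

end IsSup

variable [VNRing R]

theorem exists_isSup {ι : Type*} {f : ι → R} (hf : ∀ i, IsStarProjection (f i)) :
    ∃ e, IsSup f e := by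
  obtain ⟨e, h1, h2, h3⟩ := VNRing.sup (Set.range f) (by rintro _ ⟨i, rfl⟩; exact hf i)
  exact ⟨e, h1, fun i => h2 _ ⟨i, rfl⟩, fun x hx => h3 x (by rintro _ ⟨i, rfl⟩; exact hx i)⟩

theorem exists_polar (t : R) : ∃ v p q, PIso v p q ∧ t * p = t ∧ (∀ x, t * x = 0 → p * x = 0) ∧
    ∀ y, y * t = 0 → y * q = 0 := by
  obtain ⟨v, h1, h2, h3, h4⟩ := VNRing.polar t
  exact ⟨v, _, _, ⟨rfl, rfl, h1⟩, h2, fun x hx => by rw [mul_assoc, h3 x hx, mul_zero],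
    fun y hy => by rw [← mul_assoc, h4 y hy, zero_mul]⟩

theorem exists_sum {ι : Type*} {v p q : ι → R} {P Q : R} (h : ∀ i, PIso (v i) (p i) (q i))
    (hp : ∀ i j, i ≠ j → p i * p j = 0) (hq : ∀ i j, i ≠ j → q i * q j = 0)
    (hP : IsSup p P) (hQ : IsSup q Q) :
    ∃ u, PIso u P Q ∧ ∀ i, u * p i = v i ∧ q i * u = v i := by
  obtain ⟨u, hu⟩ := VNRing.sum (Set.range v)
    (by rintro _ ⟨i, rfl⟩; rw [(h i).source, (h i).mul_init]) (by
      rintro _ ⟨i, rfl⟩ _ ⟨j, rfl⟩ hij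
      have hij : i ≠ j := fun e => hij (e ▸ rfl)
      constructor
      · rw [← (h i).star_fin, ← (h j).fin_mul, mul_assoc, asc (hq i j hij)]; simp
      · rw [← (h i).mul_init, ← (h j).init_star, mul_assoc, asc (hp i j hij)]; simp)
  have hp' := fun i => (h i).left
  have hq' := fun i => (h i).right
  have u1 : ∀ i, u * p i = v i := fun i => by rw [← (h i).source]; exact (hu _ ⟨i, rfl⟩).1
  have u2 : ∀ i, q i * u = v i := fun i => by rw [← (h i).fin]; exact (hu _ ⟨i, rfl⟩).2
  have a1 : ∀ i, (u * P) * p i = v i := fun i => by rw [mul_assoc, hP.le, u1]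
  have a2 : ∀ i, q i * (u * P) = v i := fun i => by
    rw [← mul_assoc, u2, ← (h i).mul_init, mul_assoc, hP.le' hp']
  have a3 : ∀ i, star (u * P) * v i = p i := fun i => by
    have : star (u * P) * q i = star (v i) := by simpa [(hq' i).st] using congrArg star (a2 i)
    rw [← (h i).fin_mul, ← mul_assoc, this, (h i).source]
  have a4 : ∀ i, (u * P) * star (v i) = q i := fun i => by
    rw [← (h i).init_star, ← mul_assoc, a1, (h i).fin]
  have b1 : star (u * P) * (u * P) = P := by
    have := hP.least (star (u * P) * (u * P) - P) fun i => by
      rw [sub_mul, mul_assoc, a1, a3, hP.le, sub_self]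
    rw [sub_mul, hP.proj.mm, sub_eq_zero] at this
    rwa [mul_assoc _ _ P, mul_assoc _ P P, hP.proj.mm] at this
  have b2 : Q * (u * P) = u * P := by
    have := hP.least ((1 - Q) * (u * P)) fun i => by
      rw [mul_assoc, a1, ← (h i).fin_mul, ← mul_assoc, sub_mul, hQ.le]; simp
    rw [mul_assoc, mul_assoc, hP.proj.mm, sub_mul, one_mul, sub_eq_zero] at this
    exact this.symm
  have b3 : (u * P) * star (u * P) = Q := by
    have := hQ.least ((u * P) * star (u * P) - Q) fun i => by
      have : star (u * P) * q i = star (v i) := by simpa [(hq' i).st] using congrArg star (a2 i)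
      rw [sub_mul, mul_assoc, this, a4, hQ.le, sub_self]
    rw [sub_mul, hQ.proj.mm, sub_eq_zero, mul_assoc] at this
    have b2' := congrArg star b2
    rw [star_mul, hQ.proj.st] at b2'
    rwa [b2'] at this
  exact ⟨u * P, ⟨b1, b3, by rw [mul_assoc, hP.proj.mm]⟩, fun i => ⟨a1 i, a2 i⟩⟩

theorem Eqv.sup {ι : Type*} {p q : ι → R} {P Q : R} (h : ∀ i, Eqv (p i) (q i))
    (hp : ∀ i j, i ≠ j → p i * p j = 0) (hq : ∀ i j, i ≠ j → q i * q j = 0)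
    (hP : IsSup p P) (hQ : IsSup q Q) : Eqv P Q := by
  choose v hv using h
  obtain ⟨u, hu, -⟩ := exists_sum hv hp hq hP hQ
  exact ⟨u, hu⟩

/-- Schröder–Bernstein for projections. -/
theorem Le.antisymm {p q : R} (h : Le p q) (k : Le q p) : Eqv p q := by
  obtain ⟨q1, ⟨v, hv⟩, hq1⟩ := h
  obtain ⟨p1, ⟨w, hw⟩, hp1⟩ := k
  have hp := hv.left
  have hq := hw.left
  have qv : q * v = v := by rw [← hv.fin_mul, asc hq1]
  have pw : p * w = w := by rw [← hw.fin_mul, asc hp1]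
  set T := w * v with hT
  have TT : star T * T = p := by
    rw [hT, star_mul, mul_assoc, ← mul_assoc _ w, hw.source, qv, hv.source]
  have pT : p * T = T := by rw [hT, asc pw]
  have hTp : T * p = T := by rw [hT, mul_assoc, hv.mul_init]
  have hTi : PIso T p (T * star T) := ⟨TT, rfl, hTp⟩
  have Tsp : star T * p = star T := by simpa [hp.st] using congrArg star pT
  have pTs : p * star T = star T := by simpa [hp.st] using congrArg star hTp
  set c := p - p1 with hc
  have hcp : IsStarProjection c := hw.right.sub' hp hp1
  have pc : p * c = c := by rw [hc, mul_sub, hp.mm, hp1]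
  have cT : c * T = 0 := by rw [hc, sub_mul, pT, hT, asc hw.fin_mul, sub_self]
  have Tc : star T * c = 0 := by simpa [hcp.st] using congrArg star cT
  obtain ⟨f, f0, fs⟩ : ∃ f : ℕ → R, f 0 = c ∧ ∀ n, f (n + 1) = T * f n * star T :=
    ⟨fun n => Nat.rec c (fun _ x => T * x * star T) n, rfl, fun _ => rfl⟩
  have hf : ∀ n, IsStarProjection (f n) ∧ p * f n = f n := by
    intro n
    induction n with
    | zero => exact ⟨f0 ▸ hcp, f0 ▸ pc⟩
    | succ n ih =>
      refine ⟨fs n ▸ conj_proj hTi ih.1 ih.2, ?_⟩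
      rw [fs, mul_assoc, asc pT]
  obtain ⟨E, hE⟩ := exists_isSup (f := f) fun n => (hf n).1
  have pE : p * E = E := hE.le_of fun n => (hf n).2
  have Ep : E * p = E := hE.proj.le_symm hp pE
  have Ec : E * c = c := f0 ▸ hE.le 0
  have cE : c * E = c := hcp.le_symm hE.proj Ec
  have ETE : E * (T * E) = T * E := by
    have := hE.least ((1 - E) * T) fun n => by
      have := hE.le (n + 1)
      rw [fs] at this
      have t2 := congrArg (· * T) this
      simp only [mul_assoc, TT] at t2
      rw [(hf n).1.le_symm hp (hf n).2] at t2
      rw [mul_assoc, sub_mul, t2, one_mul, sub_self]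
    rw [mul_assoc, sub_mul, one_mul, sub_eq_zero] at this
    exact this.symm
  have ETE' : E * (star T * E) = E * star T := by
    simpa [hE.proj.st, mul_assoc] using congrArg star ETE
  have key : T * (E * star T) = E - c := by
    have := hE.least (E - c - T * (E * star T)) fun n => by
      cases n with
      | zero => simp [f0, sub_mul, mul_assoc, Ec, hcp.mm, Tc]
      | succ n =>
        rw [sub_mul, sub_mul, hE.le, fs]
        simp only [mul_assoc, asc cT, asc TT, asc (hf n).2, asc (hE.le n)]
        simp
    simp only [sub_mul, hE.proj.mm, cE, mul_assoc, ETE'] at this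
    exact (sub_eq_zero.1 this).symm
  have hpE : IsStarProjection (p - E) := hE.proj.sub' hp pE
  have p1E : p1 * (p - E) = p - E := by
    have : p1 = p - c := by rw [hc]; abel
    rw [this]
    simp [mul_sub, sub_mul, hp.mm, pE, cE, hcp.le_symm hp pc]
  have A1 := hv.restrict hE.proj pE
  have A2 := hw.symm.restrict hpE p1E
  rw [star_star] at A2
  set qa := v * E * star v with hqa
  set qb := star w * (p - E) * w with hqb
  have qqa : q * qa = qa := by rw [hqa, mul_assoc, asc qv]
  have qaq : qa * q = qa := A1.right.le_symm hq qqa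
  have wqa : w * (qa * star w) = E - c := by
    rw [← key, hqa, hT, star_mul]; simp only [mul_assoc]
  have qab : qa * qb = 0 := by
    have : qa * qb = star w * ((w * (qa * star w)) * (p - E) * w) := by
      simp only [mul_assoc, asc hw.source, hqb, asc qqa]
    rw [this, wqa]
    simp [mul_sub, sub_mul, Ep, hE.proj.mm, cE, hcp.le_symm hp pc]
  have qsum : qa + qb = q := by
    have e1 : star w * (w * (qa * star w) * w) = qa := by
      simp only [mul_assoc, hw.source, qaq, asc hw.source, qqa]
    have e2 : p - c = p1 := by rw [hc]; abel
    rw [← e1, wqa, hqb, mul_assoc, ← mul_add, ← add_mul]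
    rw [show E - c + (p - E) = p - c by abel, e2, hw.fin_mul, hw.source]
  have := A1.add A2 (by rw [mul_sub, Ep, hE.proj.mm, sub_self]) qab
  rw [qsum, show E + (p - E) = p by abel] at this
  exact ⟨_, this⟩

end VN

namespace VN
variable {R : Type*} [Ring R] [StarRing R]

theorem exists_maximal_pairwise {α : Type*} (C : α → Prop) (D : α → α → Prop) :
    ∃ S : Set α, (∀ v ∈ S, C v) ∧ S.Pairwise D ∧
      ∀ v, C v → (∀ w ∈ S, D v w ∧ D w v) → v ∈ S := by
  obtain ⟨S, hS⟩ := zorn_subset {S : Set α | (∀ v ∈ S, C v) ∧ S.Pairwise D} (by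
    intro c hc hch
    refine ⟨⋃₀ c, ⟨?_, ?_⟩, fun s hs => Set.subset_sUnion_of_mem hs⟩
    · rintro v ⟨s, hs, hv⟩
      exact (hc hs).1 v hv
    · rw [Set.pairwise_sUnion hch.directedOn]
      exact fun s hs => (hc hs).2)
  refine ⟨S, hS.prop.1, hS.prop.2, fun v hv hw => ?_⟩
  have : insert v S ∈ {S : Set α | (∀ v ∈ S, C v) ∧ S.Pairwise D} := by
    refine ⟨?_, Set.pairwise_insert.2 ⟨hS.prop.2, fun w hw' _ => hw w hw'⟩⟩
    rintro w (rfl | h)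
    · exact hv
    · exact hS.prop.1 w h
  exact hS.le_of_ge this (Set.subset_insert v S) (Set.mem_insert v S)

theorem Eqv.le_left {p q r : R} (h : Eqv p q) (k : Le q r) : Le p r := h.le.trans k

variable [VNRing R]

theorem exists_cen_le (p q : R) (hp : IsStarProjection p) (hq : IsStarProjection q) :
    ∃ z, Cen z ∧ Le (z * p) (z * q) ∧ Le ((1 - z) * q) ((1 - z) * p) := by
  obtain ⟨S, hS, hS2, hmax⟩ := exists_maximal_pairwise
    (fun v : R => v * (star v * v) = v ∧ v * p = v ∧ q * v = v)
    (fun v w => star v * w = 0 ∧ v * star w = 0)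
  have hpi : ∀ v : S, PIso v.1 (star v.1 * v.1) (v.1 * star v.1) :=
    fun v => ⟨rfl, rfl, (hS v v.2).1⟩
  obtain ⟨P, hP⟩ := exists_isSup fun v : S => (hpi v).left
  obtain ⟨Q, hQ⟩ := exists_isSup fun v : S => (hpi v).right
  have hPQ : Eqv P Q := by
    refine Eqv.sup (fun v => ⟨_, hpi v⟩) ?_ ?_ hP hQ
    · intro v w hvw
      have := (hS2 v.2 w.2 (fun e => hvw (Subtype.ext e))).2
      rw [mul_assoc, asc this]; simp
    · intro v w hvw
      have := (hS2 v.2 w.2 (fun e => hvw (Subtype.ext e))).1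
      rw [mul_assoc, asc this]; simp
  have pP : p * P = P := hP.le_of fun v => by
    have := congrArg star (hS v v.2).2.1
    rw [star_mul, hp.st] at this
    rw [asc this]
  have qQ : q * Q = Q := hQ.le_of fun v => asc (hS v v.2).2.2 _
  have hSP : ∀ w ∈ S, w * P = w := fun w hw => by
    have := hP.le' (fun v => (hpi v).left) ⟨w, hw⟩
    simp only at this
    rw [← (hS w hw).1, mul_assoc, this]
  have hSQ : ∀ w ∈ S, Q * w = w := fun w hw => by
    have := hQ.le ⟨w, hw⟩
    simp only at this
    rw [← (hS w hw).1, ← mul_assoc w, ← mul_assoc, this]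
  set p' := p - P with hp'
  set q' := q - Q with hq'
  have pp' : IsStarProjection p' := hP.proj.sub' hp pP
  have pq' : IsStarProjection q' := hQ.proj.sub' hq qQ
  have hPp' : P * p' = 0 := by rw [hp', mul_sub, hP.proj.le_symm hp pP, hP.proj.mm, sub_self]
  have hQq' : Q * q' = 0 := by rw [hq', mul_sub, hQ.proj.le_symm hq qQ, hQ.proj.mm, sub_self]
  have hp'P := pp'.orth_symm hP.proj hPp'
  have hq'Q := pq'.orth_symm hQ.proj hQq'
  have pp1 : p * p' = p' := by rw [hp', mul_sub, hp.mm, pP]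
  have qq1 : q * q' = q' := by rw [hq', mul_sub, hq.mm, qQ]
  have key : ∀ x, q' * (x * p') = 0 := by
    intro x
    obtain ⟨v, a, b, hv, h1, h2, h3⟩ := exists_polar (q' * (x * p'))
    have vp' : v * p' = v := by
      have := h2 (1 - p') (by simp only [mul_assoc, mul_sub, pp'.mm]; simp)
      rw [mul_sub, mul_one, sub_eq_zero] at this
      rw [← hv.mul_init, mul_assoc, ← this]
    have q'v : q' * v = v := by
      have := h3 (1 - q') (by simp only [sub_mul, asc pq'.mm]; simp)
      rw [sub_mul, one_mul, sub_eq_zero] at this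
      rw [← hv.fin_mul, ← mul_assoc, ← this]
    have vP : v * P = 0 := by rw [← vp', mul_assoc, hp'P, mul_zero]
    have Qv : Q * v = 0 := by rw [← q'v, ← mul_assoc, hQq', zero_mul]
    have vS : v ∈ S := by
      refine hmax v ⟨by rw [hv.source, hv.mul_init], ?_, ?_⟩ fun w hw => ?_
      · rw [← vp', mul_assoc, pp'.le_symm hp pp1]
      · rw [← q'v, asc qq1]
      · have e1 : w * star v = 0 := by
          have h4 : P * star v = 0 := by simpa [hP.proj.st] using congrArg star vP
          rw [← hSP w hw, mul_assoc, h4, mul_zero]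
        have e2 : star w * v = 0 := by
          have := congrArg star (hSQ w hw)
          rw [star_mul, hQ.proj.st] at this
          rw [← this, mul_assoc, Qv, mul_zero]
        exact ⟨⟨by simpa using congrArg star e2, by simpa using congrArg star e1⟩, e2, e1⟩
    have v0 : v = 0 := by rw [← hSP v vS, vP]
    rw [← h1, ← hv.source, v0]; simp
  have key' : ∀ x, p' * (x * q') = 0 := fun x => by
    simpa [pp'.st, pq'.st, mul_assoc] using congrArg star (key (star x))
  obtain ⟨z, hz⟩ := exists_isSup (f := fun s : {s : R // Le s q'} => s.1) fun s => s.2.left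
  have hz1 : ∀ x, (1 - z) * x * z = 0 := fun x => hz.least _ fun ⟨s, hs⟩ => by
    obtain ⟨v, a, b, hv, h1, h2, h3⟩ := exists_polar (s * star x)
    have sb : s * b = b := by
      have := h3 (1 - s) (by simp only [sub_mul, asc hs.left.mm]; simp)
      rw [sub_mul, one_mul, sub_eq_zero] at this
      exact this.symm
    have ha : Le a q' := Eqv.le_left ⟨v, hv⟩ (hs.sub_left hv.right sb)
    have za : z * a = a := hz.le ⟨a, ha⟩
    have ax : a * (x * s) = x * s := by
      simpa [hv.left.st, hs.left.st] using congrArg star h1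
    rw [mul_assoc]
    simp only
    rw [← ax, ← mul_assoc, sub_mul, za]; simp
  have hzc : Cen z := by
    refine ⟨hz.proj, fun x => ?_⟩
    have a1 := hz1 x
    have a2 := congrArg star (hz1 (star x))
    simp only [star_mul, star_sub, star_zero, star_star, hz.proj.st, sub_mul,
      one_mul, sub_eq_zero] at a1 a2
    exact a2.trans (by rw [← mul_assoc, ← a1])
  have zq' : z * q' = q' := hz.le ⟨q', .refl pq'⟩
  have zp' : p' * z = 0 := hz.least _ fun ⟨s, hs⟩ => by
    obtain ⟨s1, ⟨v, hv⟩, h1⟩ := hs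
    have := key' (star v)
    have e2 : q' * v = v := by rw [← hv.fin_mul, asc h1]
    simp only
    have e3 : p' * (star v * (q' * v)) = 0 := by rw [← mul_assoc _ q', ← mul_assoc, this, zero_mul]
    rwa [e2, hv.source] at e3
  refine ⟨z, hzc, ?_, ?_⟩
  · have e1 : z * p = z * P := by
      have : z * p' = 0 := by rw [hzc.comm, zp']
      rw [show p = P + p' by rw [hp']; abel, mul_add, this, add_zero]
    rw [e1]
    exact ⟨_, hPQ.cut hzc, by rw [hzc.comm q, mul_assoc, asc hzc.proj.mm, ← mul_assoc,
      ← hzc.comm q, mul_assoc, qQ]⟩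
  · have e1 : (1 - z) * q = (1 - z) * Q := by
      have : (1 - z) * q' = 0 := by rw [sub_mul, zq', one_mul, sub_self]
      nth_rw 1 [show q = Q + q' by rw [hq']; abel]
      rw [mul_add, this, add_zero]
    rw [e1]
    exact ⟨_, hPQ.symm.cut hzc.compl, by rw [hzc.compl.comm p, mul_assoc, asc hzc.compl.proj.mm,
      ← mul_assoc, ← hzc.compl.comm p, mul_assoc, pP]⟩

/-- A purely infinite projection: it contains two orthogonal copies of itself. -/
def Idem (y : R) : Prop := ∃ a b, Eqv y a ∧ Eqv y b ∧ a * b = 0 ∧ y * a = a ∧ y * b = b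

/-- A projection dominating no nonzero purely infinite projection. -/
def Fin' (a : R) : Prop := ∀ y, Idem y → Le y a → y = 0

theorem Fin'.mono {a b : R} (h : Fin' a) (k : Le b a) : Fin' b := fun y hy hyb =>
  h y hy (hyb.trans k)

namespace Idem
variable {y z : R}

theorem proj (h : Idem y) : IsStarProjection y := by
  obtain ⟨a, b, h, -⟩ := h
  exact h.left

theorem cut (h : Idem y) (hz : Cen z) : Idem (z * y) := by
  obtain ⟨a, b, ha, hb, hab, ya, yb⟩ := h
  have e : ∀ x t, z * x * (z * t) = z * (x * t) := fun x t => by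
    rw [mul_assoc, ← mul_assoc x, ← hz.comm x, mul_assoc, asc hz.proj.mm]
  exact ⟨z * a, z * b, ha.cut hz, hb.cut hz, by rw [e, hab, mul_zero], by rw [e, ya], by rw [e, yb]⟩

theorem of_eqv {a : R} (h : Idem y) (k : Eqv y a) : Idem a := by
  obtain ⟨w, hw⟩ := k
  obtain ⟨c, d, hc, hd, hcd, yc, yd⟩ := h
  refine ⟨w * c * star w, w * d * star w,
    ⟨_, hw.symm⟩ |> fun e : Eqv a y => e.trans (hc.trans ⟨_, hw.restrict hc.right yc⟩),
    ⟨_, hw.symm⟩ |> fun e : Eqv a y => e.trans (hd.trans ⟨_, hw.restrict hd.right yd⟩), ?_, ?_, ?_⟩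
  · simp only [mul_assoc, ← mul_assoc _ w, hw.source]
    rw [asc yd, asc hcd]; simp
  · rw [mul_assoc, asc hw.fin_mul]
  · rw [mul_assoc, asc hw.fin_mul]

theorem of_le {a : R} (h : Idem y) (k : Le y a) (k' : Le a y) : Idem a := h.of_eqv (k.antisymm k')

theorem add_le {p q : R} (h : Idem y) (hp : Le p y) (hq : Le q y) (hpq : p * q = 0) :
    Le (p + q) y := by
  obtain ⟨c, d, hc, hd, hcd, yc, yd⟩ := h
  exact ((hp.trans hc.le).add (hq.trans hd.le) hc.right hd.right hpq hcd).mono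
    (by rw [mul_add, yc, yd])

theorem seq (h : Idem y) : ∃ e : ℕ → R, (∀ n, Eqv y (e n)) ∧ (∀ n, y * e n = e n) ∧
    ∀ m n, m ≠ n → e m * e n = 0 := by
  obtain ⟨c, d, hc, ⟨t, ht⟩, hcd, yc, yd⟩ := h
  have hy := ht.left
  obtain ⟨e, e0, es⟩ : ∃ e : ℕ → R, e 0 = c ∧ ∀ n, e (n + 1) = t * e n * star t :=
    ⟨fun n => Nat.rec c (fun _ x => t * x * star t) n, rfl, fun _ => rfl⟩
  have yt : y * t = t := by rw [← ht.fin_mul, asc yd]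
  have H : ∀ n, Eqv y (e n) ∧ y * e n = e n := by
    intro n
    induction n with
    | zero => exact ⟨e0 ▸ hc, e0 ▸ yc⟩
    | succ n ih =>
      rw [es]
      exact ⟨ih.1.trans ⟨_, ht.restrict ih.1.right ih.2⟩, by rw [mul_assoc, asc yt]⟩
  have H2 : ∀ m n, m < n → e m * e n = 0 := by
    intro m
    induction m with
    | zero =>
      intro n hn
      obtain ⟨n, rfl⟩ := Nat.exists_eq_succ_of_ne_zero hn.ne'
      have : c * t = 0 := by rw [← ht.fin_mul, asc hcd, zero_mul]
      rw [e0, Nat.succ_eq_add_one, es, mul_assoc, asc this, zero_mul]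
    | succ m ih =>
      intro n hn
      obtain ⟨n, rfl⟩ := Nat.exists_eq_succ_of_ne_zero (by omega : n ≠ 0)
      rw [Nat.succ_eq_add_one, es, es]
      simp only [mul_assoc]
      rw [asc ht.source, asc (H n).2, asc (ih n (by omega))]; simp
  refine ⟨e, fun n => (H n).1, fun n => (H n).2, fun m n hmn => ?_⟩
  rcases lt_or_gt_of_ne hmn with h | h
  · exact H2 m n h
  · exact (H m).1.right.orth_symm (H n).1.right (H2 n m h)

theorem sup_le {p : ℕ → R} {P : R} (h : Idem y) (hp : ∀ n, Le (p n) y)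
    (hpp : ∀ m n, m ≠ n → p m * p n = 0) (hP : IsSup p P) : Le P y := by
  obtain ⟨e, he, hye, hee⟩ := h.seq
  have : ∀ n, Le (p n) (e n) := fun n => (hp n).trans (he n).le
  choose r hr her using this
  have hrr : ∀ m n, m ≠ n → r m * r n = 0 := fun m n hmn => by
    rw [← (hr m).right.le_symm (he m).right (her m), ← her n, mul_assoc, asc (hee m n hmn)]; simp
  obtain ⟨Q, hQ⟩ := exists_isSup fun n => (hr n).right
  exact ⟨Q, Eqv.sup hr hpp hrr hP hQ, hQ.le_of fun n => by rw [← her n, asc (hye n)]⟩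

theorem of_family {ι : Type*} {f a b : ι → R} {Y : R} (ha : ∀ i, Eqv (f i) (a i))
    (hb : ∀ i, Eqv (f i) (b i)) (hf : ∀ i j, i ≠ j → f i * f j = 0)
    (haa : ∀ i j, i ≠ j → a i * a j = 0) (hbb : ∀ i j, i ≠ j → b i * b j = 0)
    (hab : ∀ i j, a i * b j = 0) (hY : IsSup f Y) (hYa : ∀ i, Y * a i = a i)
    (hYb : ∀ i, Y * b i = b i) : Idem Y := by
  obtain ⟨A, hA⟩ := exists_isSup fun i => (ha i).right
  obtain ⟨B, hB⟩ := exists_isSup fun i => (hb i).right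
  exact ⟨A, B, Eqv.sup ha hf haa hY hA, Eqv.sup hb hf hbb hY hB,
    hB.least _ fun j => hA.zero_left (fun i => (ha i).right) fun i => hab i j,
    hA.le_of hYa, hB.le_of hYb⟩

end Idem

theorem exists_cen_idem_fin (a : R) (ha : IsStarProjection a) :
    ∃ z, Cen z ∧ Idem (z * a) ∧ Fin' ((1 - z) * a) := by
  obtain ⟨S, hS, hS2, hmax⟩ := exists_maximal_pairwise
    (fun v : R => Idem v ∧ a * v = v) (fun v w => v * w = 0)
  obtain ⟨Y, hY⟩ := exists_isSup (f := fun v : S => v.1) fun v => (hS v v.2).1.proj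
  have hYi : Idem Y := by
    choose c d hc hd hcd yc yd using fun v : S => (hS v v.2).1
    have key : ∀ (v w : S) (x y : R), v ≠ w → IsStarProjection x → v.1 * x = x → w.1 * y = y → x * y = 0 := by
      intro v w x y hvw hx h1 h2
      rw [← hx.le_symm (hS v v.2).1.proj h1, ← h2, mul_assoc,
        asc (hS2 v.2 w.2 fun e => hvw (Subtype.ext e))]; simp
    refine Idem.of_family hc hd (fun v w h => hS2 v.2 w.2 fun e => h (Subtype.ext e))
      (fun v w h => key v w _ _ h (hc v).right (yc v) (yc w))
      (fun v w h => key v w _ _ h (hd v).right (yd v) (yd w)) (fun v w => ?_) hY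
      (fun v => by rw [← yc v, asc (hY.le v)]) (fun v => by rw [← yd v, asc (hY.le v)])
    by_cases h : v = w
    · subst h; exact hcd v
    · exact key v w _ _ h (hc v).right (yc v) (yd w)
  have aY : a * Y = Y := hY.le_of fun v => (hS v v.2).2
  set r := a - Y with hr
  have hrp : IsStarProjection r := hY.proj.sub' ha aY
  have hYr : Y * r = 0 := by rw [hr, mul_sub, hY.proj.le_symm ha aY, hY.proj.mm, sub_self]
  have hrY := hrp.orth_symm hY.proj hYr
  have har : a * r = r := by rw [hr, mul_sub, ha.mm, aY]
  have hrf : Fin' r := by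
    intro y hy hyr
    obtain ⟨y', hyy', hry'⟩ := hyr
    have hy' := hy.of_eqv hyy'
    have hYy : Y * y' = 0 := by rw [← hry', asc hYr, zero_mul]
    have : y' ∈ S := hmax y' ⟨hy', by rw [← hry', asc har]⟩ fun w hw => by
      have : w * y' = 0 := by
        have : w * Y = w := hY.le' (fun v => (hS v v.2).1.proj) ⟨w, hw⟩
        rw [← this, mul_assoc, hYy, mul_zero]
      exact ⟨hy'.proj.orth_symm (hS w hw).1.proj this, this⟩
    have h0 : y' = 0 := (hY.le ⟨y', this⟩).symm.trans hYy
    obtain ⟨v, hv⟩ := hyy'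
    rw [← hv.source, ← hv.fin_mul, h0]; simp
  obtain ⟨z, hz, h1, h2⟩ := exists_cen_le r Y hrp hY.proj
  have e : ∀ z : R, z * a = z * Y + z * r := fun z => by rw [hr]; simp [mul_sub]
  refine ⟨z, hz, ?_, ?_⟩
  · have hi := hYi.cut hz
    refine hi.of_le (.of_le hi.proj ?_) ?_
    · rw [mul_assoc, ← mul_assoc a, ← hz.comm, mul_assoc, aY, asc hz.proj.mm]
    · rw [e]
      refine hi.add_le (.refl hi.proj) h1 ?_
      rw [mul_assoc, ← mul_assoc Y, ← hz.comm, mul_assoc, hYr]; simp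
  · have hi := hYi.cut hz.compl
    have h0 : (1 - z) * Y = 0 :=
      hrf _ hi (h2.mono (by rw [hz.compl.comm r, asc hrp.mm]))
    rw [e, h0, zero_add]
    exact hrf.mono (.of_le (hz.compl.mul_proj hrp) (by rw [hz.compl.comm r, asc hrp.mm]))

end VN

namespace VN
variable {R : Type*} [Ring R] [StarRing R]

theorem Cen.mul_mul {z : R} (hz : Cen z) (x y : R) : z * x * (z * y) = z * (x * y) := by
  rw [mul_assoc, ← mul_assoc x, ← hz.comm x, mul_assoc, asc hz.proj.mm]

theorem Cen.le {z p : R} (hz : Cen z) (hp : IsStarProjection p) : p * (z * p) = z * p := by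
  rw [← mul_assoc, ← hz.comm, mul_assoc, hp.mm]

theorem Cen.cut_le {z p : R} (hz : Cen z) (hp : IsStarProjection p) : Le (z * p) p :=
  .of_le (hz.mul_proj hp) (hz.le hp)

theorem Eqv.eq_zero {p q : R} (h : Eqv p q) (hq : q = 0) : p = 0 := by
  obtain ⟨v, hv⟩ := h
  rw [← hv.source, ← hv.fin_mul, hq]; simp

theorem Le.eq_zero {p q : R} (h : Le p q) (hq : q = 0) : p = 0 := by
  obtain ⟨r, h, hr⟩ := h
  exact h.eq_zero (by rw [← hr, hq, zero_mul])

variable [VNRing R]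

theorem Le.right_of_eqv {p q r : R} (h : Le p q) (k : Eqv q r) : Le p r := h.trans k.le

theorem exists_eqv_mul {a b : R} (hb : IsStarProjection b) (ha : IsStarProjection a) :
    ∃ p q, Eqv p q ∧ a * p = p ∧ b * q = q ∧ b * (a - p) = 0 ∧
      ∀ y, y * (b * a) = 0 → y * q = 0 := by
  obtain ⟨v, p, q, hv, a1, a2, a3⟩ := exists_polar (b * a)
  have kp : a * p = p := by
    have := a2 (1 - a) (by rw [mul_assoc, mul_sub, ha.mm]; simp)
    rw [mul_sub, mul_one, sub_eq_zero] at this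
    simpa [hv.left.st, ha.st] using (congrArg star this).symm
  refine ⟨p, q, ⟨v, hv⟩, kp, ?_, ?_, a3⟩
  · have := a3 (1 - b) (by rw [sub_mul, asc hb.mm]; simp)
    rw [sub_mul, one_mul, sub_eq_zero] at this
    exact this.symm
  · rw [mul_sub, ← a1, mul_assoc, kp, sub_self]

theorem Idem.split {k k' k'' : R} (hk : Idem k) (hk' : IsStarProjection k')
    (hk'' : IsStarProjection k'') (h0 : k' * k'' = 0) (h : k = k' + k'') :
    ∃ z, Cen z ∧ Le (z * k) (z * k'') ∧ Le ((1 - z) * k) ((1 - z) * k') := by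
  have h0' := hk''.orth_symm hk' h0
  obtain ⟨k1, k2, e1, e2, h12, kk1, kk2⟩ := hk
  have h21 := e2.right.orth_symm e1.right h12
  have aux : ∀ {k1 k2 k' k'' : R}, IsStarProjection k1 → IsStarProjection k2 → k1 * k2 = 0 →
      k2 * k1 = 0 →
      IsStarProjection k' → IsStarProjection k'' → k' * k'' = 0 → k' * k1 + k'' * k1 = k1 →
      ∃ p q, Eqv p q ∧ k1 * p = p ∧ k'' * q = q ∧ k' * (k1 - p) = (k1 - p) ∧
       (∀ m, IsStarProjection m → k2 * m = m → k'' * m = m → m * q = 0) := by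
    intro k1 k2 k' k'' h1 h2 h12 h21 hk' hk'' h0 hs
    obtain ⟨p, q, hv, kp, kq, e, a3⟩ := exists_eqv_mul hk'' h1
    refine ⟨p, q, hv, kp, kq, ?_, ?_⟩
    · have e2 : k1 * (k1 - p) = k1 - p := by rw [mul_sub, h1.mm, kp]
      have := congrArg (· * (k1 - p)) hs
      simp only [add_mul, mul_assoc, e2, e, add_zero] at this
      exact this
    · intro m hm h2m hm'
      refine a3 m ?_
      rw [← mul_assoc, hm.le_symm hk'' hm', ← hm.le_symm h2 h2m, mul_assoc, h21, mul_zero]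
  have s1 : k' * k1 + k'' * k1 = k1 := by rw [← add_mul, ← h, kk1]
  have s2 : k'' * k2 + k' * k2 = k2 := by rw [← add_mul, add_comm, ← h, kk2]
  obtain ⟨p1, q1, E1, b1, b2, b3, b4⟩ := aux e1.right e2.right h12 h21 hk' hk'' h0 s1
  obtain ⟨p2, q2, E2, c1, c2, c3, c4⟩ := aux e2.right e1.right h21 h12 hk'' hk' h0' s2
  have hm1 : IsStarProjection (k1 - p1) := E1.left.sub' e1.right b1
  have hm2 : IsStarProjection (k2 - p2) := E2.left.sub' e2.right c1
  have o1 : (k2 - p2) * q1 = 0 := b4 _ hm2 (by rw [mul_sub, e2.right.mm, c1]) c3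
  have o2 : (k1 - p1) * q2 = 0 := c4 _ hm1 (by rw [mul_sub, e1.right.mm, b1]) b3
  have o3 : (k1 - p1) * p1 = 0 := by
    rw [sub_mul, E1.left.mm, b1, sub_self]
  have o4 : (k2 - p2) * p2 = 0 := by
    rw [sub_mul, E2.left.mm, c1, sub_self]
  obtain ⟨z, hz, l1, l2⟩ := exists_cen_le _ _ hm1 hm2
  refine ⟨z, hz, ?_, ?_⟩
  · have := l1.add (E1.cut hz).le (hz.mul_proj hm2) (hz.mul_proj E1.right)
      (by rw [hz.mul_mul, o3, mul_zero]) (by rw [hz.mul_mul, o1, mul_zero])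
    rw [← mul_add, ← mul_add, sub_add_cancel] at this
    exact (e1.cut hz).le.trans (this.mono (by rw [hz.mul_mul, mul_add, c3, b2]))
  · have := l2.add (E2.cut hz.compl).le (hz.compl.mul_proj hm1) (hz.compl.mul_proj E2.right)
      (by rw [hz.compl.mul_mul, o4, mul_zero]) (by rw [hz.compl.mul_mul, o2, mul_zero])
    rw [← mul_add, ← mul_add, sub_add_cancel] at this
    exact (e2.cut hz.compl).le.trans (this.mono (by rw [hz.compl.mul_mul, mul_add, b3, c2]))

theorem Idem.absorb {k a b : R} (hk : Idem k) (hb : IsStarProjection b)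
    (h : Le k (a + b)) (hf : Fin' a) : Le k b := by
  obtain ⟨k0, hkk, hk0⟩ := h
  have hi := hk.of_eqv hkk
  obtain ⟨p, q, hv, kp, bq, e, -⟩ := exists_eqv_mul hb hi.proj
  have hd : IsStarProjection (k0 - p) := hv.left.sub' hi.proj kp
  have o : (k0 - p) * p = 0 := by rw [sub_mul, hv.left.mm, kp, sub_self]
  have aD : a * (k0 - p) = k0 - p := by
    have : (a + b) * (k0 - p) = k0 - p := by
      rw [mul_sub, hk0]; nth_rw 1 [← kp]; rw [← mul_assoc, hk0, kp]
    rwa [add_mul, e, add_zero] at this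
  obtain ⟨z, hz, l1, l2⟩ := hi.split hd hv.left o (by abel)
  have hb' : Le p b := hv.le.mono bq
  have h0 : (1 - z) * k0 = 0 := hf _ (hi.cut hz.compl)
    ((l2.trans (hz.compl.cut_le hd)).trans (.of_le hd aD))
  have : k0 = z * k0 := by rw [sub_mul, one_mul, sub_eq_zero] at h0; exact h0
  refine hkk.le.trans ?_
  rw [this]
  exact (l1.trans (hz.cut_le hv.left)).trans hb'

theorem exists_idem_of_eqv_add {e c : R} (h : Eqv (e + c) e) (hc : IsStarProjection c)
    (hce : c * e = 0) : ∃ k, Idem k ∧ Le c k ∧ Le k e := by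
  obtain ⟨w, hw⟩ := h
  have he := hw.right
  have hec := he.orth_symm hc hce
  obtain ⟨r, r0, rs⟩ : ∃ r : ℕ → R, r 0 = w * c * star w ∧ ∀ n, r (n + 1) = w * r n * star w :=
    ⟨fun n => Nat.rec (w * c * star w) (fun _ x => w * x * star w) n, rfl, fun _ => rfl⟩
  have ecc : (e + c) * c = c := by rw [add_mul, hec, hc.mm, zero_add]
  have aux : ∀ x, e * x = x → (e + c) * x = x := fun x hx => by
    rw [add_mul, hx]; nth_rw 2 [← hx]; rw [asc hce]; simp
  have H : ∀ n, Eqv c (r n) ∧ e * r n = r n := by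
    intro n
    induction n with
    | zero =>
      rw [r0]
      exact ⟨⟨_, hw.restrict hc ecc⟩, by rw [mul_assoc, asc hw.fin_mul]⟩
    | succ n ih =>
      rw [rs]
      exact ⟨ih.1.trans ⟨_, hw.restrict ih.1.right (aux _ ih.2)⟩, by rw [mul_assoc, asc hw.fin_mul]⟩
  have H2 : ∀ m n, m < n → r m * r n = 0 := by
    intro m
    induction m with
    | zero =>
      intro n hn
      obtain ⟨n, rfl⟩ := Nat.exists_eq_succ_of_ne_zero hn.ne'
      rw [r0, Nat.succ_eq_add_one, rs]
      simp only [mul_assoc]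
      rw [asc hw.source, asc (aux _ (H n).2), ← (H n).2, mul_assoc, asc hce]; simp
    | succ m ih =>
      intro n hn
      obtain ⟨n, rfl⟩ := Nat.exists_eq_succ_of_ne_zero (by omega : n ≠ 0)
      rw [Nat.succ_eq_add_one, rs, rs]
      simp only [mul_assoc]
      rw [asc hw.source, asc (aux _ (H n).2), asc (ih n (by omega))]; simp
  have H3 : ∀ m n, m ≠ n → r m * r n = 0 := fun m n hmn => by
    rcases lt_or_gt_of_ne hmn with h | h
    · exact H2 m n h
    · exact (H m).1.right.orth_symm (H n).1.right (H2 n m h)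
  obtain ⟨k, hk⟩ := exists_isSup fun n => (H n).1.right
  refine ⟨k, ?_, (H 0).1.le.trans (.of_le (H 0).1.right (hk.le 0)),
    .of_le hk.proj (hk.le_of fun n => (H n).2)⟩
  exact Idem.of_family (f := r) (a := fun n => r (2 * n)) (b := fun n => r (2 * n + 1))
    (fun n => (H n).1.symm.trans (H _).1) (fun n => (H n).1.symm.trans (H _).1) H3
    (fun m n h => H3 _ _ (by omega)) (fun m n h => H3 _ _ (by omega))
    (fun m n => H3 _ _ (by omega)) hk (fun n => hk.le _) (fun n => hk.le _)

theorem Idem.add_le_right {k b c : R} (hk : Idem k) (hb : IsStarProjection b)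
    (hkb : Le k b) (hck : Le c k) (hbc : b * c = 0) : Le (b + c) b := by
  obtain ⟨k1, hk1, hb1⟩ := hkb
  have hi := hk.of_eqv hk1
  have k1c : k1 * c = 0 := by rw [← hi.proj.le_symm hb hb1, mul_assoc, hbc, mul_zero]
  have hd := hi.proj.sub' hb hb1
  have o : (b - k1) * k1 = 0 := by rw [sub_mul, hi.proj.mm, hb1, sub_self]
  have := (Le.refl hd).add (hi.add_le (.refl hi.proj) (hck.trans hk1.le) k1c) hd hi.proj
    (by rw [mul_add, o, sub_mul, hbc, k1c]; simp) o
  rwa [sub_add_cancel, ← add_assoc, sub_add_cancel] at this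

theorem Eqv.cancel_of_le {a b a' b' : R} (hb' : IsStarProjection b')
    (hf : Fin' a') (h : Eqv (a + b) (a' + b')) (hab : a * b = 0) (hab' : a' * b' = 0)
    (haa : Eqv a a') (hbb : Le b b') : Eqv b b' := by
  obtain ⟨b1, hb1, hbb1⟩ := hbb
  have hp1 := hb1.right
  have ab1 : a' * b1 = 0 := by rw [← hbb1, asc hab', zero_mul]
  set c := b' - b1 with hc
  have hcp : IsStarProjection c := hp1.sub' hb' hbb1
  have bc : b1 * c = 0 := by rw [hc, mul_sub, hp1.le_symm hb' hbb1, hp1.mm, sub_self]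
  have ac : a' * c = 0 := by rw [hc, mul_sub, hab', ab1, sub_self]
  have e1 : Eqv (a' + b1 + c) (a' + b1) := by
    rw [hc, add_assoc, add_sub_cancel]
    exact h.symm.trans (haa.add hb1 hab ab1)
  obtain ⟨k, hk, hck, hke⟩ := exists_idem_of_eqv_add e1 hcp
    (by rw [mul_add, hcp.orth_symm haa.right ac, hcp.orth_symm hp1 bc, add_zero])
  have hkb := hk.absorb hp1 hke hf
  have := hk.add_le_right hp1 hkb hck bc
  rw [hc, add_sub_cancel] at this
  exact Le.antisymm ⟨b1, hb1, hbb1⟩ (this.trans hb1.symm.le)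

theorem Eqv.cancel {a b a' b' : R} (hb : IsStarProjection b) (hb' : IsStarProjection b')
    (hf : Fin' a') (h : Eqv (a + b) (a' + b')) (hab : a * b = 0) (hab' : a' * b' = 0)
    (haa : Eqv a a') : Eqv b b' := by
  obtain ⟨z, hz, l1, l2⟩ := exists_cen_le _ _ hb hb'
  have hz' := hz.compl
  have c1 := h.cut hz
  have c2 := h.symm.cut hz'
  rw [mul_add, mul_add] at c1 c2
  refine .glue hz ?_ (.symm ?_)
  · exact c1.cancel_of_le (hz.mul_proj hb') (hf.mono (hz.cut_le haa.right))
      (by rw [hz.mul_mul, hab, mul_zero]) (by rw [hz.mul_mul, hab', mul_zero]) (haa.cut hz) l1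
  · exact c2.cancel_of_le (hz'.mul_proj hb)
      (hf.mono ((hz'.cut_le haa.left).trans haa.le))
      (by rw [hz'.mul_mul, hab', mul_zero]) (by rw [hz'.mul_mul, hab,
        mul_zero]) (haa.symm.cut hz') l2

end VN

namespace VN
variable {R : Type*} [Ring R] [StarRing R]

/-- An increasing sequence of projections. -/
structure Incr (r : ℕ → R) : Prop where
  proj : ∀ n, IsStarProjection (r n)
  succ : ∀ n, r (n + 1) * r n = r n

/-- Successive differences of a sequence. -/
def dif (r : ℕ → R) : ℕ → R
  | 0 => r 0
  | n + 1 => r (n + 1) - r n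

namespace Incr
variable {r : ℕ → R} {e z : R}

theorem mul_of_le (h : Incr r) {m n : ℕ} (hmn : m ≤ n) : r n * r m = r m := by
  induction n, hmn using Nat.le_induction with
  | base => exact (h.proj m).mm
  | succ n _ ih => rw [← ih, asc (h.succ n)]

theorem mul_of_le' (h : Incr r) {m n : ℕ} (hmn : m ≤ n) : r m * r n = r m :=
  (h.proj m).le_symm (h.proj n) (h.mul_of_le hmn)

theorem dif_proj (h : Incr r) : ∀ n, IsStarProjection (dif r n)
  | 0 => h.proj 0
  | n + 1 => (h.proj n).sub' (h.proj _) (h.succ n)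

theorem mul_dif (h : Incr r) {m : ℕ} : ∀ {n}, n ≤ m → r m * dif r n = dif r n
  | 0, hn => h.mul_of_le hn
  | n + 1, hn => by rw [dif, mul_sub, h.mul_of_le hn, h.mul_of_le (by omega)]

theorem mul_dif_zero (h : Incr r) {m n : ℕ} (hmn : m < n) : r m * dif r n = 0 := by
  obtain ⟨n, rfl⟩ := Nat.exists_eq_succ_of_ne_zero (by omega : n ≠ 0)
  rw [Nat.succ_eq_add_one, dif, mul_sub, h.mul_of_le' (by omega), h.mul_of_le' (by omega), sub_self]

theorem dif_orth (h : Incr r) {m n : ℕ} (hmn : m ≠ n) : dif r m * dif r n = 0 := by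
  have aux : ∀ {m n}, m < n → dif r m * dif r n = 0 := fun {m n} hmn => by
    rw [← (h.dif_proj m).le_symm (h.proj m) (h.mul_dif le_rfl), mul_assoc, h.mul_dif_zero hmn,
      mul_zero]
  rcases lt_or_gt_of_ne hmn with h' | h'
  · exact aux h'
  · exact (h.dif_proj m).orth_symm (h.dif_proj n) (aux h')

theorem isSup_dif (h : Incr r) (he : IsSup r e) : IsSup (dif r) e := by
  refine ⟨he.proj, fun n => by rw [← h.mul_dif le_rfl, asc (he.le n)], fun x hx => he.least x ?_⟩
  intro n
  induction n with
  | zero => exact hx 0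
  | succ n ih =>
    have := hx (n + 1)
    rwa [dif, mul_sub, ih, sub_zero] at this

theorem cut (h : Incr r) (hz : Cen z) : Incr fun n => z * r n :=
  ⟨fun n => hz.mul_proj (h.proj n), fun n => by rw [hz.mul_mul, h.succ]⟩

end Incr

variable [VNRing R]

theorem Incr.sup_le_of_fin {r : ℕ → R} {ρ s : R} (h : Incr r) (hρ : IsSup r ρ)
    (hs : IsStarProjection s) (hf : Fin' s) (hr : ∀ n, Le (r n) s) : Le ρ s := by
  have step : ∀ n (Q : {Q : R // Eqv (r n) Q ∧ s * Q = Q}),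
      ∃ Q' : {Q : R // Eqv (r (n + 1)) Q ∧ s * Q = Q}, Q'.1 * Q.1 = Q.1 ∧
        Eqv (r (n + 1) - r n) (Q'.1 - Q.1) := by
    rintro n ⟨Q, hQ, hsQ⟩
    obtain ⟨T, ⟨v, hv⟩, hsT⟩ := hr (n + 1)
    have hd : IsStarProjection (r (n + 1) - r n) := h.dif_proj (n + 1)
    have hrd : r (n + 1) * (r (n + 1) - r n) = r (n + 1) - r n := by
      rw [mul_sub, (h.proj _).mm, h.succ]
    have hrd0 : r n * (r (n + 1) - r n) = 0 := h.mul_dif_zero (Nat.lt_succ_self n)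
    have e1 := hv.restrict (h.proj n) (h.succ n)
    have e2 := hv.restrict hd hrd
    set T1 := v * r n * star v with hT1
    set T2 := v * (r (n + 1) - r n) * star v with hT2
    have sv : s * v = v := by rw [← hv.fin_mul, asc hsT]
    have sT1 : s * T1 = T1 := by rw [hT1, mul_assoc, asc sv]
    have sT2 : s * T2 = T2 := by rw [hT2, mul_assoc, asc sv]
    have T12 : T1 * T2 = 0 := by
      simp only [hT1, hT2, mul_assoc]
      rw [asc hv.source, asc hrd, asc hrd0]; simp
    have p1 := e1.right.sub' hs sT1
    have p2 := hQ.right.sub' hs hsQ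
    have o1 : T1 * (s - T1) = 0 := by rw [mul_sub, e1.right.le_symm hs sT1, e1.right.mm, sub_self]
    have o2 : Q * (s - Q) = 0 := by rw [mul_sub, hQ.right.le_symm hs hsQ, hQ.right.mm, sub_self]
    have hc : Eqv (s - T1) (s - Q) := by
      refine Eqv.cancel (a := T1) (a' := Q) p1 p2 (hf.mono (.of_le hQ.right hsQ)) ?_ o1 o2
        (Eqv.trans ⟨_, e1.symm⟩ hQ)
      rw [add_sub_cancel, add_sub_cancel]
      exact .refl hs
    have : Le (r (n + 1) - r n) (s - Q) :=
      (Le.right_of_eqv ⟨T2, ⟨_, e2⟩, by rw [sub_mul, sT2, T12, sub_zero]⟩ hc)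
    obtain ⟨D, hD, hsD⟩ := this
    have QD : Q * D = 0 := by rw [← hsD, asc o2, zero_mul]
    refine ⟨⟨Q + D, ?_, ?_⟩, ?_, ?_⟩
    · have := hQ.add hD hrd0 QD
      rwa [add_sub_cancel] at this
    · rw [mul_add, hsQ, ← hsD, ← mul_assoc, mul_sub, hs.mm, hsQ]
    · simp only
      rw [add_mul, hQ.right.mm, hD.right.orth_symm hQ.right QD, add_zero]
    · simpa using hD
  choose F hF1 hF2 using step
  obtain ⟨Q0, hQ0, hsQ0⟩ := hr 0
  obtain ⟨Q, q0, qs⟩ : ∃ Q : ∀ n, {Q : R // Eqv (r n) Q ∧ s * Q = Q},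
      Q 0 = ⟨Q0, hQ0, hsQ0⟩ ∧ ∀ n, Q (n + 1) = F n (Q n) :=
    ⟨fun n => Nat.rec ⟨Q0, hQ0, hsQ0⟩ F n, rfl, fun _ => rfl⟩
  have hQ : Incr fun n => (Q n).1 := ⟨fun n => (Q n).2.1.right, fun n => by
    simp only [qs]; exact hF1 _ _⟩
  obtain ⟨E, hE⟩ := exists_isSup hQ.proj
  have hdd : ∀ n, Eqv (dif r n) (dif (fun n => (Q n).1) n)
    | 0 => (Q 0).2.1
    | n + 1 => by simp only [dif, qs]; exact hF2 _ _
  exact ⟨E, Eqv.sup hdd (fun _ _ => h.dif_orth) (fun _ _ => hQ.dif_orth) (h.isSup_dif hρ)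
    (hQ.isSup_dif hE), hE.le_of fun n => (Q n).2.2⟩

theorem Incr.sup_le {r : ℕ → R} {ρ s : R} (h : Incr r) (hρ : IsSup r ρ)
    (hs : IsStarProjection s) (hr : ∀ n, Le (r n) s) : Le ρ s := by
  obtain ⟨z, hz, hi, hf⟩ := exists_cen_idem_fin s hs
  refine .glue hz hs ?_ ?_
  · have hc := h.cut hz
    exact hi.sup_le (fun n => ((Le.of_le (hc.dif_proj n) (hc.mul_dif le_rfl)).trans
      ((hr n).cut hz))) (fun _ _ => hc.dif_orth) (hc.isSup_dif (hρ.cut hz))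
  · exact (h.cut hz.compl).sup_le_of_fin (hρ.cut hz.compl) (hz.compl.mul_proj hs) hf
      fun n => (hr n).cut hz.compl

theorem Incr.sup_eqv {p q : ℕ → R} {P Q : R} (hp : Incr p) (hq : Incr q) (h : ∀ n, Eqv (p n) (q n))
    (hP : IsSup p P) (hQ : IsSup q Q) : Eqv P Q :=
  (hp.sup_le hP hQ.proj fun n => (h n).le.mono (hQ.le n)).antisymm
    (hq.sup_le hQ hP.proj fun n => (h n).symm.le.mono (hP.le n))

/-- No nonzero central cut of `a` is purely infinite and dominates the cuts of `s`, `s'`. -/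
def NoDom (a s a' s' : R) : Prop :=
  ∀ z, Cen z → Idem (z * a) → Le (z * s) (z * a) → Le (z * s') (z * a') → z * a = 0

theorem NoDom.cut {a s a' s' z : R} (h : NoDom a s a' s') (hz : Cen z) :
    NoDom (z * a) (z * s) (z * a') (z * s') := by
  intro y hy
  simp only [← mul_assoc]
  exact h _ (hy.mul hz)

theorem Idem.eqv_add_of_le {a s : R} (ha : Idem a) (hs : IsStarProjection s) (h : Le s a)
    (o : a * s = 0) : Eqv (a + s) a :=
  (ha.add_le (.refl ha.proj) h o).antisymm (.of_le ha.proj (by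
    rw [add_mul, ha.proj.mm, hs.orth_symm ha.proj o, add_zero]))

theorem Idem.eqv_add_of_ge {a s : R} (ha : Idem a) (hs : IsStarProjection s) (h : Le a s)
    (o : a * s = 0) : Eqv (a + s) s := by
  have o' := hs.orth_symm ha.proj o
  have := ha.add_le_right hs h (.refl ha.proj) o'
  rw [add_comm] at this
  exact this.antisymm (.of_le hs (by rw [add_mul, hs.mm, o, zero_add]))

theorem NoDom.eqv_of_idem {a s a' s' : R} (h : NoDom a s a' s') (ha : Idem a)
    (hs : IsStarProjection s) (hs' : IsStarProjection s') (haa : Eqv a a') (o : a * s = 0)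
    (o' : a' * s' = 0) (hsum : Eqv (a + s) (a' + s')) : Eqv s s' := by
  have key : ∀ {a s a' s' : R}, NoDom a s a' s' → Idem a → IsStarProjection s →
      IsStarProjection s' → Eqv a a' → Le s a → Le s' a' → Eqv s s' := by
    intro a s a' s' h ha hs hs' haa l1 l2
    have := h 1 .one (by rwa [one_mul]) (by rwa [one_mul, one_mul]) (by rwa [one_mul, one_mul])
    rw [one_mul] at this
    rw [l1.eq_zero this, l2.eq_zero (haa.symm.eq_zero this)]
    exact .refl (.zero R)
  obtain ⟨z, hz, l1, l2⟩ := exists_cen_le s a hs ha.proj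
  obtain ⟨y, hy, m1, m2⟩ := exists_cen_le s' a' hs' haa.right
  have hz' := hz.compl
  have hy' := hy.compl
  have red : ∀ w, Cen w → (Le (w * s) (w * a) ∨ Le (w * a) (w * s)) →
      (Le (w * s') (w * a') ∨ Le (w * a') (w * s')) → Eqv (w * s) (w * s') := by
    intro w hw h1 h2
    have wa := ha.cut hw
    have wa' := wa.of_eqv (haa.cut hw)
    have ws := hw.mul_proj hs
    have ws' := hw.mul_proj hs'
    have wo : w * a * (w * s) = 0 := by rw [hw.mul_mul, o, mul_zero]
    have wo' : w * a' * (w * s') = 0 := by rw [hw.mul_mul, o', mul_zero]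
    have wsum := hsum.cut hw
    rw [mul_add, mul_add] at wsum
    have waa := haa.cut hw
    rcases h1 with h1 | h1 <;> rcases h2 with h2 | h2
    · exact key (h.cut hw) wa ws ws' waa h1 h2
    · have f1 : Eqv (w * s') (w * a') := ((wa'.eqv_add_of_ge ws' h2 wo').symm.trans wsum.symm).trans
        ((wa.eqv_add_of_le ws h1 wo).trans waa)
      exact key (h.cut hw) wa ws ws' waa h1 f1.le
    · have f1 : Eqv (w * s) (w * a) := ((wa.eqv_add_of_ge ws h1 wo).symm.trans wsum).trans
        ((wa'.eqv_add_of_le ws' h2 wo').trans waa.symm)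
      exact key (h.cut hw) wa ws ws' waa f1.le h2
    · exact ((wa.eqv_add_of_ge ws h1 wo).symm.trans wsum).trans (wa'.eqv_add_of_ge ws' h2 wo')
  refine .glue hz (.glue hy ?_ ?_) (.glue hy ?_ ?_)
  all_goals simp only [← mul_assoc]
  · exact red _ (hy.mul hz) (.inl (by simpa only [mul_assoc] using l1.cut hy))
      (.inl (by simpa only [mul_assoc, ← hz.comm y] using m1.cut hz))
  · exact red _ (hy'.mul hz) (.inl (by simpa only [mul_assoc] using l1.cut hy'))
      (.inr (by rw [← hz.comm]; simpa only [mul_assoc] using m2.cut hz))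
  · exact red _ (hy.mul hz') (.inr (by simpa only [mul_assoc] using l2.cut hy))
      (.inl (by rw [← hz'.comm]; simpa only [mul_assoc] using m1.cut hz'))
  · exact red _ (hy'.mul hz') (.inr (by simpa only [mul_assoc] using l2.cut hy'))
      (.inr (by rw [← hz'.comm]; simpa only [mul_assoc] using m2.cut hz'))

theorem NoDom.eqv {a s a' s' : R} (h : NoDom a s a' s')
    (hs : IsStarProjection s) (hs' : IsStarProjection s') (haa : Eqv a a') (o : a * s = 0)
    (o' : a' * s' = 0) (hsum : Eqv (a + s) (a' + s')) : Eqv s s' := by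
  obtain ⟨z, hz, hi, hf⟩ := exists_cen_idem_fin a haa.left
  have hz' := hz.compl
  have c1 := hsum.cut hz
  have c2 := hsum.cut hz'
  rw [mul_add, mul_add] at c1 c2
  refine .glue hz ?_ ?_
  · exact (h.cut hz).eqv_of_idem hi (hz.mul_proj hs) (hz.mul_proj hs') (haa.cut hz)
      (by rw [hz.mul_mul, o, mul_zero]) (by rw [hz.mul_mul, o', mul_zero]) c1
  · exact c2.cancel (hz'.mul_proj hs) (hz'.mul_proj hs') (hf.mono (haa.symm.cut hz').le)
      (by rw [hz'.mul_mul, o, mul_zero]) (by rw [hz'.mul_mul, o', mul_zero]) (haa.cut hz')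

theorem IsSup.cen_mul {ι : Type*} {f : ι → R} {Z a : R} (hf : ∀ i, Cen (f i)) (h : IsSup f Z)
    (ha : IsStarProjection a) : IsSup (fun i => f i * a) (Z * a) := by
  have hZ := h.cen hf
  refine ⟨hZ.mul_proj ha, fun i => ?_, fun x hx => ?_⟩
  · rw [mul_assoc, (hf i).le ha, asc (h.le i)]
  · rw [hZ.comm, ← mul_assoc]
    exact h.least _ fun i => by rw [mul_assoc, ← (hf i).comm, hx]

theorem Cen.orth_of {v w x y : R} (hw : Cen w) (h : v * w = 0) (hx : v * x = x)
    (hy : w * y = y) : x * y = 0 := by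
  have : v * x * (w * y) = v * w * (x * y) := by
    rw [mul_assoc, ← mul_assoc x, ← hw.comm x]
    simp only [mul_assoc]
  rw [← hx, ← hy, this, h, zero_mul]

theorem Le.cen_sup {ι : Type*} {f : ι → R} {Z a b : R} (hf : ∀ i, Cen (f i)) (h : IsSup f Z)
    (ho : ∀ i j, i ≠ j → f i * f j = 0)
    (ha : IsStarProjection a) (hb : IsStarProjection b) (hl : ∀ i, Le (f i * b) (f i * a)) :
    Le (Z * b) (Z * a) := by
  choose r hr ha' using hl
  have hfr : ∀ i, f i * r i = r i := fun i => by
    rw [← ha', ← mul_assoc, ← mul_assoc, (hf i).proj.mm]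
  have hfb : ∀ i, f i * (f i * b) = f i * b := fun i => by rw [← mul_assoc, (hf i).proj.mm]
  obtain ⟨P, hP⟩ := exists_isSup fun i => (hr i).right
  refine ⟨P, Eqv.sup hr (fun i j hij => (hf j).orth_of (ho i j hij) (hfb i) (hfb j))
    (fun i j hij => (hf j).orth_of (ho i j hij) (hfr i) (hfr j)) (h.cen_mul hf hb) hP,
    hP.le_of fun i => ?_⟩
  have := (h.cen_mul hf ha).le i
  rw [← ha', asc this]

theorem exists_maximal_cen (a b a' b' : R) (ha : IsStarProjection a) (hb : IsStarProjection b)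
    (ha' : IsStarProjection a') (hb' : IsStarProjection b') :
    ∃ Z, Cen Z ∧ Idem (Z * a) ∧ Le (Z * b) (Z * a) ∧ Le (Z * b') (Z * a') ∧
      ∀ y, Cen y → y * Z = 0 → Idem (y * a) → Le (y * b) (y * a) → Le (y * b') (y * a') → y = 0 := by
  obtain ⟨S, hS, hS2, hmax⟩ := exists_maximal_pairwise
    (fun y : R => Cen y ∧ Idem (y * a) ∧ Le (y * b) (y * a) ∧ Le (y * b') (y * a'))
    (fun v w => v * w = 0)
  have hc : ∀ v : S, Cen v.1 := fun v => (hS v v.2).1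
  obtain ⟨Z, hZ⟩ := exists_isSup (f := fun v : S => v.1) fun v => (hc v).proj
  have hne : ∀ v w : S, v ≠ w → v.1 * w.1 = 0 := fun v w h => hS2 v.2 w.2 fun e => h (Subtype.ext e)
  refine ⟨Z, hZ.cen hc, ?_, .cen_sup hc hZ hne ha hb fun v => (hS v v.2).2.2.1,
    .cen_sup hc hZ hne ha' hb' fun v => (hS v v.2).2.2.2, fun y hy hyZ h1 h2 h3 => ?_⟩
  · choose c d h1 h2 h3 h4 h5 using fun v : S => (hS v v.2).2.1
    have hva : ∀ v : S, v.1 * (v.1 * a) = v.1 * a := fun v => by rw [← mul_assoc, (hc v).proj.mm]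
    have hvc : ∀ v : S, v.1 * c v = c v := fun v => by rw [← h4, ← mul_assoc, hva]
    have hvd : ∀ v : S, v.1 * d v = d v := fun v => by rw [← h5, ← mul_assoc, hva]
    have hZa := hZ.cen_mul hc ha
    refine Idem.of_family h1 h2 (fun v w h => (hc w).orth_of (hne v w h) (hva v) (hva w))
      (fun v w h => (hc w).orth_of (hne v w h) (hvc v) (hvc w))
      (fun v w h => (hc w).orth_of (hne v w h) (hvd v) (hvd w)) (fun v w => ?_)
      hZa (fun v => ?_) fun v => ?_
    · by_cases h : v = w
      · rw [h, h3]
      · exact (hc w).orth_of (hne v w h) (hvc v) (hvd w)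
    · rw [← h4, asc (hZa.le v)]
    · rw [← h5, asc (hZa.le v)]
  · have hyv : ∀ v : S, y * v.1 = 0 := fun v => by
      rw [← hZ.le v, ← mul_assoc, hyZ, zero_mul]
    have := hmax y ⟨hy, h1, h2, h3⟩ fun w hw => ⟨hyv ⟨w, hw⟩, by
      have := hyv ⟨w, hw⟩
      rwa [hy.comm] at this⟩
    have := hyv ⟨y, this⟩
    rwa [hy.proj.mm] at this

end VN

namespace VN
variable {R : Type*} [Ring R] [StarRing R]

/-- A family of projections closed under products and joins, indexed by formal expressions. -/
structure Lat {ι : Type*} (m j : ι → ι → ι) (o : ι) (P : ι → R) : Prop where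
  proj : ∀ V, IsStarProjection (P V)
  mul : ∀ V W, P (m V W) = P V * P W
  add : ∀ V W, P (j V W) = P V + P W - P V * P W
  zero : P o = 0

/-- The bicommutant of a family. -/
def Bic {ι : Type*} (P : ι → R) (x : R) : Prop := ∀ y, (∀ V, Commute (P V) y) → Commute x y

namespace Bic
variable {ι : Type*} {P : ι → R} {x y z : R}

theorem mul (hx : Bic P x) (hy : Bic P y) : Bic P (x * y) :=
  fun w hw => (hx w hw).mul_left (hy w hw)

theorem add (hx : Bic P x) (hy : Bic P y) : Bic P (x + y) :=
  fun w hw => (hx w hw).add_left (hy w hw)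

theorem sub (hx : Bic P x) (hy : Bic P y) : Bic P (x - y) :=
  fun w hw => (hx w hw).sub_left (hy w hw)

theorem one : Bic P (1 : R) := fun w _ => Commute.one_left w

theorem compl (hx : Bic P x) : Bic P (1 - x) := one.sub hx

theorem of_mem (V : ι) : Bic P (P V) := fun _ hw => hw V

theorem cen (hz : Cen z) : Bic P z := fun w _ => hz.comm w

theorem sup {κ : Type*} {f : κ → R} (hf : ∀ i, IsStarProjection (f i)) (hb : ∀ i, Bic P (f i))
    (hs : IsSup f x) : Bic P x :=
  fun w hw => (hs.comm hf fun i => ((hb i w hw).eq).symm).symm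

end Bic

theorem _root_.IsStarProjection.mul_comm' {p q : R} (hp : IsStarProjection p)
    (hq : IsStarProjection q) (h : Commute p q) : IsStarProjection (p * q) :=
  hq.mul' hp h.eq

namespace Lat
variable {ι : Type*} {m j : ι → ι → ι} {o : ι} {P : ι → R}

theorem comm (h : Lat m j o P) (V W : ι) : Commute (P V) (P W) := by
  have := (h.proj (m V W)).st
  rw [h.mul, star_mul, (h.proj V).st, (h.proj W).st] at this
  exact this.symm

theorem bic_comm (h : Lat m j o P) {x y : R} (hx : Bic P x) (hy : Bic P y) : Commute x y :=
  hx y fun V => (hy _ fun W => h.comm W V).symm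

/-- The commutative ring of the bicommutant. -/
def bic (_ : Lat m j o P) : Subring R where
  carrier := {x | Bic P x}
  mul_mem' := Bic.mul
  one_mem' := Bic.one
  add_mem' := Bic.add
  zero_mem' := fun w _ => Commute.zero_left w
  neg_mem' := fun hx w hw => (hx w hw).neg_left

instance (h : Lat m j o P) : CommRing h.bic :=
  { (inferInstance : Ring h.bic) with
    mul_comm := fun x y => Subtype.ext (h.bic_comm x.2 y.2) }

end Lat

/-- Successive joins of a commuting sequence. -/
def joins (f : ℕ → R) : ℕ → R
  | 0 => 0
  | n + 1 => joins f n + (1 - joins f n) * f n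

theorem one_sub_joins (f : ℕ → R) (n : ℕ) :
    joins f n = 1 - ((List.range n).map fun i => 1 - f i).prod := by
  induction n with
  | zero => simp [joins]
  | succ n ih =>
    rw [List.range_succ, List.map_append, List.prod_append, List.map_singleton,
      List.prod_singleton, joins, ih]
    noncomm_ring

section
variable {f : ℕ → R} {F : R}

theorem joins_commute {x : R} (hx : ∀ i, Commute x (f i)) (n : ℕ) : Commute x (joins f n) := by
  induction n with
  | zero => exact Commute.zero_right x
  | succ n ih => exact ih.add_right (((Commute.one_right x).sub_right ih).mul_right (hx n))

theorem incr_joins (hf : ∀ i, IsStarProjection (f i)) (hc : ∀ i j, Commute (f i) (f j)) :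
    Incr (joins f) := by
  have h1 : ∀ n, IsStarProjection (joins f n) := fun n => by
    induction n with
    | zero => exact .zero R
    | succ n ih =>
      have c : Commute (f n) (1 - joins f n) :=
        (Commute.one_right _).sub_right (joins_commute (fun i => hc n i) n)
      exact (ih.one_sub.mul_comm' (hf n) c.symm).add' ih (by
        rw [← mul_assoc, mul_sub, mul_one, ih.mm, sub_self, zero_mul])
  refine ⟨h1, fun n => ?_⟩
  rw [joins, add_mul, (h1 n).mm, mul_assoc, (joins_commute (fun i => hc n i) n).eq, ← mul_assoc,
    sub_mul, (h1 n).mm, one_mul, sub_self, zero_mul, add_zero]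

theorem joins_succ_mul (hf : ∀ i, IsStarProjection (f i)) (n : ℕ) :
    joins f (n + 1) * f n = f n := by
  rw [joins, add_mul, mul_assoc, (hf n).mm]
  noncomm_ring

theorem mul_joins {e : R} (h : ∀ i, e * f i = f i) (n : ℕ) :
    e * joins f n = joins f n := by
  induction n with
  | zero => simp [joins]
  | succ n ih =>
    rw [joins, mul_add, ih, ← mul_assoc, mul_sub, mul_one, ih, sub_mul, h, sub_mul, one_mul]

theorem IsSup.joins (hf : ∀ i, IsStarProjection (f i)) (hF : IsSup f F) : IsSup (joins f) F := by
  refine ⟨hF.proj, mul_joins hF.le, fun x hx => hF.least x fun i => ?_⟩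
  rw [← joins_succ_mul hf, ← mul_assoc, hx, zero_mul]

variable [VNRing R]

theorem Idem.sup_le_of_comm {y : R} (hy : Idem y) (hf : ∀ i, IsStarProjection (f i))
    (hc : ∀ i j, Commute (f i) (f j)) (hF : IsSup f F) (hl : ∀ i, Le (f i) y) : Le F y := by
  have hi := incr_joins hf hc
  refine hi.sup_le (hF.joins hf) hy.proj fun n => ?_
  induction n with
  | zero => exact .of_le (.zero R) (mul_zero _)
  | succ n ih =>
    have c : Commute (f n) (1 - VN.joins f n) :=
        (Commute.one_right _).sub_right (joins_commute (fun i => hc n i) n)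
    refine hy.add_le ih ((hl n).sub_left ((hi.proj n).one_sub.mul_comm' (hf n) c.symm) ?_) ?_
    · rw [← c.eq, ← mul_assoc, (hf n).mm]
    · rw [← mul_assoc, mul_sub, (hi.proj n).mm, mul_one, sub_self, zero_mul]

end

end VN

namespace VN
variable {R : Type*} [Ring R] [StarRing R]

theorem IsSup.cut_of_comm {ι : Type*} {f : ι → R} {F q : R} (h : IsSup f F)
    (hf : ∀ i, IsStarProjection (f i)) (hq : IsStarProjection q) (hc : ∀ i, Commute q (f i)) :
    IsSup (fun i => q * f i) (q * F) := by
  have hF : q * F = F * q := h.comm hf fun i => (hc i).eq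
  refine ⟨hq.mul_comm' h.proj hF, fun i => ?_, fun x hx => ?_⟩
  · rw [hF, mul_assoc, ← mul_assoc q, hq.mm, (hc i).eq, ← mul_assoc, h.le]
  · rw [← mul_assoc]
    exact h.least _ fun i => by rw [mul_assoc, hx]

theorem IsSup.comp_surjective {ι κ : Type*} {f : ι → R} {F : R} (h : IsSup f F) {g : κ → ι}
    (hg : Function.Surjective g) : IsSup (fun i => f (g i)) F :=
  ⟨h.proj, fun i => h.le _, fun x hx => h.least x fun i => by
    obtain ⟨i, rfl⟩ := hg i
    exact hx i⟩

namespace Lat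
variable {ι : Type*} {m j : ι → ι → ι} {o : ι} {P : ι → R}

theorem exists_lift (h : Lat m j o P) {x : R} (hx : Bic P x) : ∃ y : h.bic, (y : R) = x :=
  ⟨⟨x, hx⟩, rfl⟩

variable [VNRing R]

theorem exists_split [Countable ι] (h : Lat m j o P) (U : ι) (z : ι → R) (hz : ∀ V, Cen (z V))
    (hi : ∀ V, Idem (z V * (P V * P U)))
    (hl : ∀ V, Le (z V * (P V * (1 - P U))) (z V * (P V * P U))) :
    ∃ k, IsStarProjection k ∧ Bic P k ∧
      (∀ V, ∃ ζ, Cen ζ ∧ Idem (ζ * (P V * P U)) ∧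
        Le (P V * ((1 - P U) * (1 - k))) (ζ * (P V * P U))) ∧
      ∀ V (g : ℕ → ι), Function.Surjective g →
        Incr (fun n => joins (fun i => (1 - z (m (g i) V)) * P (m (g i) V)) n
          * ((1 - P U) * k)) ∧
        IsSup (fun n => joins (fun i => (1 - z (m (g i) V)) * P (m (g i) V)) n
          * ((1 - P U) * k)) (P V * ((1 - P U) * k)) := by
  have hfp : ∀ V W, IsStarProjection (z (m V W) * P (m V W)) := fun V W =>
    (hz _).mul_proj (h.proj _)
  have hfb : ∀ V W, Bic P (z (m V W) * P (m V W)) := fun V W => (Bic.cen (hz _)).mul (.of_mem _)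
  choose J hJ using fun V => exists_isSup (hfp V)
  have hJb : ∀ V, Bic P (J V) := fun V => .sup (hfp V) (hfb V) (hJ V)
  have hgb : ∀ V, Bic P (P V * (1 - J V)) := fun V => (Bic.of_mem V).mul (hJb V).compl
  have hgp : ∀ V, IsStarProjection (P V * (1 - J V)) := fun V =>
    (h.proj V).mul_comm' (hJ V).proj.one_sub (h.bic_comm (.of_mem V) (hJb V).compl)
  obtain ⟨k, hk⟩ := exists_isSup hgp
  have hkb : Bic P k := .sup hgp hgb hk
  obtain ⟨u, hu⟩ := h.exists_lift (.of_mem U)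
  obtain ⟨c, rfl⟩ := h.exists_lift hkb
  have hu2 : u * u = u := by
    apply Subtype.ext
    push_cast
    rw [hu, (h.proj U).mm]
  have hc2 : c * c = c := by
    apply Subtype.ext
    push_cast
    rw [hk.proj.mm]
  refine ⟨c, hk.proj, hkb, fun V => ?_, fun V g hg => ?_⟩
  · obtain ⟨ζ, hζ, h1, h2⟩ := exists_cen_idem_fin (P V * P U)
      ((h.proj V).mul_comm' (h.proj U) (h.comm V U))
    refine ⟨ζ, hζ, h1, ?_⟩
    have : Nonempty ι := ⟨U⟩
    obtain ⟨g, hg⟩ := exists_surjective_nat ι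
    have hVJ := (((hJ V).cut_of_comm (hfp V) (h.proj U).one_sub fun i =>
      h.bic_comm (Bic.of_mem U).compl (hfb V i)).comp_surjective hg)
    refine (h1.sup_le_of_comm (fun i => (h.proj U).one_sub.mul_comm' (hfp V _)
      (h.bic_comm (Bic.of_mem U).compl (hfb V _))) (fun i i' => h.bic_comm
        ((Bic.of_mem U).compl.mul (hfb V _)) ((Bic.of_mem U).compl.mul (hfb V _)))
      hVJ fun i => ?_).sub_left ?_ ?_
    · set T := m V (g i) with hT
      have hTV : P V * P T = P T := by rw [hT, h.mul, ← mul_assoc, (h.proj V).mm]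
      have e1 : (1 - P U) * (z T * P T) = z T * (P T * (1 - P U)) := by
        rw [h.bic_comm (Bic.of_mem U).compl (hfb V (g i)), mul_assoc]
      have hx := hi T
      set x := z T * (P T * P U) with hxd
      have hxV : P V * P U * x = x := by
        rw [hxd, (hz T).comm, ← mul_assoc, mul_assoc (P V), ← mul_assoc (P U), ← (h.comm T U).eq,
          mul_assoc (P T), (h.proj U).mm, ← mul_assoc (P V), hTV]
      have hx0 : (1 - ζ) * x = 0 := h2 _ (hx.cut hζ.compl)
        ((Le.of_le hx.proj hxV).cut hζ.compl)
      have hxx : x = ζ * x := by rw [← sub_eq_zero, ← hx0]; noncomm_ring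
      rw [e1]
      refine (hl T).trans ?_
      rw [← hxd, hxx]
      exact (Le.of_le hx.proj hxV).cut hζ
    · exact (h.proj V).mul_comm' ((h.proj U).one_sub.mul_comm' hk.proj.one_sub
        (h.bic_comm (Bic.of_mem U).compl hkb.compl))
        (h.bic_comm (.of_mem V) ((Bic.of_mem U).compl.mul hkb.compl))
    · obtain ⟨v, hv⟩ := h.exists_lift (.of_mem V)
      obtain ⟨w, hw⟩ := h.exists_lift (hJb V)
      have e := hk.le V
      rw [← hv, ← hw] at e
      rw [← hv, ← hw, ← hu]
      have e' : c * (v * (1 - w)) = v * (1 - w) := by exact_mod_cast e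
      have : (1 - u) * w * (v * ((1 - u) * (1 - c))) = v * ((1 - u) * (1 - c)) := by
        linear_combination (1-u)^2 * e' + hu2 * v * (1-c)
      exact_mod_cast congrArg Subtype.val this
  · set s := (1 - P U) * (c : R) with hsd
    set F : ℕ → R := fun i => (1 - z (m (g i) V)) * P (m (g i) V) with hFd
    have hsb : Bic P s := (Bic.of_mem U).compl.mul hkb
    have hsp : IsStarProjection s := (h.proj U).one_sub.mul_comm' hk.proj
      (h.bic_comm (Bic.of_mem U).compl hkb)
    have hFp : ∀ i, IsStarProjection (F i) := fun i => (hz _).compl.mul_proj (h.proj _)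
    have hFb : ∀ i, Bic P (F i) := fun i => (Bic.cen (hz _).compl).mul (.of_mem _)
    have hin := incr_joins hFp fun i i' => h.bic_comm (hFb i) (hFb i')
    have hsc : ∀ n, Commute s (joins F n) := fun n =>
      joins_commute (fun i => h.bic_comm hsb (hFb i)) n
    have hjs : ∀ n, joins F n * s * s = joins F n * s := fun n => by rw [mul_assoc, hsp.mm]
    have hrp : ∀ n, IsStarProjection (joins F n * s) := fun n =>
      (hin.proj n).mul_comm' hsp (hsc n).symm
    refine ⟨⟨hrp, fun n => ?_⟩,
      ⟨(h.proj V).mul_comm' hsp (h.bic_comm (.of_mem V) hsb), fun n => ?_, fun x hx => ?_⟩⟩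
    · rw [mul_assoc, ← mul_assoc s, (hsc n).eq, hjs, ← mul_assoc, hin.succ]
    · have hV : ∀ i, P V * F i = F i := fun i => by
        change P V * ((1 - z (m (g i) V)) * P (m (g i) V)) = (1 - z (m (g i) V)) * P (m (g i) V)
        rw [← mul_assoc, ← (hz _).compl.comm, mul_assoc, h.mul, (h.comm (g i) V).eq,
          ← mul_assoc (P V), (h.proj V).mm]
      rw [mul_assoc, ← mul_assoc s, (hsc n).eq, hjs, ← mul_assoc, mul_joins hV]
    · have hxi : ∀ i, x * (s * F i) = 0 := fun i => by
        have : s * F i = joins F (i + 1) * s * F i := by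
          rw [← (hsc _).eq, mul_assoc s, joins_succ_mul hFp]
        rw [this, ← mul_assoc, hx, zero_mul]
      rw [hsd, ← mul_assoc, ← mul_assoc]
      refine hk.least _ fun W => ?_
      obtain ⟨i, hi⟩ := hg W
      obtain ⟨v, hv⟩ := h.exists_lift (.of_mem V)
      obtain ⟨w, hw⟩ := h.exists_lift (.of_mem W)
      obtain ⟨y, hy⟩ := h.exists_lift (hJb W)
      obtain ⟨t, ht⟩ := h.exists_lift (Bic.cen (P := P) (hz (m W V)))
      have e := hk.le W
      have f := (hJ W).le V
      have w2 := (h.proj W).mm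
      rw [h.mul, ← ht, ← hw, ← hv, ← hy] at f
      rw [← hw, ← hy] at e
      rw [← hw] at w2
      have e' : c * (w * (1 - y)) = w * (1 - y) := by exact_mod_cast e
      have f' : y * (t * (w * v)) = t * (w * v) := by exact_mod_cast f
      have w2' : w * w = w := by exact_mod_cast w2
      have : v * (1 - u) * (w * (1 - y)) = (1 - u) * c * ((1 - t) * (w * v)) * (w * (1 - y)) := by
        linear_combination - ((1 - u) * (1 - t) * (w * v)) * e' - (1 - u) * f' -
          ((1 - u) * (1 - t) * v * (1 - y)) * w2'
      have h3 : P V * (1 - P U) * (P W * (1 - J W)) = s * F i * (P W * (1 - J W)) := by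
        rw [hFd, hsd]
        simp only
        rw [hi, h.mul, ← hv, ← hw, ← hu, ← hy, ← ht]
        exact_mod_cast congrArg Subtype.val this
      rw [mul_assoc x, mul_assoc, h3, ← mul_assoc, hxi, zero_mul]

end Lat

end VN

namespace VN
variable {R : Type*} [Ring R] [StarRing R]

theorem Cen.comp_left {η A p B : R} (h : Cen η) :
    η * (1 - A * ((1 - η * p) * B)) = η * (1 - A * ((1 - p) * B)) := by
  have e : η * (A * (η * p * B)) = η * (A * (p * B)) := by
    rw [← mul_assoc, h.comm A, mul_assoc, ← mul_assoc, mul_assoc η p, ← mul_assoc, ← mul_assoc,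
      mul_assoc A η η, h.proj.mm, ← h.comm, mul_assoc, mul_assoc]
  simp only [sub_mul, one_mul, mul_sub, e]

theorem Cen.comp_right {η A p B : R} (h : Cen η) :
    (1 - η) * (1 - A * ((1 - η * p) * B)) = (1 - η) * (1 - A * B) := by
  have e : (1 - η) * (A * (η * p * B)) = 0 := by
    rw [show A * (η * p * B) = η * (A * p * B) by simp only [← mul_assoc, h.comm A], ← mul_assoc,
      sub_mul, h.proj.mm, one_mul, sub_self, zero_mul]
  have e' : 1 - A * ((1 - η * p) * B) = 1 - A * B + A * (η * p * B) := by noncomm_ring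
  rw [e', mul_add, e, add_zero]

variable [VNRing R]

theorem Idem.eqv_add_of_cut {ζ a t : R} (hζ : Cen ζ) (ha : IsStarProjection a)
    (hi : Idem (ζ * a)) (h : Le t (ζ * a)) (o : a * t = 0) : Eqv (a + t) a := by
  have o1 : ζ * a * t = 0 := by rw [mul_assoc, o, mul_zero]
  have h1 := hi.eqv_add_of_le h.left h o1
  have h2 := Eqv.refl (hζ.compl.mul_proj ha)
  have o2 : (1 - ζ) * a * t = 0 := by rw [mul_assoc, o, mul_zero]
  have := h1.add h2 (by
    rw [add_mul, h.left.orth_symm (hζ.compl.mul_proj ha) o2, hζ.orth, add_zero]) hζ.orth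
  convert this using 1 <;> noncomm_ring

theorem NoDom.eqv_cut {ζ a t s a' t' s' : R} (hζ : Cen ζ)
    (h : NoDom (ζ * a) (ζ * (t + s)) (ζ * a') (ζ * (t' + s')))
    (hs : IsStarProjection s) (hs' : IsStarProjection s')
    (ht : Le t a) (ht' : Le t' a') (hat : Eqv (a + t) a) (hat' : Eqv (a' + t') a')
    (haa : Eqv a a') (hsum : Eqv (a + t + s) (a' + t' + s'))
    (o1 : a * s = 0) (o2 : t * s = 0) (o1' : a' * s' = 0) (o2' : t' * s' = 0) :
    Eqv (ζ * s) (ζ * s') := by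
  have hN : NoDom (ζ * (a + t)) (ζ * s) (ζ * (a' + t')) (ζ * s') := by
    intro z hz hi l1 l2
    have e := (hat.cut hζ).cut hz
    have e' := (hat'.cut hζ).cut hz
    have ia : Idem (z * (ζ * a)) := hi.of_eqv e
    have ia' : Idem (z * (ζ * a')) := ia.of_eqv ((haa.cut hζ).cut hz)
    refine e.eq_zero (h z hz ia ?_ ?_)
    · rw [mul_add, mul_add]
      exact ia.add_le ((ht.cut hζ).cut hz) (l1.right_of_eqv e)
        (by rw [hz.mul_mul, hζ.mul_mul, o2, mul_zero, mul_zero])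
    · rw [mul_add, mul_add]
      exact ia'.add_le ((ht'.cut hζ).cut hz) (l2.right_of_eqv e')
        (by rw [hz.mul_mul, hζ.mul_mul, o2', mul_zero, mul_zero])
  refine hN.eqv (hζ.mul_proj hs) (hζ.mul_proj hs') (((hat.trans haa).trans hat'.symm).cut hζ)
    ?_ ?_ ?_
  · rw [hζ.mul_mul, add_mul, o1, o2, add_zero, mul_zero]
  · rw [hζ.mul_mul, add_mul, o1', o2', add_zero, mul_zero]
  · rw [← mul_add, ← mul_add]
    exact hsum.cut hζ

theorem NoDom.join {ζ a b a' b' a₁ b₁ a₁' b₁' a₂ b₂ a₂' b₂' c : R} (hζ : Cen ζ)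
    (h1 : NoDom (ζ * a₁) (ζ * b₁) (ζ * a₁') (ζ * b₁'))
    (h2 : NoDom (ζ * a₂) (ζ * b₂) (ζ * a₂') (ζ * b₂'))
    (ha₁ : IsStarProjection a₁) (hc : IsStarProjection c) (hac : a = a₁ + c) (o : a₁ * c = 0)
    (l₁ : Le a₁ a) (l₂ : Le a₂ a) (lc : Le c a₂)
    (lb₁ : Le b₁ b) (lb₂ : Le b₂ b) (lb₁' : Le b₁' b') (lb₂' : Le b₂' b')
    (e : Eqv a a') (e₁ : Eqv a₁ a₁') (e₂ : Eqv a₂ a₂') :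
    NoDom (ζ * a) (ζ * b) (ζ * a') (ζ * b') := by
  intro z hz hi l l'
  have key : ∀ {y a₀ b₀ a₀' b₀' : R}, Cen y →
      NoDom (ζ * a₀) (ζ * b₀) (ζ * a₀') (ζ * b₀') → Le a₀ a → Le b₀ b → Le b₀' b' → Eqv a₀ a₀' →
      Le (y * (z * (ζ * a))) (y * (z * (ζ * a₀))) → y * (z * (ζ * a)) = 0 := by
    intro y a₀ b₀ a₀' b₀' hy hN la lb lb' e₀ hle
    refine hle.eq_zero ?_
    have := hN (y * z) (hy.mul hz)
    simp only [mul_assoc] at this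
    exact this ((hi.cut hy).of_le hle (((la.cut hζ).cut hz).cut hy))
      (((((lb.cut hζ).cut hz).cut hy).trans (l.cut hy)).trans hle)
      (((((((lb'.cut hζ).cut hz).cut hy).trans (l'.cut hy)).trans
        ((((e.symm.cut hζ).cut hz).cut hy).le)).trans hle).right_of_eqv
        (((e₀.cut hζ).cut hz).cut hy))
  obtain ⟨y, hy, m1, m2⟩ := hi.split (hz.mul_proj (hζ.mul_proj ha₁)) (hz.mul_proj (hζ.mul_proj hc))
    (by rw [hz.mul_mul, hζ.mul_mul, o, mul_zero, mul_zero]) (by rw [hac, mul_add, mul_add])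
  have k1 := key hy h2 l₂ lb₂ lb₂' e₂ (m1.trans (((lc.cut hζ).cut hz).cut hy))
  have k2 := key hy.compl h1 l₁ lb₁ lb₁' e₁ m2
  rw [← Cen.add_eq (z := y) (p := z * (ζ * a)), k1, k2, add_zero]

end VN

namespace VN
variable {R : Type*} [Ring R] [StarRing R]

namespace Lat
variable {ι : Type*} {m j : ι → ι → ι} {o : ι} {P Q : ι → R}

theorem mul_orth (h : Lat m j o P) {x y : R} (hx : Bic P x) (hxy : x * y = 0) (V W : ι) :
    P V * x * (P W * y) = 0 := by
  rw [mul_assoc, ← mul_assoc x, (h.bic_comm hx (.of_mem W)).eq, mul_assoc, hxy, mul_zero, mul_zero]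

theorem mul_proj (h : Lat m j o P) {x : R} (hx : Bic P x) (hp : IsStarProjection x) (V : ι) :
    IsStarProjection (P V * x) :=
  (h.proj V).mul_comm' hp (h.bic_comm (.of_mem V) hx)

variable [VNRing R]

theorem eqv_joins (hP : Lat m j o P) (hQ : Lat m j o Q) (hPQ : ∀ V, Eqv (P V) (Q V)) (U : ι)
    (z : ι → R) (hz : ∀ V, Cen (z V)) {s s' : R}
    (hN : ∀ V, NoDom ((1 - z V) * (P V * P U)) ((1 - z V) * (P V * (1 - P U)))
      ((1 - z V) * (Q V * Q U)) ((1 - z V) * (Q V * (1 - Q U))))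
    (hB : ∀ V ζ, Cen ζ → NoDom (ζ * (P V * P U)) (ζ * (P V * (1 - P U)))
      (ζ * (Q V * Q U)) (ζ * (Q V * (1 - Q U))) → Eqv (ζ * (P V * s)) (ζ * (Q V * s')))
    (L : List ι) : ∀ (T ζ), Cen ζ → NoDom (ζ * (P T * P U)) (ζ * (P T * (1 - P U)))
      (ζ * (Q T * Q U)) (ζ * (Q T * (1 - Q U))) →
      Eqv (ζ * ((1 - (1 - P T) * (L.map fun V => 1 - (1 - z V) * P V).prod) * s))
        (ζ * ((1 - (1 - Q T) * (L.map fun V => 1 - (1 - z V) * Q V).prod) * s')) := by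
  induction L with
  | nil =>
    intro T ζ hζ h
    simpa using hB T ζ hζ h
  | cons V L ih =>
    intro T ζ hζ h
    have hη := (hz V).compl
    have hcomp : ∀ {P : ι → R}, Lat m j o P → (1 - P T) * (1 - P V) = 1 - P (j T V) := fun h => by
      rw [h.add]; noncomm_ring
    have sw : ∀ {η : R} (_ : Cen η) (X s : R), η * (ζ * (X * s)) = ζ * ((η * X) * s) ∧
        η * ζ * (X * s) = ζ * ((η * X) * s) := fun {η} h X s => by
      constructor <;> simp only [← mul_assoc, h.comm ζ]
    have e1 : ∀ {P : ι → R} (_ : Lat m j o P) (s B : R),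
        (1 - z V) * (ζ * ((1 - (1 - P T) * ((1 - (1 - z V) * P V) * B)) * s)) =
          ((1 - z V) * ζ) * ((1 - (1 - P (j T V)) * B) * s) := by
      intro P hP s B
      rw [(sw hη _ _).1, (sw hη _ _).2, hη.comp_left, ← mul_assoc (1 - P T), hcomp hP]
    have e2 : ∀ {P : ι → R} (s B : R),
        (1 - (1 - z V)) * (ζ * ((1 - (1 - P T) * ((1 - (1 - z V) * P V) * B)) * s)) =
          ((1 - (1 - z V)) * ζ) * ((1 - (1 - P T) * B) * s) := by
      intro P s B
      rw [(sw hη.compl _ _).1, (sw hη.compl _ _).2, hη.comp_right]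
    simp only [List.map_cons, List.prod_cons]
    refine .glue hη ?_ ?_
    · rw [e1 hP, e1 hQ]
      refine ih _ _ (hη.mul hζ) ?_
      have n1 := h.cut hη
      have n2 := (hN V).cut hζ
      simp only [← mul_assoc ζ, hζ.comm (1 - z V)] at n2
      simp only [← mul_assoc] at n1 n2 ⊢
      simp only [mul_assoc _ _ (1 - P U), mul_assoc _ _ (P U), mul_assoc _ _ (1 - Q U),
        mul_assoc _ _ (Q U)] at n1 n2 ⊢
      have hb : ∀ {P : ι → R} (h : Lat m j o P), Bic P (1 - P U) := fun _ => (Bic.of_mem U).compl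
      have pp : ∀ {P : ι → R} (h : Lat m j o P) {x : R} (_ : Bic P x) (_ : IsStarProjection x),
          Le (P T * x) (P (j T V) * x) ∧ Le (P V * x) (P (j T V) * x) := by
        intro P h x hx px
        have hc := h.bic_comm hx (Bic.of_mem (j T V))
        refine ⟨.of_le (h.mul_proj hx px _) ?_, .of_le (h.mul_proj hx px _) ?_⟩
        · rw [mul_assoc, ← mul_assoc x, (h.bic_comm hx (Bic.of_mem T)).eq, mul_assoc, px.mm,
            ← mul_assoc, h.add]
          congr 1
          rw [sub_mul, add_mul, (h.proj T).mm, mul_assoc, (h.comm V T).eq, ← mul_assoc,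
            (h.proj T).mm, add_sub_cancel_right]
        · rw [mul_assoc, ← mul_assoc x, (h.bic_comm hx (Bic.of_mem V)).eq, mul_assoc, px.mm,
            ← mul_assoc, h.add]
          congr 1
          rw [sub_mul, add_mul, (h.proj V).mm, mul_assoc, (h.proj V).mm, add_sub_cancel_left]
      have mm : ∀ V, Eqv (P V * P U) (Q V * Q U) := fun V => by
        rw [← hP.mul, ← hQ.mul]; exact hPQ _
      have c1 := (hP.proj U).one_sub
      have c2 := (hQ.proj U).one_sub
      have hUT : Bic P (P U * (1 - P T)) := (Bic.of_mem U).mul (Bic.of_mem T).compl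
      have hUTp : IsStarProjection (P U * (1 - P T)) := (hP.proj U).mul_comm' (hP.proj T).one_sub
        (hP.bic_comm (.of_mem U) (Bic.of_mem T).compl)
      obtain ⟨t, ht⟩ := hP.exists_lift (.of_mem T)
      obtain ⟨v, hv⟩ := hP.exists_lift (.of_mem V)
      obtain ⟨u, hu⟩ := hP.exists_lift (.of_mem U)
      refine NoDom.join (c := P V * (P U * (1 - P T))) (hη.mul hζ) n1 n2
        (hP.mul_proj (.of_mem U) (hP.proj U) _)
        ?_ ?_ ?_ (pp hP (.of_mem U) (hP.proj U)).1 (pp hP (.of_mem U) (hP.proj U)).2 ?_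
        (pp hP (hb hP) c1).1 (pp hP (hb hP) c1).2 (pp hQ (hb hQ) c2).1 (pp hQ (hb hQ) c2).2
        (mm _) (mm _) (mm _)
      · exact hP.mul_proj hUT hUTp _
      · have : (t + v - t * v) * u = t * u + v * (u * (1 - t)) := by ring
        rw [hP.add, ← ht, ← hv, ← hu]
        exact_mod_cast congrArg Subtype.val this
      · have t2 := (hP.proj T).mm
        rw [← ht] at t2 ⊢
        rw [← hv, ← hu]
        have t2' : t * t = t := by exact_mod_cast t2
        have : t * u * (v * (u * (1 - t))) = 0 := by linear_combination (- v * u * u) * t2'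
        exact_mod_cast congrArg Subtype.val this
      · refine .of_le (hP.mul_proj hUT hUTp _) ?_
        have v2 := (hP.proj V).mm
        have u2 := (hP.proj U).mm
        rw [← hv] at v2 ⊢
        rw [← hu] at u2 ⊢
        rw [← ht]
        have v2' : v * v = v := by exact_mod_cast v2
        have u2' : u * u = u := by exact_mod_cast u2
        have : v * u * (v * (u * (1 - t))) = v * (u * (1 - t)) := by
          linear_combination (u * u * (1 - t)) * v2' + v * (1 - t) * u2'
        exact_mod_cast congrArg Subtype.val this
    · rw [e2, e2]
      refine ih _ _ (hη.compl.mul hζ) ?_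
      simpa only [mul_assoc] using h.cut hη.compl

end Lat

end VN

namespace VN
variable {R : Type*} [Ring R] [StarRing R]

namespace Lat
variable {ι : Type*} {m j : ι → ι → ι} {o : ι} {P Q : ι → R}

theorem parts (h : Lat m j o P) (U : ι) {k : R} (hk : IsStarProjection k) (hb : Bic P k) :
    IsStarProjection ((1 - P U) * k) ∧ Bic P ((1 - P U) * k) ∧ P U * ((1 - P U) * k) = 0 ∧
      ((1 - P U) * k) * P U = 0 := by
  have hu := (h.proj U)
  have e : P U * (1 - P U) = 0 := by rw [mul_sub, hu.mm, mul_one, sub_self]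
  refine ⟨hu.one_sub.mul_comm' hk (h.bic_comm (Bic.of_mem U).compl hb),
    (Bic.of_mem U).compl.mul hb, by rw [← mul_assoc, e, zero_mul], ?_⟩
  rw [mul_assoc, h.bic_comm hb (.of_mem U), ← mul_assoc, sub_mul, hu.mm, one_mul, sub_self,
    zero_mul]

theorem parts_orth (h : Lat m j o P) (U : ι) {k : R} (hk : IsStarProjection k) (hb : Bic P k) :
    (1 - P U) * (1 - k) * ((1 - P U) * k) = 0 := by
  rw [← mul_assoc, mul_assoc (1 - P U) (1 - k), h.bic_comm hb.compl (Bic.of_mem U).compl,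
    ← mul_assoc, mul_assoc, sub_mul 1 k, hk.mm, one_mul, sub_self, mul_zero]

variable [VNRing R]

theorem step [Countable ι] (hP : Lat m j o P) (hQ : Lat m j o Q) (hPQ : ∀ V, Eqv (P V) (Q V))
    (U : ι) : ∃ e f, IsStarProjection e ∧ IsStarProjection f ∧ (∀ V, Commute e (P V)) ∧
      (∀ V, Commute f (Q V)) ∧ (∀ V, Eqv (P V * e) (Q V * f)) ∧
      (∀ V, Eqv (P V * (1 - e)) (Q V * (1 - f))) ∧ (1 - e) * P U = 0 ∧ (1 - f) * Q U = 0 ∧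
      (∀ U', P U' * P U = 0 → P U' * e = 0) ∧ ∀ U', Q U' * Q U = 0 → Q U' * f = 0 := by
  have hpa : ∀ V, IsStarProjection (P V * P U) := hP.mul_proj (.of_mem U) (hP.proj U)
  have hqa : ∀ V, IsStarProjection (Q V * Q U) := hQ.mul_proj (.of_mem U) (hQ.proj U)
  have haa : ∀ V, Eqv (P V * P U) (Q V * Q U) := fun V => by
    rw [← hP.mul, ← hQ.mul]; exact hPQ _
  choose z hz hi hl hl' hmax using fun V => exists_maximal_cen (P V * P U) (P V * (1 - P U))
    (Q V * Q U) (Q V * (1 - Q U)) (hpa V)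
    (hP.mul_proj (Bic.of_mem U).compl (hP.proj U).one_sub V) (hqa V)
    (hQ.mul_proj (Bic.of_mem U).compl (hQ.proj U).one_sub V)
  obtain ⟨k, hk, kb, kA, kB⟩ := hP.exists_split U z hz hi hl
  obtain ⟨l, hl, lb, lA, lB⟩ := hQ.exists_split U z hz (fun V => (hi V).of_eqv ((haa V).cut (hz V)))
    hl'
  have main : ∀ {P : ι → R} {k : R}, Lat m j o P → IsStarProjection k → Bic P k →
      (∀ V, ∃ ζ, Cen ζ ∧ Idem (ζ * (P V * P U)) ∧
        Le (P V * ((1 - P U) * (1 - k))) (ζ * (P V * P U))) →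
      (∀ V, Le (P V * ((1 - P U) * (1 - k))) (P V * P U)) ∧
      ∀ V, Eqv (P V * P U + P V * ((1 - P U) * (1 - k))) (P V * P U) := by
    intro P k h hk hb kA
    have hpa : ∀ V, IsStarProjection (P V * P U) := h.mul_proj (.of_mem U) (h.proj U)
    constructor <;> intro V <;> obtain ⟨ζ, hζ, h1, h2⟩ := kA V
    · exact h2.trans (hζ.cut_le (hpa V))
    · exact h1.eqv_add_of_cut hζ (hpa V) h2
        (h.mul_orth (.of_mem U) (h.parts U hk.one_sub hb.compl).2.2.1 V V)
  obtain ⟨p1, p2⟩ := main hP hk kb kA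
  obtain ⟨q1, q2⟩ := main hQ hl lb lA
  obtain ⟨pp, pb, po, po'⟩ := hP.parts U hk kb
  obtain ⟨qp, qb, qo, qo'⟩ := hQ.parts U hl lb
  obtain ⟨rp, rb, ro, ro'⟩ := hP.parts U hk.one_sub kb.compl
  obtain ⟨tp, tb, wo, wo'⟩ := hQ.parts U hl.one_sub lb.compl
  have hB : ∀ V ζ, Cen ζ → NoDom (ζ * (P V * P U)) (ζ * (P V * (1 - P U)))
      (ζ * (Q V * Q U)) (ζ * (Q V * (1 - Q U))) →
      Eqv (ζ * (P V * ((1 - P U) * k))) (ζ * (Q V * ((1 - Q U) * l))) := by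
    intro V ζ hζ hN
    have s1 : ∀ (p k v : R), v * (1 - p) = v * ((1 - p) * (1 - k)) + v * ((1 - p) * k) := by
      intros; noncomm_ring
    rw [s1 (P U) k, s1 (Q U) l] at hN
    refine hN.eqv_cut hζ (hP.mul_proj pb pp V) (hQ.mul_proj qb qp V) (p1 V) (q1 V) (p2 V) (q2 V)
      (haa V) ?_ (hP.mul_orth (.of_mem U) po V V) (hP.mul_orth rb (hP.parts_orth U hk kb) V V)
      (hQ.mul_orth (.of_mem U) qo V V) (hQ.mul_orth tb (hQ.parts_orth U hl lb) V V)
    convert hPQ V using 1 <;> noncomm_ring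
  have hN : ∀ V, NoDom ((1 - z V) * (P V * P U)) ((1 - z V) * (P V * (1 - P U)))
      ((1 - z V) * (Q V * Q U)) ((1 - z V) * (Q V * (1 - Q U))) := by
    intro V y hy h1 h2 h3
    simp only [← mul_assoc y] at h1 h2 h3 ⊢
    rw [hmax V (y * (1 - z V)) (hy.mul (hz V).compl) (by
      rw [mul_assoc, sub_mul, (hz V).proj.mm, one_mul, sub_self, mul_zero]) h1 h2 h3, zero_mul]
  have hEq1 : ∀ V, Eqv (P V * ((1 - P U) * k)) (Q V * ((1 - Q U) * l)) := by
    intro V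
    have : Nonempty ι := ⟨U⟩
    obtain ⟨g, hg⟩ := exists_surjective_nat ι
    obtain ⟨i1, i2⟩ := kB V g hg
    obtain ⟨j1, j2⟩ := lB V g hg
    refine i1.sup_eqv j1 (fun n => ?_) i2 j2
    have := hP.eqv_joins hQ hPQ U z hz hN hB ((List.range n).map fun i => m (g i) V) o 1 .one
      (fun y _ _ _ _ => by rw [hP.zero]; simp)
    rw [one_sub_joins, one_sub_joins]
    simpa [hP.zero, hQ.zero, Function.comp_def] using this
  have e1 : ∀ p k : R, 1 - (p + (1 - p) * (1 - k)) = (1 - p) * k := by intros; noncomm_ring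
  refine ⟨P U + (1 - P U) * (1 - k), Q U + (1 - Q U) * (1 - l), rp.add' (hP.proj U) ro,
    tp.add' (hQ.proj U) wo, fun V => hP.bic_comm ((Bic.of_mem U).add rb) (.of_mem V),
    fun V => hQ.bic_comm ((Bic.of_mem U).add tb) (.of_mem V), fun V => ?_, fun V => ?_,
    ?_, ?_, fun U' h => ?_, fun U' h => ?_⟩
  · rw [mul_add, mul_add]
    exact ((p2 V).trans (haa V)).trans (q2 V).symm
  · rw [e1, e1]
    exact hEq1 V
  · rw [e1, po']
  · rw [e1, qo']
  · rw [mul_add, h, zero_add]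
    exact (p1 U').eq_zero h
  · rw [mul_add, h, zero_add]
    exact (q1 U').eq_zero h

end Lat

end VN

namespace VN
variable {R : Type*} [Ring R] [StarRing R]

/-- A binary tree of projections. -/
structure Tree (e : List Bool → R) : Prop where
  proj : ∀ l, IsStarProjection (e l)
  add : ∀ l, e (true :: l) + e (false :: l) = e l
  orth : ∀ l, e (true :: l) * e (false :: l) = 0

/-- The sum of the left children `i` levels below a node. -/
def lefts (e : List Bool → R) : ℕ → List Bool → R
  | 0, l => e (true :: l)
  | i + 1, l => lefts e i (true :: l) + lefts e i (false :: l)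

namespace Tree
variable {e f : List Bool → R}

theorem orth' (h : Tree e) (l) : e (false :: l) * e (true :: l) = 0 :=
  (h.proj _).orth_symm (h.proj _) (h.orth l)

theorem mul_child (h : Tree e) (b : Bool) (l) : e l * e (b :: l) = e (b :: l) := by
  rw [← h.add l]
  cases b
  · rw [add_mul, h.orth, (h.proj _).mm, zero_add]
  · rw [add_mul, h.orth', (h.proj _).mm, add_zero]

theorem lefts_proj (h : Tree e) (i : ℕ) : ∀ l, IsStarProjection (lefts e i l) ∧
    e l * lefts e i l = lefts e i l := by
  induction i with
  | zero => exact fun l => ⟨h.proj _, h.mul_child _ _⟩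
  | succ i ih =>
    intro l
    refine ⟨(ih _).1.add' (ih _).1 ?_, ?_⟩
    · rw [← (ih (false :: l)).2, ← (ih (true :: l)).1.le_symm (h.proj _) (ih (true :: l)).2,
        mul_assoc, ← mul_assoc (e _) (e _), h.orth, zero_mul, mul_zero]
    · simp only [lefts]
      rw [mul_add, ← (ih (true :: l)).2, ← (ih (false :: l)).2, ← mul_assoc, ← mul_assoc,
        h.mul_child, h.mul_child]

theorem lefts_mul (h : Tree e) (i : ℕ) (l) : lefts e i l * e l = lefts e i l :=
  (h.lefts_proj i l).1.le_symm (h.proj _) (h.lefts_proj i l).2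

theorem sub_lefts_mul (i : ℕ) : ∀ {l x}, Tree e → (∀ l', l'.length = i + l.length →
    e (false :: l') * x = 0) → (e l - lefts e i l) * x = 0 := by
  induction i with
  | zero =>
    intro l x h hx
    rw [← h.add l, lefts, add_sub_cancel_left, hx l (by simp)]
  | succ i ih =>
    intro l x h hx
    have h1 := ih (l := true :: l) h fun l' hl' => hx l' (by simp only [hl', List.length_cons]; omega)
    have h2 := ih (l := false :: l) h fun l' hl' => hx l' (by simp only [hl', List.length_cons]; omega)
    rw [lefts, ← h.add l, add_sub_add_comm, add_mul, h1, h2, add_zero]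

theorem mul_lefts (i : ℕ) : ∀ {l x}, (∀ l', l'.length = i + l.length →
    x * e (true :: l') = 0) → x * lefts e i l = 0 := by
  induction i with
  | zero =>
    intro l x hx
    exact hx l (by simp)
  | succ i ih =>
    intro l x hx
    rw [lefts, mul_add, ih fun l' hl' => hx l' (by simp only [hl', List.length_cons]; omega),
      ih fun l' hl' => hx l' (by simp only [hl', List.length_cons]; omega), add_zero]

/-- Sum of the partial isometries `n` levels below a node. -/
def sums (v : List Bool → R) : ℕ → List Bool → R
  | 0, l => v l
  | n + 1, l => sums v n (true :: l) + sums v n (false :: l)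

theorem piso_sums {v : List Bool → R} (h : Tree e) (h' : Tree f) (hv : ∀ l, PIso (v l) (f l) (e l))
    (n : ℕ) : ∀ l, PIso (sums v n l) (f l) (e l) := by
  induction n with
  | zero => exact hv
  | succ n ih =>
    intro l
    rw [sums, ← h.add l, ← h'.add l]
    exact (ih _).add (ih _) (h'.orth l) (h.orth l)

theorem lefts_sums {v : List Bool → R} (h : Tree e) (h' : Tree f)
    (hv : ∀ l, PIso (v l) (f l) (e l)) (n : ℕ) : ∀ i < n, ∀ l,
      lefts e i l * sums v n l = sums v n l * lefts f i l := by
  have cross : ∀ n l {x}, x * e (true :: l) = x → x * sums v n (false :: l) = 0 := fun n l x hx => by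
    rw [← (piso_sums h h' hv n (false :: l)).fin_mul, ← hx, mul_assoc, ← mul_assoc (e _), h.orth,
      zero_mul, mul_zero]
  have cross' : ∀ n l {x}, x * e (false :: l) = x → x * sums v n (true :: l) = 0 := fun n l x hx => by
    rw [← (piso_sums h h' hv n (true :: l)).fin_mul, ← hx, mul_assoc, ← mul_assoc (e _), h.orth',
      zero_mul, mul_zero]
  have dross : ∀ n l {x}, f (true :: l) * x = x → sums v n (false :: l) * x = 0 := fun n l x hx => by
    rw [← (piso_sums h h' hv n (false :: l)).mul_init, ← hx, mul_assoc, ← mul_assoc (f _), h'.orth',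
      zero_mul, mul_zero]
  have dross' : ∀ n l {x}, f (false :: l) * x = x → sums v n (true :: l) * x = 0 := fun n l x hx => by
    rw [← (piso_sums h h' hv n (true :: l)).mul_init, ← hx, mul_assoc, ← mul_assoc (f _), h'.orth,
      zero_mul, mul_zero]
  induction n with
  | zero => intro i hi; omega
  | succ n ih =>
    intro i hi l
    match i with
    | 0 =>
      have := piso_sums h h' hv n (true :: l)
      rw [lefts, lefts, sums, mul_add, add_mul, cross n l (h.proj _).mm, dross n l (h'.proj _).mm,
        this.fin_mul, this.mul_init]
    | i + 1 =>
      simp only [lefts, sums, mul_add, add_mul, cross n l (h.lefts_mul _ _),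
        cross' n l (h.lefts_mul _ _), dross n l (h'.lefts_proj _ _).2,
        dross' n l (h'.lefts_proj _ _).2, ih i (by omega), add_zero, zero_add]

end Tree

namespace Lat
variable {ι : Type*} {m j : ι → ι → ι} {o : ι} {P Q : ι → R}

theorem cut (h : Lat m j o P) {e : R} (he : IsStarProjection e) (hc : ∀ V, Commute e (P V)) :
    Lat m j o fun V => P V * e := by
  refine ⟨fun V => (h.proj V).mul_comm' he (hc V).symm, fun V W => ?_, fun V W => ?_, ?_⟩
  · rw [h.mul, mul_assoc (P V) e, ← mul_assoc e, (hc W).eq, mul_assoc (P W), he.mm, mul_assoc]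
  · rw [h.add, mul_assoc (P V) e, ← mul_assoc e, (hc W).eq, mul_assoc (P W), he.mm, ← mul_assoc,
      sub_mul, add_mul]
  · rw [h.zero, zero_mul]

/-- Matching projections commuting with the two families. -/
def Node (P Q : ι → R) : Type _ := {x : R × R // IsStarProjection x.1 ∧ IsStarProjection x.2 ∧
  (∀ V, Commute x.1 (P V)) ∧ (∀ V, Commute x.2 (Q V)) ∧ ∀ V, Eqv (P V * x.1) (Q V * x.2)}

variable [VNRing R]

theorem step_node [Countable ι] (hP : Lat m j o P) (hQ : Lat m j o Q) {t : ι} (ht : P t = 1)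
    (ht' : Q t = 1) (U : ι) (x : Node P Q) : ∃ y w : Node P Q,
      (y.1 + w.1 = x.1 ∧ y.1 * w.1 = 0) ∧ w.1.1 * P U = 0 ∧ w.1.2 * Q U = 0 ∧
      (∀ U', P U' * P U = 0 → P U' * y.1.1 = 0) ∧ ∀ U', Q U' * Q U = 0 → Q U' * y.1.2 = 0 := by
  obtain ⟨⟨e, f⟩, he, hf, ce, cf, hef⟩ := x
  simp only at he hf ce cf hef
  obtain ⟨p, q, hp, hq, cp, cq, h1, h2, h3, h4, h5, h6⟩ := (hP.cut he ce).step (hQ.cut hf cf) hef U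
  have main : ∀ {P : ι → R} {e p : R}, P t = 1 → IsStarProjection e → IsStarProjection p →
      (∀ V, Commute e (P V)) → (∀ V, Commute p (P V * e)) → Commute e p ∧
      IsStarProjection (e * p) ∧ ∀ V, Commute (e * p) (P V) := by
    intro P e p ht he hp ce cp
    have hep : Commute e p := by simpa [ht] using (cp t).symm
    refine ⟨hep, he.mul_comm' hp hep, fun V => ?_⟩
    have := (cp V).eq
    rw [← (ce V).eq] at this
    rw [Commute, SemiconjBy, hep.eq, mul_assoc, this, ← hep.eq, ← mul_assoc, (ce V).eq]
  obtain ⟨a1, a2, a3⟩ := main ht he hp ce cp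
  obtain ⟨b1, b2, b3⟩ := main ht' hf hq cf cq
  obtain ⟨c1, c2, c3⟩ := main ht he hp.one_sub ce fun V => (Commute.one_left _).sub_left (cp V)
  obtain ⟨d1, d2, d3⟩ := main ht' hf hq.one_sub cf fun V => (Commute.one_left _).sub_left (cq V)
  have orth : ∀ {e p : R}, Commute e p → IsStarProjection p → e * p * (e * (1 - p)) = 0 := by
    intro e p h hp
    have h1 : Commute e (1 - p) := (Commute.one_right _).sub_right h
    rw [h1.eq, mul_assoc, ← mul_assoc p, mul_sub, hp.mm, mul_one, sub_self, zero_mul, mul_zero]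
  have low : ∀ {P : ι → R} {e p : R}, (∀ V, Commute p (P V * e)) →
      (∀ V, Commute (e * (1 - p)) (P V)) → (1 - p) * (P U * e) = 0 → e * (1 - p) * P U = 0 := by
    intro P e p cp c h
    rw [(c U).eq, ← mul_assoc, ← ((Commute.one_left _).sub_left (cp U)).eq, h]
  have cutz : ∀ {P : ι → R} {e p : R}, (∀ V, Commute e (P V)) →
      (∀ U', P U' * e * (P U * e) = 0 → P U' * e * p = 0) →
      ∀ U', P U' * P U = 0 → P U' * (e * p) = 0 := by
    intro P e p ce h U' hU
    rw [← mul_assoc]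
    refine h _ ?_
    rw [mul_assoc, ← mul_assoc e, (ce U).eq, ← mul_assoc, ← mul_assoc, hU, zero_mul, zero_mul]
  refine ⟨⟨(e * p, f * q), a2, b2, a3, b3, fun V => by simpa only [mul_assoc] using h1 V⟩,
    ⟨(e * (1 - p), f * (1 - q)), c2, d2, c3, d3, fun V => by simpa only [mul_assoc] using h2 V⟩,
    ⟨?_, ?_⟩, ?_, ?_, fun U' h => ?_, fun U' h => ?_⟩
  · exact Prod.ext (by simp [← mul_add]) (by simp [← mul_add])
  · exact Prod.ext (orth a1 hp) (orth b1 hq)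
  · exact low cp c3 h3
  · exact low cq d3 h4
  · exact cutz ce h5 U' h
  · exact cutz cf h6 U' h

end Lat

end VN

namespace VN
variable {R : Type*} [Ring R] [StarRing R] [VNRing R]

/-- Two equivalent families of projections can be separated compatibly at countably many
thresholds, by unitaries that match more and more of the separating projections. -/
theorem Lat.exists_unitaries {ι : Type*} {m j : ι → ι → ι} {o : ι} {P Q : ι → R} [Countable ι]
    (hP : Lat m j o P) (hQ : Lat m j o Q) (hPQ : ∀ V, Eqv (P V) (Q V)) {t : ι} (ht : P t = 1)
    (ht' : Q t = 1) (U : ℕ → ι) : ∃ E F u : ℕ → R,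
      (∀ i, IsStarProjection (E i)) ∧ (∀ i, IsStarProjection (F i)) ∧
      (∀ n, star (u n) * u n = 1) ∧ (∀ n, u n * star (u n) = 1) ∧ u 0 = 1 ∧
      (∀ n, ∀ i < n, E i * u n = u n * F i) ∧
      (∀ i, (1 - E i) * P (U i) = 0) ∧ (∀ i, (1 - F i) * Q (U i) = 0) ∧
      (∀ i W, P W * P (U i) = 0 → P W * E i = 0) ∧ ∀ i W, Q W * Q (U i) = 0 → Q W * F i = 0 := by
  choose y w hyw using hP.step_node hQ ht ht'
  let root : Lat.Node P Q := ⟨(1, 1), .one R, .one R, fun _ => .one_left _, fun _ => .one_left _,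
    fun V => by simpa using hPQ V⟩
  obtain ⟨N, N0, Nt, Nf⟩ : ∃ N : List Bool → Lat.Node P Q, N [] = root ∧
      (∀ l, N (true :: l) = y (U l.length) (N l)) ∧ ∀ l, N (false :: l) = w (U l.length) (N l) :=
    ⟨fun l => List.rec root (fun b l x => if b then y (U l.length) x else w (U l.length) x) l,
      rfl, fun l => rfl, fun l => rfl⟩
  have he : Tree fun l => (N l).1.1 := by
    refine ⟨fun l => (N l).2.1, fun l => ?_, fun l => ?_⟩
    · simp only [Nt, Nf]
      exact congrArg Prod.fst (hyw (U l.length) (N l)).1.1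
    · simp only [Nt, Nf]
      exact congrArg Prod.fst (hyw (U l.length) (N l)).1.2
  have hf : Tree fun l => (N l).1.2 := by
    refine ⟨fun l => (N l).2.2.1, fun l => ?_, fun l => ?_⟩
    · simp only [Nt, Nf]
      exact congrArg Prod.snd (hyw (U l.length) (N l)).1.1
    · simp only [Nt, Nf]
      exact congrArg Prod.snd (hyw (U l.length) (N l)).1.2
  have hv : ∀ l, ∃ v, PIso v (N l).1.2 (N l).1.1 ∧ (l = [] → v = 1) := by
    intro l
    rcases l with _ | ⟨b, l⟩
    · refine ⟨1, ?_, fun _ => rfl⟩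
      rw [N0]
      exact .refl (.one R)
    · obtain ⟨v, hv⟩ := (N (b :: l)).2.2.2.2.2 t
      rw [ht, ht', one_mul, one_mul] at hv
      exact ⟨star v, hv.symm, by simp⟩
  choose v hv hv1 using hv
  have hu := fun n => he.piso_sums hf hv n []
  have N1 : (N []).1 = (1, 1) := by rw [N0]
  simp only [N1] at hu
  refine ⟨fun i => lefts (fun l => (N l).1.1) i [], fun i => lefts (fun l => (N l).1.2) i [],
    fun n => Tree.sums v n [], fun i => (he.lefts_proj i _).1, fun i => (hf.lefts_proj i _).1,
    fun n => (hu n).source, fun n => (hu n).fin, hv1 _ rfl,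
    fun n i hi => he.lefts_sums hf hv n i hi [], fun i => ?_, fun i => ?_, fun i W h => ?_,
    fun i W h => ?_⟩
  · have := Tree.sub_lefts_mul i (l := []) (x := P (U i)) he fun l' hl' => ?_
    · simpa only [N1] using this
    · simpa [Nf, hl'] using (hyw (U l'.length) (N l')).2.1
  · have := Tree.sub_lefts_mul i (l := []) (x := Q (U i)) hf fun l' hl' => ?_
    · simpa only [N1] using this
    · simpa [Nf, hl'] using (hyw (U l'.length) (N l')).2.2.1
  · refine Tree.mul_lefts i fun l' hl' => ?_
    have hl : l'.length = i := by simpa using hl'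
    rw [Nt]
    exact (hyw (U l'.length) (N l')).2.2.2.1 W (by rwa [hl])
  · refine Tree.mul_lefts i fun l' hl' => ?_
    have hl : l'.length = i := by simpa using hl'
    rw [Nt]
    exact (hyw (U l'.length) (N l')).2.2.2.2 W (by rwa [hl])

end VN

namespace VN
variable {H : Type*} [NormedAddCommGroup H] [InnerProductSpace ℂ H] [CompleteSpace H]

theorem mem_vn_iff {M : VonNeumannAlgebra H} {x : H →L[ℂ] H} :
    x ∈ M ↔ ∀ g ∈ M.commutant, g * x = x * g := by
  conv_lhs => rw [← M.commutant_commutant]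
  exact VonNeumannAlgebra.mem_commutant_iff

theorem commutant_comm {M : VonNeumannAlgebra H} {x g : H →L[ℂ] H} (hx : x ∈ M)
    (hg : g ∈ M.commutant) : g * x = x * g := mem_vn_iff.1 hx g hg

/-- The projection onto the closure of an invariant subspace. -/
theorem starProjection_mem (M : VonNeumannAlgebra H) (K : Submodule ℂ H)
    (hK : ∀ g ∈ M.commutant, ∀ x ∈ K, g x ∈ K) :
    K.topologicalClosure.starProjection ∈ M := by
  rw [VonNeumannAlgebra.IsStarProjection.mem_iff isStarProjection_starProjection]
  intro y hy
  rw [Submodule.range_starProjection]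
  intro x hx
  exact map_mem_closure y.continuous hx fun z hz => hK y hy z hz

theorem comp_starProjection_eq_zero {K : Submodule ℂ H} {x : H →L[ℂ] H} (h : ∀ z ∈ K, x z = 0) :
    x * K.topologicalClosure.starProjection = 0 := by
  ext z
  have h1 : K.topologicalClosure.starProjection z ∈ K.topologicalClosure :=
    Submodule.starProjection_apply_mem _ _
  have : K.topologicalClosure ≤ LinearMap.ker x.toLinearMap :=
    K.topologicalClosure_minimal (fun z hz => h z hz) x.isClosed_ker
  exact this h1

theorem exists_polar_vn (M : VonNeumannAlgebra H) {t : H →L[ℂ] H} (ht : t ∈ M) :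
    ∃ v ∈ M, v * (star v * v) = v ∧ t * (star v * v) = t ∧
    (∀ x : H →L[ℂ] H, t * x = 0 → v * x = 0) ∧ ∀ y : H →L[ℂ] H, y * t = 0 → y * v = 0 := by
  set a := CFC.abs t with ha
  have ha0 : star a = a := (CFC.abs_nonneg t).isSelfAdjoint.star_eq
  have hsym : ∀ x y, inner ℂ (a x) y = inner ℂ x (a y) := fun x y => by
    conv_lhs => rw [← ha0]
    exact ContinuousLinearMap.adjoint_inner_left a y x
  have hn : ∀ x, ‖t x‖ = ‖a x‖ := by
    intro x
    have h2 : star a * a = star t * t := by rw [ha0]; exact CFC.abs_mul_abs t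
    have h3 : inner ℂ (t x) (t x) = inner ℂ (a x) (a x) := by
      rw [← ContinuousLinearMap.adjoint_inner_right t, ← ContinuousLinearMap.adjoint_inner_right a]
      exact congrArg (fun s : H →L[ℂ] H => inner ℂ x (s x)) h2.symm
    rw [@norm_eq_sqrt_re_inner ℂ, h3, ← @norm_eq_sqrt_re_inner ℂ]
  let K₀ : Submodule ℂ H := LinearMap.range a.toLinearMap
  let K := K₀.topologicalClosure
  have haK : ∀ x, a x ∈ K := fun x => K₀.le_topologicalClosure ⟨x, rfl⟩
  let e : H →ₗ[ℂ] K := a.toLinearMap.codRestrict K haK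
  have hd : DenseRange e := by
    intro x
    rw [closure_subtype]
    have : ((↑) '' Set.range e : Set H) = K₀ := by
      ext z
      constructor
      · rintro ⟨-, ⟨y, rfl⟩, rfl⟩
        exact ⟨y, rfl⟩
      · rintro ⟨y, rfl⟩
        exact ⟨_, ⟨y, rfl⟩, rfl⟩
    rw [this]
    exact x.2
  let f : K →L[ℂ] H := t.toLinearMap.extendOfNorm e
  have hf : ∀ x, f (e x) = t x := fun x =>
    LinearMap.extendOfNorm_eq hd ⟨1, fun x => by simpa using! (hn x).le⟩ x
  have hfn : ∀ x, ‖f x‖ = ‖x‖ := by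
    intro x
    refine hd.induction_on x (isClosed_eq (by fun_prop) (by fun_prop)) fun y => ?_
    rw [hf]
    exact hn y
  let p := K.starProjection
  let v : H →L[ℂ] H := f ∘L K.orthogonalProjectionOnto
  have hp : IsStarProjection p := isStarProjection_starProjection
  have hvn : ∀ x, ‖v x‖ = ‖p x‖ := fun x => hfn _
  have hva : ∀ x, v (a x) = t x := by
    intro x
    rw [← hf]
    refine congrArg f ?_
    exact Submodule.orthogonalProjectionOnto_mem_subspace_eq_self (⟨a x, haK x⟩ : K)
  have hpa : p * a = a := by
    ext x
    exact K.starProjection_eq_self_iff.2 (haK x)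
  have hap : a * p = a := by simpa [ha0, hp.st] using congrArg star hpa
  have hvp : v * p = v := by
    ext x
    change f (K.orthogonalProjectionOnto (K.starProjection x)) = f (K.orthogonalProjectionOnto x)
    congr 1
    exact Submodule.orthogonalProjectionOnto_mem_subspace_eq_self (K.orthogonalProjectionOnto x)
  have hvv : star v * v = p := by
    apply ContinuousLinearMap.coe_injective
    rw [← ext_inner_map]
    intro x
    have h1 : inner ℂ ((star v * v) x) x = inner ℂ (v x) (v x) :=
      ContinuousLinearMap.adjoint_inner_left v x (v x)
    have h2 : inner ℂ (p x) x = inner ℂ (p x) (p x) := by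
      conv_lhs => rw [← hp.mm]
      conv_lhs => enter [2, 1, 1]; rw [← hp.st]
      exact ContinuousLinearMap.adjoint_inner_left p x (p x)
    refine h1.trans (Eq.trans ?_ h2.symm)
    rw [inner_self_eq_norm_sq_to_K, inner_self_eq_norm_sq_to_K, hvn]
  have hva' : v * a = t := ContinuousLinearMap.ext hva
  have hkil : ∀ {x : H →L[ℂ] H}, x * a = 0 → x * p = 0 := fun {x} hx =>
    comp_starProjection_eq_zero (K := K₀) (by rintro - ⟨z, rfl⟩; exact DFunLike.congr_fun hx z)
  have hca : ∀ g ∈ M.commutant, Commute a g := by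
    intro g hg
    refine Commute.cfcAbs_left (commutant_comm ht hg).symm ?_
    exact (commutant_comm ht (star_mem hg)).symm
  have hcp : ∀ g ∈ M.commutant, g * p = p * g := by
    refine fun g hg => commutant_comm (starProjection_mem M K₀ ?_) hg
    rintro g hg - ⟨z, rfl⟩
    exact ⟨g z, DFunLike.congr_fun (hca g hg).eq z⟩
  refine ⟨v, mem_vn_iff.2 fun g hg => ?_, by rw [hvv, hvp], by rw [hvv, ← hva', mul_assoc, hap],
    fun x hx => ?_, fun y hy => ?_⟩
  · have h1 : (g * v - v * g) * a = 0 := by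
      rw [sub_mul, mul_assoc, hva', mul_assoc, ← (hca g hg).eq, ← mul_assoc, hva',
        commutant_comm ht hg, sub_self]
    have h2 := hkil h1
    rw [sub_mul, mul_assoc, hvp, mul_assoc, hcp g hg, ← mul_assoc, hvp] at h2
    exact sub_eq_zero.1 h2
  · have h1 : a * x = 0 := by
      ext z
      refine norm_eq_zero.1 ?_
      exact (hn (x z)).symm.trans (by simpa using! DFunLike.congr_fun hx z)
    have h2 : star x * a = 0 := by simpa [ha0] using congrArg star h1
    have h3 : p * x = 0 := by simpa [hp.st] using congrArg star (hkil h2)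
    rw [← hvp, mul_assoc, h3, mul_zero]
  · rw [← hva', ← mul_assoc] at hy
    rw [← hvp, ← mul_assoc]
    exact hkil hy

theorem exists_sup_vn (M : VonNeumannAlgebra H) (S : Set (H →L[ℂ] H)) (hS : ∀ p ∈ S, p ∈ M) :
    ∃ e ∈ M, IsStarProjection e ∧ (∀ p ∈ S, e * p = p) ∧
      ∀ x : H →L[ℂ] H, (∀ p ∈ S, x * p = 0) → x * e = 0 := by
  let K₀ : Submodule ℂ H := ⨆ p ∈ S, LinearMap.range p.toLinearMap
  refine ⟨K₀.topologicalClosure.starProjection, starProjection_mem M K₀ fun g hg => ?_,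
    isStarProjection_starProjection, fun p hp => ?_, fun x hx => comp_starProjection_eq_zero ?_⟩
  · change K₀ ≤ K₀.comap g.toLinearMap
    refine iSup₂_le fun p hp => ?_
    rintro - ⟨z, rfl⟩
    refine Submodule.mem_iSup_of_mem p (Submodule.mem_iSup_of_mem hp ⟨g z, ?_⟩)
    exact (DFunLike.congr_fun (commutant_comm (hS p hp) hg) z).symm
  · ext z
    refine Submodule.starProjection_eq_self_iff.2 (K₀.le_topologicalClosure ?_)
    exact Submodule.mem_iSup_of_mem p (Submodule.mem_iSup_of_mem hp ⟨z, rfl⟩)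
  · change K₀ ≤ LinearMap.ker x.toLinearMap
    refine iSup₂_le fun p hp => ?_
    rintro - ⟨z, rfl⟩
    exact DFunLike.congr_fun (hx p hp) z

end VN

namespace VN
variable {H : Type*} [NormedAddCommGroup H] [InnerProductSpace ℂ H] [CompleteSpace H]

theorem star_apply_inner (a : H →L[ℂ] H) (x y : H) : inner ℂ (star a x) y = inner ℂ x (a y) :=
  ContinuousLinearMap.adjoint_inner_left a y x

theorem inner_star_apply (a : H →L[ℂ] H) (x y : H) : inner ℂ x (star a y) = inner ℂ (a x) y :=
  ContinuousLinearMap.adjoint_inner_right a x y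

theorem _root_.IsStarProjection.norm_apply_le {p : H →L[ℂ] H} (hp : IsStarProjection p) (x : H) :
    ‖p x‖ ≤ ‖x‖ := by
  simpa using p.le_of_opNorm_le hp.norm_le x

section sum
variable {S : Set (H →L[ℂ] H)}

theorem orthogonalFamily_range
    (h2 : ∀ v ∈ S, ∀ w ∈ S, v ≠ w → star v * w = 0 ∧ v * star w = 0) : OrthogonalFamily ℂ
    (fun v : S => LinearMap.range v.1.toLinearMap) fun _ => Submodule.subtypeₗᵢ _ := by
  rintro v w hvw ⟨-, x, rfl⟩ ⟨-, y, rfl⟩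
  change inner ℂ (v.1 x) (w.1 y) = 0
  rw [← inner_star_apply]
  have : (star v.1 * w.1) y = 0 := by
    rw [(h2 v v.2 w w.2 (Subtype.coe_injective.ne hvw)).1]; rfl
  exact (congrArg (inner ℂ x) this).trans (inner_zero_right _)

theorem sum_norm_sq_le (h1 : ∀ v ∈ S, v * (star v * v) = v)
    (h2 : ∀ v ∈ S, ∀ w ∈ S, v ≠ w → star v * w = 0 ∧ v * star w = 0)
    (F : Finset S) (x : H) : ∑ v ∈ F, ‖v.1 x‖ ^ 2 ≤ ‖x‖ ^ 2 := by
  classical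
  have hp : IsStarProjection (∑ v ∈ F, star v.1 * v.1) := by
    induction F using Finset.induction_on with
    | empty => simp
    | insert v F hv ih =>
      rw [Finset.sum_insert hv]
      refine ih.add' (isStarProjection_mk ?_ (by simp)) ?_
      · rw [mul_assoc, h1 v v.2]
      · rw [Finset.mul_sum]
        refine Finset.sum_eq_zero fun w hw => ?_
        rw [mul_assoc, asc (h2 v v.2 w w.2 ?_).2, zero_mul, mul_zero]
        rintro h
        exact hv (Subtype.coe_injective h ▸ hw)
  have h3 : inner ℂ ((∑ v ∈ F, star v.1 * v.1) x) x = ((∑ v ∈ F, ‖v.1 x‖ ^ 2 : ℝ) : ℂ) := by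
    rw [_root_.sum_apply, sum_inner]
    push_cast
    refine Finset.sum_congr rfl fun v _ => ?_
    exact (star_apply_inner v.1 (v.1 x) x).trans (inner_self_eq_norm_sq_to_K _)
  have h4 := norm_inner_le_norm (𝕜 := ℂ) ((∑ v ∈ F, star v.1 * v.1) x) x
  rw [h3, Complex.norm_real, Real.norm_of_nonneg (by positivity)] at h4
  refine h4.trans ?_
  rw [sq]
  gcongr
  exact hp.norm_apply_le x

theorem summable_apply (h1 : ∀ v ∈ S, v * (star v * v) = v)
    (h2 : ∀ v ∈ S, ∀ w ∈ S, v ≠ w → star v * w = 0 ∧ v * star w = 0)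
    (x : H) : Summable fun v : S => v.1 x := by
  have := (orthogonalFamily_range h2).summable_iff_norm_sq_summable
    fun v : S => ⟨v.1 x, x, rfl⟩
  refine this.2 (summable_of_sum_le (c := ‖x‖ ^ 2) (fun v => sq_nonneg _) fun F => ?_)
  exact sum_norm_sq_le h1 h2 F x

theorem norm_tsum_apply_le (h1 : ∀ v ∈ S, v * (star v * v) = v)
    (h2 : ∀ v ∈ S, ∀ w ∈ S, v ≠ w → star v * w = 0 ∧ v * star w = 0)
    (x : H) : ‖∑' v : S, v.1 x‖ ≤ ‖x‖ := by
  refine le_of_tendsto (summable_apply h1 h2 x).hasSum.norm (.of_forall fun F => ?_)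
  refine le_of_sq_le_sq ?_ (norm_nonneg _)
  have := (orthogonalFamily_range h2).norm_sum (fun v : S => ⟨v.1 x, x, rfl⟩) F
  refine this.le.trans ?_
  exact sum_norm_sq_le h1 h2 F x

theorem exists_sum_vn (h1 : ∀ v ∈ S, v * (star v * v) = v)
    (h2 : ∀ v ∈ S, ∀ w ∈ S, v ≠ w → star v * w = 0 ∧ v * star w = 0) :
    ∃ u : H →L[ℂ] H, (∀ v ∈ S, u * (star v * v) = v ∧ v * star v * u = v) ∧
    ∀ g : H →L[ℂ] H, (∀ v ∈ S, g * v = v * g) → g * u = u * g := by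
  let u : H →L[ℂ] H := LinearMap.mkContinuous
    { toFun := fun x => ∑' v : S, v.1 x
      map_add' := fun x y => by
        simpa using (summable_apply h1 h2 x).tsum_add (summable_apply h1 h2 y)
      map_smul' := fun c x => by
        simpa using (summable_apply h1 h2 x).tsum_const_smul c } 1
    fun x => by simpa using norm_tsum_apply_le h1 h2 x
  have hu : ∀ x, u x = ∑' v : S, v.1 x := fun x => rfl
  have hgu : ∀ (g : H →L[ℂ] H) x, (g * u) x = ∑' v : S, (g * v.1) x := fun g x =>
    g.map_tsum (summable_apply h1 h2 x)
  refine ⟨u, fun v hv => ⟨?_, ?_⟩, fun g hg => ?_⟩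
  · ext x
    change ∑' w : S, (w.1 * (star v * v)) x = v x
    rw [tsum_eq_single ⟨v, hv⟩, h1 v hv]
    intro w hw
    rw [← mul_assoc, (h2 w w.2 v hv fun h => hw (Subtype.ext h)).2, zero_mul]
    rfl
  · ext x
    rw [hgu, tsum_eq_single ⟨v, hv⟩, mul_assoc, h1 v hv]
    intro w hw
    rw [mul_assoc, (h2 v hv w w.2 fun h => hw (Subtype.ext h.symm)).1, mul_zero]
    rfl
  · ext x
    rw [hgu]
    change _ = ∑' v : S, (v.1 * g) x
    exact tsum_congr fun v => by rw [hg v v.2]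

end sum

instance (M : VonNeumannAlgebra H) : VNRing M where
  polar t := by
    obtain ⟨v, hv, a, b, c, d⟩ := exists_polar_vn M t.2
    refine ⟨⟨v, hv⟩, Subtype.ext a, Subtype.ext b, fun x hx => Subtype.ext ?_,
      fun x hx => Subtype.ext ?_⟩
    · exact c _ (congrArg Subtype.val hx)
    · exact d _ (congrArg Subtype.val hx)
  sup S hS := by
    obtain ⟨e, he, a, b, c⟩ := exists_sup_vn M (Subtype.val '' S) (by rintro - ⟨p, -, rfl⟩; exact p.2)
    refine ⟨⟨e, he⟩, isStarProjection_mk (Subtype.ext a.mm) (Subtype.ext a.st),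
      fun p hp => Subtype.ext (b _ ⟨p, hp, rfl⟩), fun x hx => Subtype.ext (c x ?_)⟩
    rintro - ⟨p, hp, rfl⟩
    exact congrArg Subtype.val (hx p hp)
  sum S hS hS' := by
    obtain ⟨u, a, b⟩ := exists_sum_vn (S := Subtype.val '' S)
      (by rintro - ⟨v, hv, rfl⟩; exact congrArg Subtype.val (hS v hv))
      (by
        rintro - ⟨v, hv, rfl⟩ - ⟨w, hw, rfl⟩ h
        obtain ⟨h1, h2⟩ := hS' v hv w hw fun h' => h (congrArg _ h')
        exact ⟨congrArg Subtype.val h1, congrArg Subtype.val h2⟩)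
    refine ⟨⟨u, mem_vn_iff.2 fun g hg => b g ?_⟩, fun v hv => ?_⟩
    · rintro - ⟨v, hv, rfl⟩
      exact commutant_comm v.2 hg
    · obtain ⟨h1, h2⟩ := a v ⟨v, hv, rfl⟩
      exact ⟨Subtype.ext h1, Subtype.ext h2⟩

end VN

namespace VN
variable {R : Type*} [Ring R] [StarRing R]

/-- `p` is the right support projection of `t`. -/
structure IsSupp (t p : R) : Prop where
  proj : IsStarProjection p
  mul : t * p = t
  least : ∀ x, t * x = 0 → p * x = 0

namespace IsSupp
variable {t s p q : R}

theorem of_polar {v : R} (h1 : v * (star v * v) = v) (h2 : t * (star v * v) = t)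
    (h3 : ∀ x, t * x = 0 → v * x = 0) : IsSupp t (star v * v) :=
  ⟨isStarProjection_mk (by rw [mul_assoc, h1]) (by simp), h2,
    fun x hx => by rw [mul_assoc, h3 x hx, mul_zero]⟩

theorem unique (h : IsSupp t p) (k : IsSupp t q) : p = q := by
  have h1 : p * (1 - q) = 0 := h.least _ (by rw [mul_sub, k.mul, mul_one, sub_self])
  have h2 : q * (1 - p) = 0 := k.least _ (by rw [mul_sub, h.mul, mul_one, sub_self])
  rw [mul_sub, mul_one, sub_eq_zero] at h1 h2
  have h3 := congrArg star h1
  rw [star_mul, h.proj.st, k.proj.st, ← h2] at h3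
  exact h3

theorem zero : IsSupp (0 : R) 0 := ⟨.zero R, by simp, by simp⟩

theorem one : IsSupp (1 : R) 1 := ⟨.one R, by simp, by simp⟩

theorem mul_eq_zero_iff (h : IsSupp t p) {x : R} : t * x = 0 ↔ p * x = 0 :=
  ⟨h.least x, fun hx => by rw [← h.mul, mul_assoc, hx, mul_zero]⟩

theorem commute (h : IsSupp t p) (hs : star s = s) (hc : Commute t s) : Commute p s := by
  have h1 : p * (s * (1 - p)) = 0 := h.least _ (by
    rw [← mul_assoc, hc.eq, mul_assoc, mul_sub, h.mul, mul_one, sub_self, mul_zero])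
  rw [mul_sub, mul_sub, mul_one, sub_eq_zero] at h1
  have h2 := congrArg star h1
  simp only [star_mul, hs, h.proj.st] at h2
  exact h1.trans (by rw [← mul_assoc, ← h2])

theorem commute_supp (h : IsSupp t p) (k : IsSupp s q) (hs : star s = s)
    (hc : Commute t s) : Commute p q :=
  (k.commute h.proj.st (h.commute hs hc).symm).symm

theorem mul_supp (h : IsSupp t p) (k : IsSupp s q) (hs : star s = s)
    (hc : Commute t s) : IsSupp (t * s) (p * q) := by
  have hpq := h.commute_supp k hs hc
  have hps := h.commute hs hc
  refine ⟨k.proj.mul' h.proj hpq.eq, ?_, fun x hx => ?_⟩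
  · rw [mul_assoc, asc hps.eq.symm, mul_assoc, k.mul, asc h.mul]
  · rw [hpq.eq, mul_assoc]
    refine k.least _ ?_
    rw [asc hps.eq.symm, mul_assoc]
    exact h.least _ (by rw [← mul_assoc, hx])

theorem add_supp (h : IsSupp t p) (k : IsSupp s q) (hs : star s = s)
    (hc : Commute t s) (hz : ∀ x, (t + s) * x = 0 → t * x = 0) :
    IsSupp (t + s) (p + q - p * q) := by
  have hpq := h.commute_supp k hs hc
  have e : p + q - p * q = 1 - (1 - p) * (1 - q) := by noncomm_ring
  refine ⟨?_, ?_, fun x hx => ?_⟩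
  · rw [e]
    refine (k.proj.one_sub.mul' h.proj.one_sub ?_).one_sub
    exact ((Commute.one_left _).sub_left ((Commute.one_right _).sub_right hpq)).eq
  · rw [add_mul, mul_sub, mul_sub, mul_add, mul_add, k.mul, hpq.eq, asc k.mul, ← hpq.eq, asc h.mul,
      h.mul]
    abel
  · have h1 := hz x hx
    have h2 : s * x = 0 := by rwa [add_mul, h1, zero_add] at hx
    rw [sub_mul, add_mul, mul_assoc, h.least x h1, k.least x h2]
    simp

theorem le_of_ker (h : IsSupp t p) (k : IsSupp s q) (hz : ∀ x, s * x = 0 → t * x = 0) :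
    q * p = p := by
  have h1 : p * (1 - q) = 0 := h.least _ (hz _ (by rw [mul_sub, k.mul, mul_one, sub_self]))
  rw [mul_sub, mul_one, sub_eq_zero] at h1
  have h3 := congrArg star h1
  rw [star_mul, h.proj.st, k.proj.st] at h3
  exact h3.symm

end IsSupp

theorem exists_supp [VNRing R] (t : R) : ∃ p, IsSupp t p := by
  obtain ⟨v, h1, h2, h3, -⟩ := VNRing.polar t
  exact ⟨_, .of_polar h1 h2 h3⟩

end VN

namespace VN

section order
variable {B : Type*} [CStarAlgebra B] [PartialOrder B] [StarOrderedRing B]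

theorem mul_eq_zero_of_star_mul_mul {a x : B} (ha : 0 ≤ a) (h : star x * a * x = 0) :
    a * x = 0 := by
  have hs := CFC.sqrt_mul_sqrt_self a ha
  have hst : star (CFC.sqrt a) = CFC.sqrt a := (CFC.sqrt_nonneg a).isSelfAdjoint.star_eq
  have : CFC.sqrt a * x = 0 := by
    rw [← CStarRing.star_mul_self_eq_zero_iff, star_mul, hst, mul_assoc, asc hs, ← mul_assoc, h]
  rw [← hs, mul_assoc, this, mul_zero]

theorem mul_eq_zero_of_le {a b x : B} (ha : 0 ≤ a) (hab : a ≤ b) (h : b * x = 0) : a * x = 0 := by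
  refine mul_eq_zero_of_star_mul_mul ha (le_antisymm ?_ (star_left_conjugate_nonneg ha x))
  refine (star_left_conjugate_le_conjugate hab x).trans_eq ?_
  rw [mul_assoc, h, mul_zero]

end order

section cut
variable {B : Type*} [CStarAlgebra B]

/-- The positive part of `h - r`. -/
noncomputable def above (r : ℝ) (h : B) : B := cfc (fun t : ℝ => max (t - r) 0) h

/-- The negative part of `h - r`. -/
noncomputable def below (r : ℝ) (h : B) : B := cfc (fun t : ℝ => max (r - t) 0) h

theorem above_sub_below {h : B} (hh : IsSelfAdjoint h) (r : ℝ) :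
    above r h - below r h = h - algebraMap ℝ B r := by
  rw [above, below, ← cfc_sub _ _ h]
  conv_rhs => rw [← cfc_id ℝ h, ← cfc_const r h, ← cfc_sub _ _ h]
  refine cfc_congr fun t _ => ?_
  simp only [id]
  rcases le_total t r with h | h
  · rw [max_eq_right (by linarith), max_eq_left (by linarith)]; ring
  · rw [max_eq_left (by linarith), max_eq_right (by linarith)]; ring

theorem above_mul_below (h : B) (r : ℝ) : above r h * below r h = 0 := by
  rw [above, below, ← cfc_mul _ _ h]
  rw [← cfc_zero (R := ℝ) h]
  refine cfc_congr fun t _ => ?_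
  rcases le_total t r with h | h
  · simp [max_eq_right (sub_nonpos.2 h)]
  · simp [max_eq_right (sub_nonpos.2 h)]

variable [PartialOrder B] [StarOrderedRing B]

theorem above_nonneg (h : B) (r : ℝ) : 0 ≤ above r h := cfc_nonneg fun _ _ => le_max_right _ _

theorem below_nonneg (h : B) (r : ℝ) : 0 ≤ below r h := cfc_nonneg fun _ _ => le_max_right _ _

theorem above_anti (h : B) {r s : ℝ} (hrs : r ≤ s) : above s h ≤ above r h :=
  cfc_mono fun t _ => max_le_max_right _ (by linarith)

theorem below_mono (h : B) {r s : ℝ} (hrs : r ≤ s) : below r h ≤ below s h :=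
  cfc_mono fun t _ => max_le_max_right _ (by linarith)

theorem norm_sub_above_le {h : B} (hh : 0 ≤ h) {r : ℝ} (hr : 0 ≤ r) : ‖h - above r h‖ ≤ r := by
  have hs : IsSelfAdjoint h := hh.isSelfAdjoint
  have : h - above r h = cfc (fun t : ℝ => t - max (t - r) 0) h := by
    rw [cfc_sub (fun t => t) _ h, cfc_id' ℝ h, above]
  rw [this]
  refine norm_cfc_le hr fun t ht => ?_
  have : 0 ≤ t := spectrum_nonneg_of_nonneg hh ht
  rw [Real.norm_eq_abs, abs_le]
  rcases le_total t r with h | h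
  · rw [max_eq_right (by linarith)]; constructor <;> linarith
  · rw [max_eq_left (by linarith)]; constructor <;> linarith

end cut

end VN

namespace VN
variable {A H : Type*} [CommCStarAlgebra A] [PartialOrder A] [StarOrderedRing A]
  [NormedAddCommGroup H] [InnerProductSpace ℂ H] [CompleteSpace H] {M : VonNeumannAlgebra H}
  {σ : A →⋆ₐ[ℂ] (H →L[ℂ] H)}

theorem el_mul_eq_zero (hσ : ∀ a, σ a ∈ M) {a b : A} (ha : 0 ≤ a) (hab : a ≤ b) {x : M}
    (h : (⟨σ b, hσ b⟩ : M) * x = 0) : (⟨σ a, hσ a⟩ : M) * x = 0 :=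
  Subtype.ext (mul_eq_zero_of_le (map_nonneg σ ha) (OrderHomClass.mono σ hab)
    (congrArg Subtype.val h))

theorem lat_supp (hσ : ∀ a, σ a ∈ M) {ι : Type*} {m j : ι → ι → ι} {o : ι} {val : ι → A}
    (hv : ∀ V, 0 ≤ val V) (hm : ∀ V W, val (m V W) = val V * val W)
    (hj : ∀ V W, val (j V W) = val V + val W) (ho : val o = 0) {P : ι → M}
    (hP : ∀ V, IsSupp (⟨σ (val V), hσ _⟩ : M) (P V)) : Lat m j o P := by
  have hst : ∀ V, star (⟨σ (val V), hσ _⟩ : M) = ⟨σ (val V), hσ _⟩ := fun V =>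
    Subtype.ext (map_nonneg σ (hv V)).isSelfAdjoint.star_eq
  have hc : ∀ V W, Commute (⟨σ (val V), hσ _⟩ : M) ⟨σ (val W), hσ _⟩ := fun V W =>
    Subtype.ext ((Commute.all (val V) (val W)).map σ).eq
  refine ⟨fun V => (hP V).proj, fun V W => ?_, fun V W => ?_, ?_⟩
  · refine (hP _).unique ?_
    convert (hP V).mul_supp (hP W) (hst W) (hc V W) using 1
    exact Subtype.ext (by simp [hm])
  · refine (hP _).unique ?_
    have e : (⟨σ (val (j V W)), hσ _⟩ : M) = ⟨σ (val V), hσ _⟩ + ⟨σ (val W), hσ _⟩ :=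
      Subtype.ext (by simp [hj])
    rw [e]
    refine (hP V).add_supp (hP W) (hst W) (hc V W) fun x hx => ?_
    rw [← e] at hx
    exact el_mul_eq_zero hσ (hv V) (by rw [hj]; exact le_add_of_nonneg_right (hv W)) hx
  · refine (hP o).unique ?_
    convert IsSupp.zero using 1
    exact Subtype.ext (by simp [ho])

theorem inner_apply_nonneg {a : H →L[ℂ] H} (ha : 0 ≤ a) (x : H) : 0 ≤ (inner ℂ (a x) x).re :=
  ((ContinuousLinearMap.nonneg_iff_isPositive a).1 ha).re_inner_nonneg_left x

theorem supp_above_le (hσ : ∀ a, σ a ∈ M) {x u : H →L[ℂ] H} (hx : x ∈ M) (hu : u ∈ M)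
    {a : A} (ha : 0 ≤ a) {δ : ℝ}
    (h : ‖star u * x * u - σ a‖ < δ) {p r : M} (hp : IsSupp (⟨x, hx⟩ : M) p)
    (hr : IsSupp (⟨σ (above δ a), hσ _⟩ : M) r) : Le r p := by
  let u' : M := ⟨u, hu⟩
  have key : IsSupp (p * u' * r) r := by
    refine ⟨hr.proj, by rw [mul_assoc, hr.proj.mm], fun y hy => Subtype.ext ?_⟩
    ext z
    set η : H := (r * y).1 z with hη
    have h1 : x * u * (r * y).1 = 0 := by
      have : (⟨x, hx⟩ : M) * (u' * (r * y)) = 0 := by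
        rw [hp.mul_eq_zero_iff, ← mul_assoc, ← mul_assoc, hy]
      rw [mul_assoc]
      exact congrArg Subtype.val this
    have h2 : (star u * x * u) η = 0 := by
      have := congrArg (star u * ·) h1
      simp only [← mul_assoc, mul_zero] at this
      exact DFunLike.congr_fun this z
    have h3 : σ (below δ a) * r.1 = 0 := by
      have h4 : (⟨σ (above δ a), hσ _⟩ : M) * ⟨σ (below δ a), hσ _⟩ = 0 :=
        Subtype.ext (by
          change σ _ * σ _ = 0
          rw [← map_mul, above_mul_below, map_zero])
      have h5 := congrArg (fun s : M => star s.1) (hr.least _ h4)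
      have h6 : star (σ (below δ a)) = σ (below δ a) :=
        (map_nonneg σ (below_nonneg a δ)).isSelfAdjoint.star_eq
      have h7 : star r.1 = r.1 := congrArg Subtype.val hr.proj.st
      simpa [h6, h7] using h5
    have h4 : σ a η = σ (above δ a) η + (δ : ℂ) • η := by
      have e : σ a = σ (above δ a) - σ (below δ a) + algebraMap ℂ _ (δ : ℂ) := by
        rw [← map_sub, above_sub_below ha.isSelfAdjoint, map_sub]
        have : σ (algebraMap ℝ A δ) = algebraMap ℂ _ (δ : ℂ) := by
          rw [IsScalarTower.algebraMap_apply ℝ ℂ A]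
          exact AlgHomClass.commutes σ _
        rw [this, sub_add_cancel]
      have h5 : σ (below δ a) η = 0 := by
        have : (σ (below δ a) * (r * y).1) z = 0 := by
          have : σ (below δ a) * (r.1 * y.1) = 0 := by rw [← mul_assoc, h3, zero_mul]
          exact DFunLike.congr_fun this z
        exact this
      rw [e]
      simp [Algebra.algebraMap_eq_smul_one, h5]
    have h5 : δ * ‖η‖ ^ 2 ≤ ‖star u * x * u - σ a‖ * ‖η‖ ^ 2 := by
      have e1 : (star u * x * u - σ a) η = - σ a η := by
        rw [sub_apply, h2, zero_sub]
      have e2 := (star u * x * u - σ a).le_opNorm η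
      rw [e1, norm_neg] at e2
      have e3 := inner_apply_nonneg (map_nonneg σ (above_nonneg a δ)) η
      have e4 : (inner ℂ (σ a η) η).re = (inner ℂ (σ (above δ a) η) η).re + δ * ‖η‖ ^ 2 := by
        rw [h4, inner_add_left, inner_smul_left, inner_self_eq_norm_sq_to_K]
        norm_cast
        rw [Complex.add_re, Complex.conj_ofReal, Complex.re_ofReal_mul]
        rfl
      have e5 := (Complex.re_le_norm _).trans (norm_inner_le_norm (𝕜 := ℂ) (σ a η) η)
      have e6 := mul_le_mul_of_nonneg_right e2 (norm_nonneg η)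
      nlinarith
    have h6 : ‖η‖ = 0 := by
      by_contra h0
      have : 0 < ‖η‖ ^ 2 := by positivity
      nlinarith
    simpa using h6
  obtain ⟨v, h1, h2, h3, h4⟩ := VNRing.polar (p * u' * r)
  have e := (IsSupp.of_polar h1 h2 h3).unique key
  refine ⟨v * star v, ⟨v, e, rfl, by rw [← e, h1]⟩, ?_⟩
  have := h4 (1 - p) (by rw [← mul_assoc, ← mul_assoc, sub_mul, hp.proj.mm]; simp)
  rw [sub_mul, one_mul, sub_eq_zero] at this
  rw [← mul_assoc, ← this]

theorem supp_le (hσ : ∀ a, σ a ∈ M) {x : H →L[ℂ] H} (hx : x ∈ M) {a : A} (ha : 0 ≤ a)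
    (h : ∀ δ > 0, ∃ u ∈ M, ‖star u * x * u - σ a‖ < δ)
    {p q : M} (hp : IsSupp (⟨x, hx⟩ : M) p) (hq : IsSupp (⟨σ a, hσ a⟩ : M) q) : Le q p := by
  let δ : ℕ → ℝ := fun n => 1 / (n + 1)
  have hδ : ∀ n, 0 < δ n := fun n => Nat.one_div_pos_of_nat
  choose r hr using fun n => exists_supp (⟨σ (above (δ n) a), hσ _⟩ : M)
  have hinc : Incr r := ⟨fun n => (hr n).proj, fun n => (hr n).le_of_ker (hr (n + 1)) fun x hx =>
    el_mul_eq_zero hσ (above_nonneg _ _)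
      (above_anti a (Nat.one_div_le_one_div n.le_succ)) hx⟩
  obtain ⟨s, hs⟩ := exists_isSup hinc.proj
  have hle := hinc.sup_le hs hp.proj fun n => by
    obtain ⟨u, hu, h'⟩ := h (δ n) (hδ n)
    exact supp_above_le hσ hx hu ha h' hp (hr n)
  refine hle.sub_left hq.proj ?_
  have h1 : ∀ n, (⟨σ (above (δ n) a), hσ _⟩ : M) * s = ⟨σ (above (δ n) a), hσ _⟩ := fun n => by
    have := hs.le n
    have := (hr n).proj.le_symm hs.proj this
    rw [← (hr n).mul, mul_assoc, this]
  have hlim : Tendsto (fun n => σ (above (δ n) a)) atTop (nhds (σ a)) := by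
    refine ((map_continuous σ).tendsto a).comp ?_
    rw [tendsto_iff_norm_sub_tendsto_zero]
    refine squeeze_zero (fun _ => norm_nonneg _) (fun n => ?_)
      tendsto_one_div_add_atTop_nhds_zero_nat
    rw [norm_sub_rev]
    exact norm_sub_above_le ha (hδ n).le
  have h2 : (⟨σ a, hσ a⟩ : M) * s = ⟨σ a, hσ a⟩ := by
    refine Subtype.ext (tendsto_nhds_unique (hlim.mul_const s.1) ?_)
    refine hlim.congr fun n => ?_
    exact (congrArg Subtype.val (h1 n)).symm
  have h3 : q * (1 - s) = 0 := hq.least _ (by rw [mul_sub, mul_one, h2, sub_self])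
  rw [mul_sub, mul_one, sub_eq_zero] at h3
  have h4 := congrArg star h3
  rw [star_mul, hq.proj.st, hs.proj.st] at h4
  exact h4.symm

end VN

namespace VN

section
variable {B : Type*} [CStarAlgebra B]

theorem exists_path_of_norm_lt {u : B} (hu : u ∈ unitary B) (h : ‖u - 1‖ < 2) :
    ∃ c : ℝ → B, Continuous c ∧ (∀ s, c s ∈ unitary B) ∧ (∀ s ≤ 0, c s = 1) ∧
      (∀ s ≥ 1, c s = u) ∧ ∀ y, Commute u y → Commute (star u) y → ∀ s, Commute (c s) y := by
  let v : unitary B := ⟨u, hu⟩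
  let k := Unitary.argSelfAdjoint v
  let σ : ℝ → ℝ := fun s => max 0 (min s 1)
  have hσ : Continuous σ := by fun_prop
  refine ⟨fun s => (selfAdjoint.expUnitary (σ s • k) : unitary B), ?_, fun s => Subtype.prop _,
    fun s hs => ?_, fun s hs => ?_, fun y h1 h2 s => ?_⟩
  · exact continuous_subtype_val.comp (selfAdjoint.continuous_expUnitary.comp (by fun_prop))
  · have : σ s = 0 := by
      simp only [σ]
      rw [max_eq_left ((min_le_left _ _).trans hs)]
    change ((selfAdjoint.expUnitary (σ s • k) : unitary B) : B) = 1
    rw [this, zero_smul, selfAdjoint.expUnitary_zero]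
    rfl
  · have : σ s = 1 := by
      simp only [σ]
      rw [min_eq_right hs, max_eq_right zero_le_one]
    change ((selfAdjoint.expUnitary (σ s • k) : unitary B) : B) = u
    rw [this, one_smul, expUnitary_argSelfAdjoint (u := v) h]
  · change Commute ((selfAdjoint.expUnitary (σ s • k) : unitary B) : B) y
    rw [selfAdjoint.expUnitary_coe]
    have hk : Commute (k : B) y := by
      rw [Unitary.argSelfAdjoint_coe]
      exact Commute.cfc h1 h2 _
    let +nondep : NormedAlgebra ℚ B := .restrictScalars ℚ ℂ B
    refine Commute.exp_left (Commute.smul_left ?_ _)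
    exact Commute.smul_left hk (σ s)

theorem exists_path_of_re_nonneg [PartialOrder B] [StarOrderedRing B] {u : B} (hu : u ∈ unitary B)
    (h : 0 ≤ u + star u) :
    ∃ c : ℝ → B, Continuous c ∧ (∀ s, c s ∈ unitary B) ∧ (∀ s ≤ 0, c s = 1) ∧
      (∀ s ≥ 1, c s = u) ∧ ∀ y, Commute u y → Commute (star u) y → ∀ s, Commute (c s) y := by
  refine exists_path_of_norm_lt hu ?_
  have h1 : star (u - 1) * (u - 1) = algebraMap ℝ B 2 - (u + star u) := by
    have : star u * u = 1 := hu.1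
    rw [star_sub, star_one, sub_mul, mul_sub, this, map_ofNat]
    rw [← one_add_one_eq_two]
    simp only [mul_one, one_mul]
    abel
  have h2 : ‖star (u - 1) * (u - 1)‖ ≤ 2 := by
    refine (CStarAlgebra.norm_le_norm_of_nonneg_of_le (star_mul_self_nonneg _)
      (h1.le.trans (sub_le_self _ h))).trans ?_
    nontriviality B
    rw [norm_algebraMap']
    norm_num
  rw [CStarRing.norm_star_mul_self] at h2
  nlinarith [norm_nonneg (u - 1)]

end

variable {H : Type*} [NormedAddCommGroup H] [InnerProductSpace ℂ H] [CompleteSpace H]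

/-- All bounded operators. -/
noncomputable def full (H : Type*) [NormedAddCommGroup H] [InnerProductSpace ℂ H] [CompleteSpace H] :
    VonNeumannAlgebra H where
  toStarSubalgebra := ⊤
  centralizer_centralizer' := by
    refine Set.eq_univ_of_forall fun x => ?_
    intro y hy
    exact (hy x (Set.mem_univ _)).symm

theorem exists_supp_op (t : H →L[ℂ] H) : ∃ p, IsSupp t p := by
  obtain ⟨v, -, h1, h2, h3, -⟩ := exists_polar_vn (full H) (t := t) trivial
  exact ⟨_, .of_polar h1 h2 h3⟩

theorem IsSupp.commute' {R : Type*} [Ring R] [StarRing R] {t s p : R} (h : IsSupp t p)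
    (hc : Commute t s) (hc' : Commute t (star s)) : Commute p s := by
  have h0 : ∀ {s}, Commute t s → p * (s * (1 - p)) = 0 := fun {s} hc => h.least _ (by
    rw [← mul_assoc, hc.eq, mul_assoc, mul_sub, h.mul, mul_one, sub_self, mul_zero])
  have h1 := h0 hc
  rw [mul_sub, mul_sub, mul_one, sub_eq_zero] at h1
  have h2 := h0 hc'
  rw [mul_sub, mul_sub, mul_one, sub_eq_zero] at h2
  have h3 := congrArg star h2
  simp only [star_mul, star_star, h.proj.st] at h3
  exact h1.trans (by rw [← mul_assoc, ← h3])

theorem mix_mul_mix {R : Type*} [Ring R] {e w w' : R} (ee : e * e = e) (hw : Commute e w)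
    (h : w * w' = 1) : (e * w + (1 - e)) * (e * w' + (1 - e)) = 1 := by
  have h2 : w * (e * w') = e := by rw [← mul_assoc, ← hw.eq, mul_assoc, h, mul_one]
  have h3 : e * (e * w') = e * w' := by rw [← mul_assoc, ee]
  simp only [mul_add, add_mul, mul_sub, sub_mul, mul_one, one_mul, mul_assoc, h2, h3, ee, hw.eq]
  abel

theorem exists_unitary_path {w : H →L[ℂ] H} (hw : w ∈ unitary (H →L[ℂ] H)) :
    ∃ c : ℝ → H →L[ℂ] H, Continuous c ∧ (∀ s, c s ∈ unitary (H →L[ℂ] H)) ∧ (∀ s ≤ 0, c s = 1) ∧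
      (∀ s ≥ 1, c s = w) ∧ ∀ y, Commute w y → Commute (star w) y → ∀ s, Commute (c s) y := by
  have w1 : star w * w = 1 := hw.1
  have w2 : w * star w = 1 := hw.2
  let k : H →L[ℂ] H := - (Complex.I • (w - star w))
  have hk : IsSelfAdjoint k := by
    rw [IsSelfAdjoint]
    simp only [k, star_neg, star_smul, star_sub, star_star]
    simp only [Complex.star_def, Complex.conj_I, smul_sub, neg_smul]
    abel
  obtain ⟨e, he⟩ := exists_supp_op (above 0 k)
  have hkt : k = above 0 k - below 0 k := by simpa using (above_sub_below hk 0).symm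
  have hn : e * below 0 k = 0 := he.least _ (above_mul_below k 0)
  have hck : ∀ y, Commute w y → Commute (star w) y → Commute k y := fun y h1 h2 =>
    ((h1.sub_left h2).smul_left _).neg_left
  have hce : ∀ y, Commute w y → Commute (star w) y → Commute e y := by
    intro y h1 h2
    have a1 : Commute (above 0 k) y := hk.commute_cfc (hck y h1 h2) _
    have a2 : Commute (above 0 k) (star y) := hk.commute_cfc (hck _ ?_ ?_) _
    · exact he.commute' a1 a2
    · simpa using h2.star_star
    · simpa using h1.star_star
  have hst : star (above 0 k) = above 0 k := (above_nonneg k 0).isSelfAdjoint.star_eq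
  have het : e * above 0 k = above 0 k := by
    simpa [hst, he.proj.st] using congrArg star he.mul
  have hek : e * k = above 0 k := by
    rw [hkt, mul_sub, hn, sub_zero, ← hkt, het]
  have hwe : Commute e w := hce w (.refl w) (by rw [Commute, SemiconjBy, w1, w2])
  have hwe' : Commute e (star w) := hce _ (by rw [Commute, SemiconjBy, w1, w2]) (.refl _)
  have hee := he.proj.mm
  have hes := he.proj.st
  let u₁ : H →L[ℂ] H := (-Complex.I) • (e * w + (1 - e))
  let u₂ : H →L[ℂ] H := Complex.I • ((1 - e) * w + e)
  have hs₁ : star u₁ = Complex.I • (e * star w + (1 - e)) := by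
    simp only [u₁, star_smul, star_add, star_mul, star_sub, star_one, star_neg, Complex.star_def,
      Complex.conj_I, neg_neg, hes, hwe'.eq]
  have hs₂ : star u₂ = (-Complex.I) • ((1 - e) * star w + e) := by
    simp only [u₂, star_smul, star_add, star_mul, star_sub, star_one, Complex.star_def,
      Complex.conj_I, hes, ((Commute.one_left (star w)).sub_left hwe').eq]
  have hff : (1 - e) * (1 - e) = 1 - e := by rw [mul_sub, sub_mul, sub_mul, hee]; simp
  have hwf : Commute (1 - e) w := (Commute.one_left w).sub_left hwe
  have hwf' : Commute (1 - e) (star w) := (Commute.one_left _).sub_left hwe'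
  have hu₁ : u₁ ∈ unitary (H →L[ℂ] H) := by
    rw [Unitary.mem_iff, hs₁]
    constructor
    · simp only [u₁, smul_mul_smul_comm, mix_mul_mix hee hwe' w1]
      simp
    · simp only [u₁, smul_mul_smul_comm, mix_mul_mix hee hwe w2]
      simp
  have hu₂ : u₂ ∈ unitary (H →L[ℂ] H) := by
    have m1 := mix_mul_mix hff hwf' w1
    have m2 := mix_mul_mix hff hwf w2
    rw [sub_sub_cancel] at m1 m2
    rw [Unitary.mem_iff, hs₂]
    constructor
    · simp only [u₂, smul_mul_smul_comm, m1]
      simp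
    · simp only [u₂, smul_mul_smul_comm, m2]
      simp
  have hr₁ : u₁ + star u₁ = above 0 k := by
    rw [← hek, hs₁]
    simp only [u₁, k, mul_neg, mul_smul_comm, mul_sub, smul_add, neg_smul, smul_sub]
    abel
  have hr₂ : u₂ + star u₂ = below 0 k := by
    have : below 0 k = e * k - k := by
      rw [hek, eq_sub_iff_add_eq, eq_sub_iff_add_eq'.mp hkt]

    rw [this, hs₂]
    simp only [u₂, k, mul_neg, mul_smul_comm, sub_mul, one_mul, mul_sub, smul_add, neg_smul,
      smul_sub]
    abel
  obtain ⟨c₁, a1, a2, a3, a4, a5⟩ := exists_path_of_re_nonneg hu₁ (hr₁ ▸ above_nonneg k 0)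
  obtain ⟨c₂, b1, b2, b3, b4, b5⟩ := exists_path_of_re_nonneg hu₂ (hr₂ ▸ below_nonneg k 0)
  refine ⟨fun s => c₁ s * c₂ s, a1.mul b1, fun s => mul_mem (a2 s) (b2 s), fun s hs => ?_,
    fun s hs => ?_, fun y h1 h2 s => (a5 y ?_ ?_ s).mul_left (b5 y ?_ ?_ s)⟩
  · simp only [a3 s hs, b3 s hs, mul_one]
  · simp only [a4 s hs, b4 s hs]
    have e1 : e * w * ((1 - e) * w) = 0 := by
      rw [hwe.eq, mul_assoc, ← mul_assoc e, mul_sub, mul_one, hee, sub_self, zero_mul, mul_zero]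
    have e2 : e * w * e = e * w := by rw [mul_assoc, ← hwe.eq, ← mul_assoc, hee]
    have e3 : (1 - e) * ((1 - e) * w) = (1 - e) * w := by rw [← mul_assoc, hff]
    have e4 : (1 - e) * e = 0 := by rw [sub_mul, one_mul, hee, sub_self]
    simp only [u₁, u₂, smul_mul_smul_comm, add_mul, mul_add, e1, e2, e3, e4]
    simp [sub_mul]
  all_goals have h3 := hce y h1 h2
  all_goals have h4 : Commute (1 - e) y := (Commute.one_left y).sub_left h3
  · exact ((h3.mul_left h1).add_left h4).smul_left _
  · rw [hs₁]; exact ((h3.mul_left h2).add_left h4).smul_left _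
  · exact ((h4.mul_left h1).add_left h3).smul_left _
  · rw [hs₂]; exact ((h4.mul_left h2).add_left h3).smul_left _

end VN

namespace VN

section
variable {B : Type*} [CStarAlgebra B] [PartialOrder B] [StarOrderedRing B]

theorem above_one (h : B) (h0 : 0 ≤ h) (h1 : h ≤ 1) : above 1 h = 0 := by
  have hh : IsSelfAdjoint h := h0.isSelfAdjoint
  rw [above, ← cfc_const_zero ℝ h]
  refine cfc_congr fun t ht => max_eq_right ?_
  have := (le_algebraMap_iff_spectrum_le (r := (1 : ℝ)) (a := h)).1 (by simpa using h1) t ht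
  linarith

theorem below_zero (h : B) (h0 : 0 ≤ h) : below 0 h = 0 := by
  rw [below, ← cfc_const_zero ℝ h]
  refine cfc_congr fun t ht => max_eq_right ?_
  have := spectrum_nonneg_of_nonneg h0 ht
  linarith

theorem le_smul_of_mul_eq_zero {c : ℝ} {d e : B} (he : IsStarProjection e) (hd : d ≤ c • (1 : B))
    (hs : IsSelfAdjoint d) (h : d * (1 - e) = 0) : d ≤ c • e := by
  have h1 : d * e = d := by rw [mul_sub, mul_one, sub_eq_zero] at h; exact h.symm
  have h2 : star e * d = d := by simpa [hs.star_eq] using congrArg star h1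
  have := star_left_conjugate_le_conjugate hd e
  rw [h2, h1, mul_smul_comm, smul_mul_assoc, mul_one, he.isSelfAdjoint.star_eq,
    he.isIdempotentElem.eq] at this
  exact this

theorem norm_avg_sub_le {m : ℕ} (hm : 0 < m) {x : B} {p n E : ℕ → B}
    (hpn : ∀ i, p i - n i = x - algebraMap ℝ B (i / m)) (hp : ∀ i, 0 ≤ p i) (hn : ∀ i, 0 ≤ n i)
    (hp' : Antitone p) (hn' : Monotone n) (h0 : n 0 = 0) (h1 : p m = 0)
    (hE : ∀ i, IsStarProjection (E i)) (hpE : ∀ i, (1 - E i) * p i = 0)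
    (hnE : ∀ i, n i * E i = 0) : ‖(1 / m : ℝ) • (∑ i ∈ Finset.range m, E i) - x‖ ≤ 1 / m := by
  set c : ℝ := 1 / m with hc
  have c0 : 0 ≤ c := by positivity
  have hd : ∀ i, p i - p (i + 1) = c • 1 - (n (i + 1) - n i) := by
    intro i
    have a1 := hpn i
    have a2 := hpn (i + 1)
    have : algebraMap ℝ B ((i + 1 : ℕ) / m) = algebraMap ℝ B (i / m) + c • 1 := by
      rw [← Algebra.algebraMap_eq_smul_one, ← map_add, hc]
      congr 1
      push_cast
      ring
    rw [this] at a2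
    rw [sub_eq_iff_eq_add] at a1 a2
    rw [a1, a2]
    abel
  have hle : ∀ i, p i - p (i + 1) ≤ c • E i := by
    intro i
    have hz : ∀ j, i ≤ j → p j * (1 - E i) = 0 := fun j hj => by
      refine mul_eq_zero_of_le (hp j) (hp' hj) ?_
      simpa [(hE i).isSelfAdjoint.star_eq, (hp i).isSelfAdjoint.star_eq] using congrArg star (hpE i)
    refine le_smul_of_mul_eq_zero (hE i) ?_ ?_ ?_
    · rw [hd]
      exact sub_le_self _ (sub_nonneg.2 (hn' i.le_succ))
    · exact (hp _).isSelfAdjoint.sub (hp _).isSelfAdjoint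
    · rw [sub_mul, hz i le_rfl, hz _ i.le_succ, sub_zero]
  have hge : ∀ i, c • E (i + 1) ≤ p i - p (i + 1) := by
    intro i
    have hz : ∀ j, j ≤ i + 1 → n j * E (i + 1) = 0 := fun j hj =>
      mul_eq_zero_of_le (hn j) (hn' hj) (hnE _)
    have : n (i + 1) - n i ≤ c • (1 - E (i + 1)) := by
      refine le_smul_of_mul_eq_zero (hE _).one_sub ?_ ?_ ?_
      · have := sub_nonneg.2 (hp' i.le_succ)
        rw [hd, sub_nonneg] at this
        exact this
      · exact (hn _).isSelfAdjoint.sub (hn _).isSelfAdjoint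
      · rw [sub_sub_cancel, sub_mul, hz _ le_rfl, hz _ i.le_succ, sub_zero]
    rw [hd, le_sub_comm]
    rwa [smul_sub] at this
  have hx : x = p 0 := by
    have := hpn 0
    simpa [h0] using this.symm
  have hs : ∑ i ∈ Finset.range m, (p i - p (i + 1)) = x := by
    rw [Finset.sum_range_sub', h1, sub_zero, hx]
  have l1 : 0 ≤ c • (∑ i ∈ Finset.range m, E i) - x := by
    rw [sub_nonneg, ← hs, Finset.smul_sum]
    exact Finset.sum_le_sum fun i _ => hle i
  have l2 : c • (∑ i ∈ Finset.range m, E i) - x ≤ algebraMap ℝ B c := by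
    obtain ⟨k, rfl⟩ : ∃ k, m = k + 1 := ⟨m - 1, by omega⟩
    rw [sub_le_iff_le_add, Finset.smul_sum, Finset.sum_range_succ', add_comm]
    refine add_le_add ?_ ?_
    · rw [Algebra.algebraMap_eq_smul_one, ← sub_nonneg, ← smul_sub]
      exact smul_nonneg c0 (hE 0).one_sub.nonneg
    · refine (Finset.sum_le_sum fun i _ => hge i).trans ?_
      rw [← hs, Finset.sum_range_succ]
      exact le_add_of_nonneg_right (sub_nonneg.2 (hp' k.le_succ))
  refine (CStarAlgebra.norm_le_norm_of_nonneg_of_le l1 l2).trans ?_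
  rcases subsingleton_or_nontrivial B with hB | hB
  · rw [Subsingleton.elim (algebraMap ℝ B c) 0, norm_zero]
    exact c0
  rw [norm_algebraMap', Real.norm_of_nonneg c0]

end

theorem norm_avg_sub_map_le {A B : Type*} [CStarAlgebra A] [PartialOrder A] [StarOrderedRing A]
    [CStarAlgebra B] [PartialOrder B] [StarOrderedRing B] (σ : A →⋆ₐ[ℂ] B) {h : A} (h0 : 0 ≤ h)
    (h1 : h ≤ 1) {m : ℕ} (hm : 0 < m) {E : ℕ → B} (hE : ∀ i, IsStarProjection (E i))
    (ha : ∀ i : ℕ, (1 - E i) * σ (above (i / m) h) = 0)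
    (hb : ∀ i : ℕ, σ (below (i / m) h) * E i = 0) :
    ‖(1 / m : ℝ) • (∑ i ∈ Finset.range m, E i) - σ h‖ ≤ 1 / m := by
  have hm' : (0 : ℝ) < m := by exact_mod_cast hm
  refine norm_avg_sub_le hm (p := fun i => σ (above (i / m) h)) (n := fun i => σ (below (i / m) h))
    (fun i => ?_) (fun i => map_nonneg σ (above_nonneg h _)) (fun i => map_nonneg σ (below_nonneg h _))
    (fun i j hij => OrderHomClass.mono σ (above_anti h ?_))
    (fun i j hij => OrderHomClass.mono σ (below_mono h ?_)) ?_ ?_ hE ha hb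
  · rw [← map_sub, above_sub_below h0.isSelfAdjoint, map_sub]
    congr 1
    rw [Algebra.algebraMap_eq_smul_one, Algebra.algebraMap_eq_smul_one, ← Complex.coe_smul,
      ← Complex.coe_smul, map_smul, map_one]
  · gcongr
  · gcongr
  · simp [below_zero h h0]
  · simp [hm'.ne', above_one h h0 h1]

end VN

namespace VN

section
variable [CStarAlgebra A] [NormedAddCommGroup H] [InnerProductSpace ℂ H] [CompleteSpace H]
  {M : VonNeumannAlgebra H} {π : A →⋆ₐ[ℂ] (H →L[ℂ] H)}

theorem approx_of_mem_closure {f : A → H →L[ℂ] H} (hf : f ∈ closure (unitaryOrbitVN M π)) (a : A)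
    {δ : ℝ} (hδ : 0 < δ) : ∃ u ∈ M, u ∈ unitary (H →L[ℂ] H) ∧ ‖star u * π a * u - f a‖ < δ := by
  obtain ⟨g, hg, u, h1, h2, rfl⟩ := mem_closure_iff_nhds.1 hf
    ((fun f => f a) ⁻¹' Metric.ball (f a) δ)
    ((continuous_apply a).continuousAt.preimage_mem_nhds (Metric.ball_mem_nhds _ hδ))
  exact ⟨u, h1, h2, by simpa [dist_eq_norm] using hg⟩

theorem isClosed_vn (M : VonNeumannAlgebra H) : IsClosed {x | x ∈ M} := by
  have : {x | x ∈ M} = ⋂ g ∈ M.commutant, {x : H →L[ℂ] H | g * x = x * g} := by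
    ext x
    simp only [Set.mem_iInter]
    exact mem_vn_iff
  rw [this]
  exact isClosed_iInter fun g => isClosed_iInter fun _ =>
    isClosed_eq (by fun_prop) (by fun_prop)

theorem mem_of_mem_closure (hπ : ∀ a, π a ∈ M) {f : A → H →L[ℂ] H}
    (hf : f ∈ closure (unitaryOrbitVN M π)) (a : A) : f a ∈ M := by
  refine closure_minimal (t := (fun f => f a) ⁻¹' {x | x ∈ M}) ?_
    ((isClosed_vn M).preimage (continuous_apply a)) hf
  rintro _ ⟨u, h1, h2, rfl⟩
  exact mul_mem (mul_mem (star_mem h1) (hπ a)) h1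

theorem exists_hom_of_mem_closure {f : A → H →L[ℂ] H} (hf : f ∈ closure (unitaryOrbitVN M π)) :
    ∃ ρ : A →⋆ₐ[ℂ] (H →L[ℂ] H), ⇑ρ = f := by
  have key : ∀ {s : Set (A → H →L[ℂ] H)}, IsClosed s →
      (∀ u ∈ unitary (H →L[ℂ] H), (fun a => star u * π a * u) ∈ s) → f ∈ s := by
    intro s hs h
    refine closure_minimal ?_ hs hf
    rintro _ ⟨u, -, hu, rfl⟩
    exact h u hu
  have c : ∀ a : A, Continuous fun f : A → H →L[ℂ] H => f a := fun a => continuous_apply a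
  exact ⟨{ toFun := f
           map_one' := key (s := {f | f 1 = 1}) (isClosed_eq (c _) continuous_const)
             fun u hu => by simp [hu.1]
           map_mul' := fun x y => key (s := {f | f (x * y) = f x * f y})
             (isClosed_eq (c _) ((c _).mul (c _)))
             fun u hu => by simp [mul_assoc, asc hu.2]
           map_zero' := key (s := {f | f 0 = 0}) (isClosed_eq (c _) continuous_const)
             fun u hu => by simp
           map_add' := fun x y => key (s := {f | f (x + y) = f x + f y})
             (isClosed_eq (c _) ((c _).add (c _)))
             fun u hu => by simp [mul_add, add_mul]
           commutes' := fun r => key (s := {f | f (algebraMap ℂ A r) = algebraMap ℂ _ r})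
             (isClosed_eq (c _) continuous_const)
             fun u hu => by
               simp only [Set.mem_ofPred_eq, Algebra.algebraMap_eq_smul_one, map_smul, map_one,
                 mul_smul_comm, smul_mul_assoc, mul_one, hu.1]
           map_star' := fun x => key (s := {f | f (star x) = star (f x)})
             (isClosed_eq (c _) (c _).star)
             fun u hu => by simp [mul_assoc, map_star] }, rfl⟩

end

section
variable [CommCStarAlgebra A] [PartialOrder A] [StarOrderedRing A] [NormedAddCommGroup H]
  [InnerProductSpace ℂ H] [CompleteSpace H] {M : VonNeumannAlgebra H}
  {π ρ : A →⋆ₐ[ℂ] (H →L[ℂ] H)}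

theorem eqv_supp (hπ : ∀ a, π a ∈ M) (hρ : ∀ a, ρ a ∈ M)
    (h : ⇑ρ ∈ closure (unitaryOrbitVN M π)) {a : A} (ha : 0 ≤ a) {p q : M}
    (hp : IsSupp (⟨π a, hπ a⟩ : M) p) (hq : IsSupp (⟨ρ a, hρ a⟩ : M) q) : Eqv p q := by
  refine Le.antisymm ?_ ?_
  · refine supp_le hπ (hρ a) ha (fun δ hδ => ?_) hq hp
    obtain ⟨u, h1, h2, h3⟩ := approx_of_mem_closure h a hδ
    refine ⟨star u, star_mem h1, ?_⟩
    rw [star_star]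
    have : u * ρ a * star u - π a = u * (ρ a - star u * π a * u) * star u := by
      have e := h2.2
      simp [mul_sub, sub_mul, mul_assoc, e, asc e]
    rw [this]
    have : ‖u * (ρ a - star u * π a * u) * star u‖ = ‖ρ a - star u * π a * u‖ := by
      rw [CStarRing.norm_mul_mem_unitary _ (Unitary.star_mem h2),
        CStarRing.norm_mem_unitary_mul _ h2]
    rwa [this, norm_sub_rev]
  · refine supp_le hρ (hπ a) ha (fun δ hδ => ?_) hp hq
    obtain ⟨u, h1, h2, h3⟩ := approx_of_mem_closure h a hδ
    exact ⟨u, h1, h3⟩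

end

end VN

namespace VN

theorem countable_mvPolynomial (X : Type) [Countable X] : Countable (MvPolynomial X ℕ) := by
  rw [← Cardinal.mk_le_aleph0_iff]
  refine MvPolynomial.cardinalMk_le_max.trans (max_le (max_le ?_ ?_) le_rfl)
  · simp
  · exact Cardinal.mk_le_aleph0

theorem aeval_nonneg {A X : Type*} [CommCStarAlgebra A] [PartialOrder A] [StarOrderedRing A]
    {x : X → A} (hx : ∀ i, 0 ≤ x i) (p : MvPolynomial X ℕ) : 0 ≤ MvPolynomial.aeval x p := by
  induction p using MvPolynomial.induction_on with
  | C a => simp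
  | add p q hp hq => rw [map_add]; exact add_nonneg hp hq
  | mul_X p n hp =>
    rw [map_mul, MvPolynomial.aeval_X]
    exact (Commute.all _ _).mul_nonneg hp (hx n)

variable {A H : Type*} [CommCStarAlgebra A] [PartialOrder A] [StarOrderedRing A]
  [NormedAddCommGroup H] [InnerProductSpace ℂ H] [CompleteSpace H] {M : VonNeumannAlgebra H}
  {π ρ : A →⋆ₐ[ℂ] (H →L[ℂ] H)}

theorem one_sub_mul_eq_zero (hπ : ∀ a, π a ∈ M) {a : A} (ha : 0 ≤ a) {p E : M}
    (hp : IsSupp (⟨π a, hπ a⟩ : M) p) (h : (1 - E) * p = 0) : (1 - (E : H →L[ℂ] H)) * π a = 0 := by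
  have hst : star (⟨π a, hπ a⟩ : M) = ⟨π a, hπ a⟩ :=
    Subtype.ext (map_nonneg π ha).isSelfAdjoint.star_eq
  have h1 : p * (⟨π a, hπ a⟩ : M) = ⟨π a, hπ a⟩ := by
    simpa [hst, hp.proj.isSelfAdjoint.star_eq] using congrArg star hp.mul
  have h2 : (1 - E) * (⟨π a, hπ a⟩ : M) = 0 := by rw [← h1, ← mul_assoc, h, zero_mul]
  exact congrArg Subtype.val h2

theorem mul_eq_zero_of_supp (hπ : ∀ a, π a ∈ M) {a : A} {p E : M}
    (hp : IsSupp (⟨π a, hπ a⟩ : M) p) (h : p * E = 0) : π a * (E : H →L[ℂ] H) = 0 := by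
  have h2 : (⟨π a, hπ a⟩ : M) * E = 0 := by rw [← hp.mul, mul_assoc, h, mul_zero]
  exact congrArg Subtype.val h2

theorem supp_mul_supp (hπ : ∀ a, π a ∈ M) {a b : A} (hb : 0 ≤ b) (hab : a * b = 0) {p q : M}
    (hp : IsSupp (⟨π a, hπ a⟩ : M) p) (hq : IsSupp (⟨π b, hπ b⟩ : M) q) : p * q = 0 := by
  have h1 : p * (⟨π b, hπ b⟩ : M) = 0 := hp.least _ (Subtype.ext (by
    change π a * π b = 0
    rw [← map_mul, hab, map_zero]))
  have hst : star (⟨π b, hπ b⟩ : M) = ⟨π b, hπ b⟩ :=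
    Subtype.ext (map_nonneg π hb).isSelfAdjoint.star_eq
  have h2 : (⟨π b, hπ b⟩ : M) * p = 0 := by
    simpa [hst, hp.proj.isSelfAdjoint.star_eq] using congrArg star h1
  simpa [hq.proj.isSelfAdjoint.star_eq, hp.proj.isSelfAdjoint.star_eq] using
    congrArg star (hq.least _ h2)

theorem exists_cut_unitaries (hπ : ∀ a, π a ∈ M) (hρ : ∀ a, ρ a ∈ M)
    (h : ⇑ρ ∈ closure (unitaryOrbitVN M π)) (k : ℕ → A) :
    ∃ (E F : ℕ → H →L[ℂ] H) (u : ℕ → H →L[ℂ] H) (idx : ℕ → ℚ → ℕ),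
      (∀ i, E i ∈ M ∧ IsStarProjection (E i)) ∧ (∀ i, IsStarProjection (F i)) ∧
      (∀ n, u n ∈ M ∧ u n ∈ unitary (H →L[ℂ] H)) ∧ u 0 = 1 ∧
      (∀ n, ∀ i < n, E i * u n = u n * F i) ∧
      (∀ n r, (1 - E (idx n r)) * π (above r (k n)) = 0 ∧ π (below r (k n)) * E (idx n r) = 0) ∧
      ∀ n r, (1 - F (idx n r)) * ρ (above r (k n)) = 0 ∧ ρ (below r (k n)) * F (idx n r) = 0 := by
  have := countable_mvPolynomial (ℕ × ℚ × Bool)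
  let x : ℕ × ℚ × Bool → A := fun i => if i.2.2 then above i.2.1 (k i.1) else below i.2.1 (k i.1)
  have hx : ∀ i, 0 ≤ x i := fun i => by
    simp only [x]
    split_ifs
    exacts [above_nonneg _ _, below_nonneg _ _]
  let val : MvPolynomial (ℕ × ℚ × Bool) ℕ → A := fun V => MvPolynomial.aeval x V
  have hv : ∀ V, 0 ≤ val V := aeval_nonneg hx
  choose P hP using fun V => exists_supp (⟨π (val V), hπ _⟩ : M)
  choose Q hQ using fun V => exists_supp (⟨ρ (val V), hρ _⟩ : M)
  have lP : Lat (· * ·) (· + ·) 0 P := lat_supp hπ hv (fun V W => map_mul _ V W)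
    (fun V W => map_add _ V W) (map_zero _) hP
  have lQ : Lat (· * ·) (· + ·) 0 Q := lat_supp hρ hv (fun V W => map_mul _ V W)
    (fun V W => map_add _ V W) (map_zero _) hQ
  have tP : P 1 = 1 := by
    refine (hP 1).unique ?_
    convert IsSupp.one (R := M)
    simp [val]
  have tQ : Q 1 = 1 := by
    refine (hQ 1).unique ?_
    convert IsSupp.one (R := M)
    simp [val]
  obtain ⟨e, he⟩ := exists_surjective_nat (ℕ × ℚ)
  obtain ⟨E, F, u, hE, hF, hu, hu', h0, hEF, h1, h2, h3, h4⟩ := lP.exists_unitaries lQ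
    (fun V => eqv_supp hπ hρ h (hv V) (hP V) (hQ V)) tP tQ
    (fun n => MvPolynomial.X ((e n).1, (e n).2, true))
  have hproj : ∀ {p : M}, IsStarProjection p → IsStarProjection (p : H →L[ℂ] H) := fun hp =>
    ⟨congrArg Subtype.val hp.isIdempotentElem, congrArg Subtype.val hp.isSelfAdjoint⟩
  have va : ∀ n r, val (MvPolynomial.X (n, r, true)) = above r (k n) := fun n r => by simp [val, x]
  have vb : ∀ n r, val (MvPolynomial.X (n, r, false)) = below r (k n) := fun n r => by
    simp [val, x]
  choose idx hidx using fun n r => he (n, r)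
  refine ⟨fun i => E i, fun i => F i, fun n => u n, idx, fun i => ⟨(E i).2, hproj (hE i)⟩,
    fun i => hproj (hF i), fun n => ⟨(u n).2, congrArg Subtype.val (hu n),
      congrArg Subtype.val (hu' n)⟩, congrArg Subtype.val h0,
      fun n i hi => congrArg Subtype.val (hEF n i hi), fun n r => ?_, fun n r => ?_⟩
  · have a1 := h1 (idx n r)
    have a3 := h3 (idx n r) (MvPolynomial.X (n, r, false))
    simp only [hidx] at a1 a3
    rw [← va, ← vb]
    refine ⟨one_sub_mul_eq_zero hπ (hv _) (hP _) a1, mul_eq_zero_of_supp hπ (hP _) (a3 ?_)⟩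
    refine supp_mul_supp hπ (hv _) ?_ (hP _) (hP _)
    rw [va, vb, mul_comm, above_mul_below]
  · have a1 := h2 (idx n r)
    have a3 := h4 (idx n r) (MvPolynomial.X (n, r, false))
    simp only [hidx] at a1 a3
    rw [← va, ← vb]
    refine ⟨one_sub_mul_eq_zero hρ (hv _) (hQ _) a1, mul_eq_zero_of_supp hρ (hQ _) (a3 ?_)⟩
    refine supp_mul_supp hρ (hv _) ?_ (hQ _) (hQ _)
    rw [va, vb, mul_comm, above_mul_below]

end VN

namespace VN

section
variable {H : Type*} [NormedAddCommGroup H] [InnerProductSpace ℂ H] [CompleteSpace H]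
  {M : VonNeumannAlgebra H}

theorem exists_ray {E F u : ℕ → H →L[ℂ] H} (hE : ∀ i, IsStarProjection (E i))
    (hF : ∀ i, IsStarProjection (F i)) (hu : ∀ n, u n ∈ M ∧ u n ∈ unitary (H →L[ℂ] H))
    (h0 : u 0 = 1) (h : ∀ n, ∀ i < n, E i * u n = u n * F i) :
    ∃ g : ℝ → H →L[ℂ] H, Continuous g ∧ (∀ x, g x ∈ M ∧ g x ∈ unitary (H →L[ℂ] H)) ∧ g 0 = 1 ∧
      ∀ (i : ℕ) (x : ℝ), i + 1 ≤ x → E i * g x = g x * F i := by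
  have u1 : ∀ n, star (u n) * u n = 1 := fun n => (hu n).2.1
  have h' : ∀ n, ∀ i < n, star (u n) * E i = F i * star (u n) := fun n i hi => by
    simpa [(hE i).isSelfAdjoint.star_eq, (hF i).isSelfAdjoint.star_eq] using
      congrArg star (h n i hi)
  let w : ℕ → H →L[ℂ] H := fun n => u (n + 1) * star (u n)
  have hw : ∀ n, w n ∈ unitary (H →L[ℂ] H) := fun n =>
    mul_mem (hu _).2 (Unitary.star_mem (hu n).2)
  have hwM : ∀ n, w n ∈ M := fun n => mul_mem (hu _).1 (star_mem (hu n).1)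
  choose c hc cu c0 c1 cc using fun n => exists_unitary_path (hw n)
  have hcM : ∀ n s, c n s ∈ M := fun n s => mem_vn_iff.2 fun g hg =>
    (cc n g (commutant_comm (hwM n) hg).symm (commutant_comm (star_mem (hwM n)) hg).symm s).eq.symm
  have hcE : ∀ n, ∀ i < n, ∀ s, Commute (c n s) (E i) := by
    intro n i hi s
    have hwE : Commute (w n) (E i) := by
      rw [Commute, SemiconjBy]
      simp only [w]
      rw [mul_assoc, h' n i hi, ← mul_assoc, ← mul_assoc, h _ i (hi.trans n.lt_succ_self)]
    refine cc n _ hwE ?_ s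
    simpa [(hE i).isSelfAdjoint.star_eq] using hwE.star_star
  obtain ⟨G, G0, Gs⟩ : ∃ G : ℕ → ℝ → H →L[ℂ] H, (G 0 = fun _ => 1) ∧
      ∀ n, G (n + 1) = fun x => c n (x - n) * G n x :=
    ⟨fun n => Nat.rec (fun _ => 1) (fun n g x => c n (x - n) * g x) n, rfl, fun _ => rfl⟩
  have Gc : ∀ n, Continuous (G n) := fun n => by
    induction n with
    | zero => rw [G0]; exact continuous_const
    | succ n ih => rw [Gs]; exact ((hc n).comp (by fun_prop)).mul ih
  have Gu : ∀ n x, G n x ∈ M ∧ G n x ∈ unitary (H →L[ℂ] H) := fun n x => by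
    induction n with
    | zero => rw [G0]; exact ⟨one_mem M, one_mem _⟩
    | succ n ih => rw [Gs]; exact ⟨mul_mem (hcM _ _) ih.1, mul_mem (cu _ _) ih.2⟩
  have Gle : ∀ (n N : ℕ) (x : ℝ), n ≤ N → x ≤ n → G N x = G n x := by
    intro n N x hN hx
    induction N, hN using Nat.le_induction with
    | base => rfl
    | succ N hN ih =>
      have : x ≤ N := hx.trans (by exact_mod_cast hN)
      rw [Gs, ← ih]
      simp only
      rw [c0 N _ (by linarith), one_mul]
  have Gge : ∀ (n : ℕ) (x : ℝ), n ≤ x → G n x = u n := by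
    intro n x
    induction n with
    | zero => intro _; rw [G0, h0]
    | succ n ih =>
      intro hx
      push_cast at hx
      rw [Gs]
      simp only
      rw [c1 n _ (by linarith), ih (by linarith), mul_assoc, u1, mul_one]
  have GE : ∀ (i N : ℕ) (x : ℝ), i + 1 ≤ N → (i + 1 : ℝ) ≤ x → E i * G N x = G N x * F i := by
    intro i N x hN hx
    induction N, hN using Nat.le_induction with
    | base => rw [Gge _ _ (by exact_mod_cast hx), h _ _ i.lt_succ_self]
    | succ N hN ih =>
      rw [Gs]
      simp only
      rw [← mul_assoc, ← (hcE N i hN _).eq, mul_assoc, ih, mul_assoc]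
  have hg : ∀ (N : ℕ) (x : ℝ), x ≤ N → G ⌈x⌉₊ x = G N x := fun N x hx =>
    (Gle _ _ _ (Nat.ceil_le.2 hx) (Nat.le_ceil x)).symm
  refine ⟨fun x => G ⌈x⌉₊ x, continuous_iff_continuousAt.2 fun x => ?_, fun x => Gu _ x, ?_,
    fun i x hx => ?_⟩
  · refine ((Gc (⌈x⌉₊ + 1)).continuousAt (x := x)).congr ?_
    have : x < (⌈x⌉₊ + 1 : ℕ) := by
      push_cast
      linarith [Nat.le_ceil x]
    filter_upwards [Iio_mem_nhds this] with y hy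
    exact (hg _ y (le_of_lt hy)).symm
  · simp [G0]
  · refine GE i _ x ?_ hx
    have : ((i + 1 : ℕ) : ℝ) ≤ ⌈x⌉₊ := by
      push_cast
      exact hx.trans (Nat.le_ceil x)
    exact_mod_cast this

theorem norm_conj_unitary {B : Type*} [CStarAlgebra B] {g : B} (hg : g ∈ unitary B) (y : B) :
    ‖star g * y * g‖ = ‖y‖ := by
  rw [CStarRing.norm_mul_mem_unitary _ hg, CStarRing.norm_mem_unitary_mul _ (Unitary.star_mem hg)]

end

section
variable {A B : Type*} [CStarAlgebra A] [CStarAlgebra B] {π ρ : A →⋆ₐ[ℂ] B} {T : Type*}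
  {l : Filter T} {g : T → B}

theorem tendsto_of_mem_closure (hg : ∀ x, g x ∈ unitary B) {s : Set A}
    (h : ∀ a ∈ s, Tendsto (fun x => star (g x) * π a * g x) l (nhds (ρ a))) {a : A}
    (ha : a ∈ closure s) : Tendsto (fun x => star (g x) * π a * g x) l (nhds (ρ a)) := by
  rw [Metric.tendsto_nhds]
  intro ε hε
  obtain ⟨b, hb, hab⟩ := Metric.mem_closure_iff.1 ha (ε / 3) (by positivity)
  filter_upwards [Metric.tendsto_nhds.1 (h b hb) (ε / 3) (by positivity)] with x hx
  rw [dist_eq_norm] at *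
  have : star (g x) * π a * g x - ρ a = star (g x) * π (a - b) * g x +
      (star (g x) * π b * g x - ρ b) - ρ (a - b) := by
    simp only [map_sub, mul_sub, sub_mul]
    abel
  rw [this]
  have h1 : ‖star (g x) * π (a - b) * g x‖ ≤ ‖a - b‖ :=
    (norm_conj_unitary (hg x) _).trans_le (NonUnitalStarAlgHom.norm_apply_le π _)
  have h2 : ‖ρ (a - b)‖ ≤ ‖a - b‖ := NonUnitalStarAlgHom.norm_apply_le ρ _
  linarith [norm_sub_le (star (g x) * π (a - b) * g x + (star (g x) * π b * g x - ρ b))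
    (ρ (a - b)), norm_add_le (star (g x) * π (a - b) * g x) (star (g x) * π b * g x - ρ b)]

theorem tendsto_of_unit_interval [PartialOrder A] [StarOrderedRing A]
    (h : ∀ a : A, 0 ≤ a → a ≤ 1 → Tendsto (fun x => star (g x) * π a * g x) l (nhds (ρ a)))
    (a : A) : Tendsto (fun x => star (g x) * π a * g x) l (nhds (ρ a)) := by
  have ha : a ∈ Submodule.span ℂ {a : A | 0 ≤ a} := by
    rw [CStarAlgebra.span_nonneg]
    trivial
  induction ha using Submodule.span_induction with
  | mem a ha =>
    have hs : ∀ (z : ℂ) (b : A), Tendsto (fun x => star (g x) * π b * g x) l (nhds (ρ b)) →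
        Tendsto (fun x => star (g x) * π (z • b) * g x) l (nhds (ρ (z • b))) := fun z b hb => by
      simpa only [map_smul, mul_smul_comm, smul_mul_assoc] using hb.const_smul z
    rcases eq_or_ne a 0 with rfl | h0
    · simp [tendsto_const_nhds]
    have hn : 0 < ‖a‖ := norm_pos_iff.2 h0
    have := hs (‖a‖ : ℂ) ((‖a‖⁻¹ : ℝ) • a) (h _ (smul_nonneg (by positivity) ha) ?_)
    · rwa [Complex.coe_smul, smul_smul, mul_inv_cancel₀ hn.ne', one_smul] at this
    · rw [← CStarAlgebra.norm_le_one_iff_of_nonneg _ (smul_nonneg (by positivity) ha)]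
      rw [norm_smul, norm_inv, norm_norm, inv_mul_cancel₀ hn.ne']
  | zero => simp [tendsto_const_nhds]
  | add x y _ _ hx hy => simpa only [map_add, mul_add, add_mul] using hx.add hy
  | smul z x _ hx => simpa only [map_smul, mul_smul_comm, smul_mul_assoc] using hx.const_smul z

theorem exists_dense_unit_interval (A : Type*) [CStarAlgebra A] [PartialOrder A]
    [StarOrderedRing A] [TopologicalSpace.SeparableSpace A] :
    ∃ k : ℕ → A, (∀ n, 0 ≤ k n ∧ k n ≤ 1) ∧ ∀ a, 0 ≤ a → a ≤ 1 → a ∈ closure (Set.range k) := by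
  have := UniformSpace.secondCountable_of_separable A
  have : Nonempty {a : A // 0 ≤ a ∧ a ≤ 1} := ⟨⟨0, le_rfl, zero_le_one⟩⟩
  obtain ⟨k, hk⟩ := TopologicalSpace.exists_dense_seq {a : A // 0 ≤ a ∧ a ≤ 1}
  refine ⟨fun n => k n, fun n => (k n).2, fun a h0 h1 => ?_⟩
  have := image_closure_subset_closure_image continuous_subtype_val
    (Set.mem_image_of_mem Subtype.val (hk ⟨a, h0, h1⟩))
  rwa [← Set.range_comp] at this

end

end VN

namespace VN
variable {A H : Type*} [CommCStarAlgebra A]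
  [NormedAddCommGroup H] [InnerProductSpace ℂ H] [CompleteSpace H] {M : VonNeumannAlgebra H}
  {π ρ : A →⋆ₐ[ℂ] (H →L[ℂ] H)}

theorem tendsto_of_cuts [PartialOrder A] [StarOrderedRing A] {E F : ℕ → H →L[ℂ] H}
    {idx : ℕ → ℚ → ℕ} {k : ℕ → A} (hk : ∀ n, 0 ≤ k n ∧ k n ≤ 1)
    (hE : ∀ i, IsStarProjection (E i)) (hF : ∀ i, IsStarProjection (F i))
    (h1 : ∀ n r, (1 - E (idx n r)) * π (above r (k n)) = 0 ∧ π (below r (k n)) * E (idx n r) = 0)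
    (h2 : ∀ n r, (1 - F (idx n r)) * ρ (above r (k n)) = 0 ∧ ρ (below r (k n)) * F (idx n r) = 0)
    {g : ℝ → H →L[ℂ] H} (hg : ∀ x, g x ∈ unitary (H →L[ℂ] H))
    (hEF : ∀ (i : ℕ) (x : ℝ), i + 1 ≤ x → E i * g x = g x * F i) (n : ℕ) :
    Tendsto (fun x => star (g x) * π (k n) * g x) atTop (nhds (ρ (k n))) := by
  rw [Metric.tendsto_nhds]
  intro ε hε
  obtain ⟨m, hm⟩ := exists_nat_one_div_lt (half_pos hε)
  set j : ℕ → ℕ := fun i => idx n (i / (m + 1 : ℕ) : ℚ) with hj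
  have a1 := norm_avg_sub_map_le π (hk n).1 (hk n).2 m.succ_pos (E := fun i => E (j i))
    (fun i => hE _) (fun i => by simpa [hj] using (h1 n (i / (m + 1 : ℕ) : ℚ)).1)
    (fun i => by simpa [hj] using (h1 n (i / (m + 1 : ℕ) : ℚ)).2)
  have a2 := norm_avg_sub_map_le ρ (hk n).1 (hk n).2 m.succ_pos (E := fun i => F (j i))
    (fun i => hF _) (fun i => by simpa [hj] using (h2 n (i / (m + 1 : ℕ) : ℚ)).1)
    (fun i => by simpa [hj] using (h2 n (i / (m + 1 : ℕ) : ℚ)).2)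
  have hev : ∀ᶠ x : ℝ in atTop, ∀ i ∈ Finset.range (m + 1), (j i : ℝ) + 1 ≤ x :=
    (Filter.eventually_all_finset _).2 fun i _ => eventually_ge_atTop _
  filter_upwards [hev] with x hx
  have hc : ∀ i ∈ Finset.range (m + 1), star (g x) * E (j i) * g x = F (j i) := fun i hi => by
    rw [mul_assoc, hEF _ _ (hx i hi), ← mul_assoc, (hg x).1, one_mul]
  have hS : star (g x) * ((1 / (m + 1 : ℕ) : ℝ) • ∑ i ∈ Finset.range (m + 1), E (j i)) * g x =
      (1 / (m + 1 : ℕ) : ℝ) • ∑ i ∈ Finset.range (m + 1), F (j i) := by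
    rw [mul_smul_comm, smul_mul_assoc, Finset.mul_sum, Finset.sum_mul, Finset.sum_congr rfl hc]
  have a3 := norm_conj_unitary (hg x)
    ((1 / (m + 1 : ℕ) : ℝ) • ∑ i ∈ Finset.range (m + 1), E (j i) - π (k n))
  rw [mul_sub, sub_mul, hS] at a3
  rw [dist_eq_norm, norm_sub_rev]
  have hm' : (1 / (m + 1 : ℕ) : ℝ) < ε / 2 := by exact_mod_cast hm
  have a4 := norm_sub_le ((1 / (m + 1 : ℕ) : ℝ) • ∑ i ∈ Finset.range (m + 1), F (j i) -
    star (g x) * π (k n) * g x) ((1 / (m + 1 : ℕ) : ℝ) • ∑ i ∈ Finset.range (m + 1), F (j i) -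
    ρ (k n))
  rw [sub_sub_sub_cancel_left] at a4
  linarith

variable [TopologicalSpace.SeparableSpace A]

theorem exists_asymptotic_ray (hπ : ∀ a, π a ∈ M) (h : ⇑ρ ∈ closure (unitaryOrbitVN M π)) :
    ∃ g : ℝ → H →L[ℂ] H, Continuous g ∧ (∀ x, g x ∈ M ∧ g x ∈ unitary (H →L[ℂ] H)) ∧ g 0 = 1 ∧
      ∀ a, Tendsto (fun x => star (g x) * π a * g x) atTop (nhds (ρ a)) := by
  let _ := CStarAlgebra.spectralOrder A
  have := CStarAlgebra.spectralOrderedRing A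
  obtain ⟨k, hk, hd⟩ := exists_dense_unit_interval A
  obtain ⟨E, F, u, idx, hE, hF, hu, h0, hEF, h1, h2⟩ :=
    exists_cut_unitaries hπ (mem_of_mem_closure hπ h) h k
  obtain ⟨g, gc, gu, g0, gE⟩ := exists_ray (fun i => (hE i).2) hF hu h0 hEF
  refine ⟨g, gc, gu, g0, tendsto_of_unit_interval fun a ha ha' =>
    tendsto_of_mem_closure (fun x => (gu x).2) ?_ (hd a ha ha')⟩
  rintro _ ⟨n, rfl⟩
  exact tendsto_of_cuts hk (fun i => (hE i).2) hF h1 h2 (fun x => (gu x).2) gE n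

theorem exists_strong_path (hπ : ∀ a, π a ∈ M) (h : ⇑ρ ∈ closure (unitaryOrbitVN M π)) :
    ∃ γ : ℝ → H →L[ℂ] H, ContinuousOn γ (Set.Ico 0 1) ∧
      (∀ t, γ t ∈ M ∧ γ t ∈ unitary (H →L[ℂ] H)) ∧ γ 0 = 1 ∧
      ∀ a, Tendsto (fun t => star (γ t) * π a * γ t) (nhdsWithin 1 (Set.Ico 0 1)) (nhds (ρ a)) := by
  obtain ⟨g, gc, gu, g0, gt⟩ := exists_asymptotic_ray hπ h
  refine ⟨fun t => g (t / (1 - t)), gc.comp_continuousOn ?_, fun t => gu _, by simpa using g0,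
    fun a => (gt a).comp ?_⟩
  · refine ContinuousOn.div (by fun_prop) (by fun_prop) fun t ht => ?_
    have := ht.2
    exact (sub_pos.2 this).ne'
  · have h1 : Tendsto (fun t : ℝ => 1 - t) (nhdsWithin 1 (Set.Ico 0 1)) (nhdsWithin 0 (Set.Ioi 0)) := by
      refine tendsto_nhdsWithin_iff.2 ⟨?_, ?_⟩
      · have : Tendsto (fun t : ℝ => 1 - t) (nhds 1) (nhds (1 - 1)) :=
          (continuous_const.sub continuous_id).tendsto 1
        rw [sub_self] at this
        exact this.mono_left nhdsWithin_le_nhds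
      · filter_upwards [self_mem_nhdsWithin] with t ht
        exact sub_pos.2 ht.2
    have h2 : Tendsto (fun t : ℝ => t) (nhdsWithin 1 (Set.Ico 0 1)) (nhds 1) :=
      tendsto_id.mono_left nhdsWithin_le_nhds
    simp only [div_eq_mul_inv]
    exact h2.pos_mul_atTop one_pos (tendsto_inv_nhdsGT_zero.comp h1)

theorem joinedIn_of_mem_closure (hπ : ∀ a, π a ∈ M) (h : ⇑ρ ∈ closure (unitaryOrbitVN M π)) :
    JoinedIn (closure (unitaryOrbitVN M π)) π ρ := by
  classical
  obtain ⟨γ, hc, hu, h0, ht⟩ := exists_strong_path hπ h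
  let f : ℝ → A → H →L[ℂ] H := fun t => if t = 1 then ρ else fun a => star (γ t) * π a * γ t
  have h1 : f 1 = ρ := if_pos rfl
  have hne : ∀ t, t ≠ 1 → f t = fun a => star (γ t) * π a * γ t := fun t ht => if_neg ht
  have hf : ContinuousOn f (Set.Icc 0 1) := by
    refine continuousOn_pi.2 fun a t ht' => ?_
    rcases eq_or_ne t 1 with rfl | hn
    · rw [← Set.Ico_union_right zero_le_one, continuousWithinAt_union]
      refine ⟨?_, continuousWithinAt_singleton⟩
      rw [ContinuousWithinAt, h1]
      refine (ht a).congr' ?_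
      filter_upwards [self_mem_nhdsWithin] with s hs
      rw [hne s hs.2.ne]
    · have hlt : t < 1 := lt_of_le_of_ne ht'.2 hn
      have : ContinuousWithinAt (fun t => star (γ t) * π a * γ t) (Set.Ico 0 1) t :=
        ((((hc.star).mul continuousOn_const).mul hc) t ⟨ht'.1, hlt⟩)
      have h2 : ContinuousWithinAt (fun t => f t a) (Set.Ico 0 1) t :=
        this.congr (fun s hs => by rw [hne s hs.2.ne]) (by rw [hne t hn])
      refine h2.mono_of_mem_nhdsWithin ?_
      filter_upwards [self_mem_nhdsWithin, mem_nhdsWithin_of_mem_nhds (Iio_mem_nhds hlt)] with s a b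
      exact ⟨a.1, b⟩
  refine JoinedIn.ofLine hf ?_ h1 ?_
  · rw [hne 0 zero_ne_one]
    simp [h0]
  · rintro _ ⟨t, -, rfl⟩
    rcases eq_or_ne t 1 with rfl | hn
    · rwa [h1]
    · rw [hne t hn]
      exact subset_closure ⟨γ t, (hu t).1, (hu t).2, rfl⟩

end VN

theorem stmt15 [CommCStarAlgebra A] [TopologicalSpace.SeparableSpace A]
    [NormedAddCommGroup H] [InnerProductSpace ℂ H] [CompleteSpace H]
    (M : VonNeumannAlgebra H) (π : A →⋆ₐ[ℂ] (H →L[ℂ] H)) (hπ : ∀ a, π a ∈ M) :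
    IsPathConnected (closure (unitaryOrbitVN M π)) ∧
    ∀ ρ : A →⋆ₐ[ℂ] (H →L[ℂ] H), ⇑ρ ∈ closure (unitaryOrbitVN M π) →
      StrongInternalPathVN M π ρ := by
  refine ⟨⟨π, subset_closure ⟨1, one_mem M, one_mem _, by simp⟩, fun {f} hf => ?_⟩, fun ρ hρ => ?_⟩
  · obtain ⟨ρ, rfl⟩ := VN.exists_hom_of_mem_closure hf
    exact VN.joinedIn_of_mem_closure hπ hf
  · obtain ⟨γ, hc, hu, -, ht⟩ := VN.exists_strong_path hπ hρ
    exact ⟨γ, hc, fun t _ => hu t, ht⟩
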